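/- Let h ∈ ℤ[x] be an intersective polynomial of degree k ≥ 2, and let c be a real number with 0 < c < 1/log((k²+k)/2). Then there exists a constant C = C(h,c) > 0 such that for every integer N ≥ 16 and every set A ⊆ {1,…,N} satisfying a − a' ≠ h(n) for all distinct pairs a, a' ∈ A and all integers n ≥ 1, one has |A| ≤ C · N · (log N)^{−c·log log log log N}. -/

import Mathlib

/-- A nonzero polynomial `h ∈ ℤ[x]` is *intersective* if for every positive integer `q`
there is a positive integer `n` with `q ∣ h(n)`. -/
def Intersective (h : Polynomial ℤ) : Prop :=
  h ≠ 0 ∧ ∀ q : ℕ, 0 < q → ∃ n : ℕ, 0 < n ∧ (q : ℤ) ∣ h.eval (n : ℤ)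

set_option linter.unusedSectionVars false

section ProductAverages

variable {ι : Type} [Fintype ι] [DecidableEq ι] {Ω : ι → Type} [∀ i, Fintype (Ω i)]

/-- The average of `f` over a finite product space. -/
noncomputable def prodAvg (f : (∀ i, Ω i) → ℝ) : ℝ :=
  (∑ y, f y) / (Fintype.card (∀ i, Ω i) : ℝ)

/-- The average of `f` over the `i`-th coordinate. -/
noncomputable def coordAvg (i : ι) (f : (∀ i, Ω i) → ℝ) (x : ∀ i, Ω i) : ℝ :=
  (∑ t : Ω i, f (Function.update x i t)) / (Fintype.card (Ω i) : ℝ)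

/-- The average of `f` over the coordinates in `S`. -/
noncomputable def partAvg (S : Finset ι) (f : (∀ i, Ω i) → ℝ) (x : ∀ i, Ω i) : ℝ :=
  prodAvg fun y => f (S.piecewise y x)

theorem prodAvg_mono {f g : (∀ i, Ω i) → ℝ} (h : ∀ x, f x ≤ g x) : prodAvg f ≤ prodAvg g := by
  unfold prodAvg
  gcongr
  exact h _

theorem prodAvg_nonneg {f : (∀ i, Ω i) → ℝ} (h : ∀ x, 0 ≤ f x) : 0 ≤ prodAvg f :=
  div_nonneg (Finset.sum_nonneg fun _ _ => h _) (Nat.cast_nonneg _)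

theorem prodAvg_add (f g : (∀ i, Ω i) → ℝ) :
    prodAvg (fun x => f x + g x) = prodAvg f + prodAvg g := by
  simp [prodAvg, Finset.sum_add_distrib, add_div]

theorem prodAvg_sum {κ : Type*} (s : Finset κ) (f : κ → (∀ i, Ω i) → ℝ) :
    prodAvg (fun x => ∑ c ∈ s, f c x) = ∑ c ∈ s, prodAvg (f c) := by
  simp only [prodAvg]
  rw [Finset.sum_comm, Finset.sum_div]

theorem prodAvg_const_mul (a : ℝ) (f : (∀ i, Ω i) → ℝ) :
    prodAvg (fun x => a * f x) = a * prodAvg f := by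
  simp [prodAvg, ← Finset.mul_sum, mul_div_assoc]

theorem prodAvg_mul_const (a : ℝ) (f : (∀ i, Ω i) → ℝ) :
    prodAvg (fun x => f x * a) = prodAvg f * a := by
  simp only [mul_comm _ a, prodAvg_const_mul]

theorem prodAvg_const [∀ i, Nonempty (Ω i)] (a : ℝ) :
    prodAvg (fun _ : ∀ i, Ω i => a) = a := by
  have : (Fintype.card (∀ i, Ω i) : ℝ) ≠ 0 := by exact_mod_cast Fintype.card_ne_zero
  unfold prodAvg
  rw [Finset.sum_const, Finset.card_univ, nsmul_eq_mul]
  field_simp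

theorem abs_prodAvg_le (f : (∀ i, Ω i) → ℝ) : |prodAvg f| ≤ prodAvg fun x => |f x| := by
  unfold prodAvg
  rw [abs_div, Nat.abs_cast]
  gcongr
  exact Finset.abs_sum_le_sum_abs _ _

theorem coordAvg_mono {i : ι} {f g : (∀ i, Ω i) → ℝ} (h : ∀ x, f x ≤ g x) (x : ∀ i, Ω i) :
    coordAvg i f x ≤ coordAvg i g x := by
  unfold coordAvg
  gcongr
  exact h _

theorem coordAvg_sum {κ : Type*} (i : ι) (s : Finset κ) (f : κ → (∀ i, Ω i) → ℝ) (x : ∀ i, Ω i) :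
    coordAvg i (fun x => ∑ c ∈ s, f c x) x = ∑ c ∈ s, coordAvg i (f c) x := by
  simp only [coordAvg]
  rw [Finset.sum_comm, Finset.sum_div]

theorem partAvg_mono {S : Finset ι} {f g : (∀ i, Ω i) → ℝ} (h : ∀ x, f x ≤ g x) (x : ∀ i, Ω i) :
    partAvg S f x ≤ partAvg S g x :=
  prodAvg_mono fun _ => h _

theorem partAvg_nonneg {S : Finset ι} {f : (∀ i, Ω i) → ℝ} (h : ∀ x, 0 ≤ f x) (x : ∀ i, Ω i) :
    0 ≤ partAvg S f x :=
  prodAvg_nonneg fun _ => h _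

theorem partAvg_add (S : Finset ι) (f g : (∀ i, Ω i) → ℝ) (x : ∀ i, Ω i) :
    partAvg S (fun x => f x + g x) x = partAvg S f x + partAvg S g x :=
  prodAvg_add _ _

theorem partAvg_empty [∀ i, Nonempty (Ω i)] (f : (∀ i, Ω i) → ℝ) (x : ∀ i, Ω i) :
    partAvg ∅ f x = f x := by
  simp [partAvg, prodAvg_const]

theorem partAvg_univ (f : (∀ i, Ω i) → ℝ) (x : ∀ i, Ω i) :
    partAvg Finset.univ f x = prodAvg f := by
  simp [partAvg]

/-- Resampling a coordinate does not change a sum over the product space. -/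
theorem sum_sum_update (i : ι) (F : (∀ i, Ω i) → ℝ) :
    ∑ y, ∑ t : Ω i, F (Function.update y i t) = Fintype.card (Ω i) * ∑ y, F y := by
  have h : ∑ p : (∀ i, Ω i) × Ω i, F (Function.update p.1 i p.2)
      = ∑ p : (∀ i, Ω i) × Ω i, F p.1 := by
    refine Finset.sum_nbij' (fun p => (Function.update p.1 i p.2, p.1 i))
      (fun p => (Function.update p.1 i p.2, p.1 i)) ?_ ?_ ?_ ?_ ?_ <;> simp
  rw [Fintype.sum_prod_type, Fintype.sum_prod_type] at h
  rw [h, Finset.mul_sum]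
  simp

theorem piecewise_update_of_notMem {S : Finset ι} {i : ι} (hi : i ∉ S) (y x : ∀ i, Ω i)
    (t : Ω i) : S.piecewise (Function.update y i t) x = S.piecewise y x := by
  ext j
  by_cases hj : j ∈ S
  · have : j ≠ i := fun h => hi (h ▸ hj)
    simp [hj, this]
  · simp [hj]

theorem piecewise_update_right {S : Finset ι} {i : ι} (hi : i ∉ S) (y x : ∀ i, Ω i)
    (t : Ω i) : S.piecewise y (Function.update x i t) = Function.update (S.piecewise y x) i t := by
  ext j
  by_cases hji : j = i
  · subst hji; simp [hi]
  · by_cases hj : j ∈ S <;> simp [hj, hji]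

variable [∀ i, Nonempty (Ω i)]

theorem partAvg_insert' {S : Finset ι} {i : ι} (hi : i ∉ S) (f : (∀ i, Ω i) → ℝ) (x : ∀ i, Ω i) :
    partAvg (insert i S) f x = partAvg S (coordAvg i f) x := by
  have hn : (Fintype.card (Ω i) : ℝ) ≠ 0 := by exact_mod_cast Fintype.card_ne_zero
  simp only [partAvg, prodAvg, coordAvg]
  congr 1
  rw [← Finset.sum_div, eq_div_iff hn, mul_comm, ← sum_sum_update i]
  refine Finset.sum_congr rfl fun y _ => Finset.sum_congr rfl fun t _ => ?_
  rw [Finset.piecewise_insert, piecewise_update_of_notMem hi, Function.update_self]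

theorem coordAvg_partAvg {S : Finset ι} {i : ι} (hi : i ∉ S) (f : (∀ i, Ω i) → ℝ) (x : ∀ i, Ω i) :
    coordAvg i (partAvg S f) x = partAvg S (coordAvg i f) x := by
  simp only [partAvg, prodAvg, coordAvg, piecewise_update_right hi]
  rw [← Finset.sum_div, ← Finset.sum_div, Finset.sum_comm, div_right_comm]

theorem partAvg_insert {S : Finset ι} {i : ι} (hi : i ∉ S) (f : (∀ i, Ω i) → ℝ) (x : ∀ i, Ω i) :
    partAvg (insert i S) f x = coordAvg i (partAvg S f) x := by
  rw [partAvg_insert' hi, coordAvg_partAvg hi]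

theorem partAvg_update {S : Finset ι} {i : ι} (hi : i ∉ S) (f : (∀ i, Ω i) → ℝ) (x : ∀ i, Ω i)
    (t : Ω i) :
    partAvg S (fun z => f (Function.update z i t)) x = partAvg S f (Function.update x i t) := by
  simp only [partAvg, piecewise_update_right hi]

/-- Averaging a partial average over everything gives the full average. -/
theorem prodAvg_partAvg (S : Finset ι) (f : (∀ i, Ω i) → ℝ) :
    prodAvg (partAvg S f) = prodAvg f := by
  induction S using Finset.induction_on generalizing f with
  | empty => congr 1; ext x; exact partAvg_empty f x
  | insert i S hi ih =>
    have : partAvg (insert i S) f = partAvg S (coordAvg i f) := by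
      ext x; exact partAvg_insert' hi f x
    rw [this, ih]
    have hn : (Fintype.card (Ω i) : ℝ) ≠ 0 := by exact_mod_cast Fintype.card_ne_zero
    simp only [prodAvg, coordAvg]
    rw [← Finset.sum_div, sum_sum_update, mul_div_cancel_left₀ _ hn]

end ProductAverages

/-- Second-order Taylor bound for a power. -/
theorem abs_add_pow_sub_le (u y w : ℝ) (hu : |u| ≤ w) (hy : |y| ≤ w) (n : ℕ) :
    |(u + y) ^ (n + 2) - u ^ (n + 2) - (n + 2) * u ^ (n + 1) * y|
      ≤ (2 ^ (n + 2) - n - 3) * (w ^ n * y ^ 2) := by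
  have hw : 0 ≤ w := (abs_nonneg _).trans hu
  induction n with
  | zero =>
    have : (u + y) ^ (0 + 2) - u ^ (0 + 2) - ((0 : ℕ) + 2 : ℝ) * u ^ (0 + 1) * y = y ^ 2 := by
      push_cast; ring
    rw [this, abs_of_nonneg (sq_nonneg y)]
    norm_num
  | succ n ih =>
    have e : (u + y) ^ (n + 1 + 2) - u ^ (n + 1 + 2) - ((n + 1 : ℕ) + 2 : ℝ) * u ^ (n + 1 + 1) * y
        = (u + y) * ((u + y) ^ (n + 2) - u ^ (n + 2) - (n + 2) * u ^ (n + 1) * y)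
          + (n + 2) * u ^ (n + 1) * y ^ 2 := by
      push_cast; ring
    rw [e]
    have h1 : |u + y| ≤ 2 * w := (abs_add_le u y).trans (by linarith)
    have h2 : |(n + 2) * u ^ (n + 1) * y ^ 2| ≤ (n + 2) * w ^ (n + 1) * y ^ 2 := by
      rw [abs_mul, abs_mul, abs_pow, abs_of_nonneg (sq_nonneg y),
        abs_of_nonneg (by positivity : (0 : ℝ) ≤ (n : ℝ) + 2)]
      gcongr
    calc _ ≤ |u + y| * |(u + y) ^ (n + 2) - u ^ (n + 2) - (n + 2) * u ^ (n + 1) * y|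
          + |(n + 2) * u ^ (n + 1) * y ^ 2| := by
            rw [← abs_mul]; exact abs_add_le _ _
      _ ≤ (2 * w) * ((2 ^ (n + 2) - n - 3) * (w ^ n * y ^ 2)) + (n + 2) * w ^ (n + 1) * y ^ 2 := by
          gcongr
      _ = _ := by push_cast; ring

/-- The real inequality behind the one-variable hypercontractive estimate. -/
theorem add_pow_le_of_abs_le {A B y ρ : ℝ} {n : ℕ} (hA : 0 ≤ A) (hB : 0 ≤ B) (hρ0 : 0 ≤ ρ)
    (hρ : 18 * 2 ^ (n + 2) * ρ ^ 2 ≤ 1) (hy : |y| ≤ ρ * (2 * A * B + B ^ 2)) :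
    (A ^ 2 + y) ^ (n + 2) ≤ (A ^ 2) ^ (n + 2) + (n + 2) * (A ^ 2) ^ (n + 1) * y
      + 1 / 2 * ((A ^ 2) ^ (n + 1) * B ^ 2 + (B ^ 2) ^ (n + 2)) := by
  have h2 : (4 : ℝ) ≤ 2 ^ (n + 2) := by
    calc (4 : ℝ) = 2 ^ 2 := by norm_num
      _ ≤ 2 ^ (n + 2) := pow_le_pow_right₀ (by norm_num) (by omega)
  have hρ3 : 3 * ρ ≤ 1 := by nlinarith [sq_nonneg ρ]
  suffices h : (2 ^ (n + 2)) * ((max (A ^ 2) |y|) ^ n * y ^ 2)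
      ≤ 1 / 2 * ((A ^ 2) ^ (n + 1) * B ^ 2 + (B ^ 2) ^ (n + 2)) by
    have key := abs_add_pow_sub_le (A ^ 2) y (max (A ^ 2) |y|)
      (by rw [abs_of_nonneg (sq_nonneg A)]; exact le_max_left _ _) (le_max_right _ _) n
    have h1 : (2 ^ (n + 2) - n - 3 : ℝ) * ((max (A ^ 2) |y|) ^ n * y ^ 2)
        ≤ (2 ^ (n + 2)) * ((max (A ^ 2) |y|) ^ n * y ^ 2) := by
      apply mul_le_mul_of_nonneg_right
      · have : (0 : ℝ) ≤ n := Nat.cast_nonneg n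
        linarith
      · positivity
    have := (abs_le.1 (key.trans (h1.trans h))).2
    linarith
  rcases le_total B A with hBA | hAB
  · have hy1 : |y| ≤ 3 * ρ * (A * B) := hy.trans (by nlinarith [mul_le_mul_of_nonneg_left hBA hB])
    have hy2 : y ^ 2 ≤ 9 * ρ ^ 2 * (A ^ 2 * B ^ 2) := by
      rw [← sq_abs]
      calc |y| ^ 2 ≤ (3 * ρ * (A * B)) ^ 2 := by gcongr
        _ = _ := by ring
    have hy3 : |y| ≤ A ^ 2 := by
      have h0 : A * B ≤ A ^ 2 := by nlinarith
      have h1 : 0 ≤ A * B := by positivity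
      nlinarith
    rw [max_eq_left hy3]
    calc (2 : ℝ) ^ (n + 2) * ((A ^ 2) ^ n * y ^ 2)
        ≤ 2 ^ (n + 2) * ((A ^ 2) ^ n * (9 * ρ ^ 2 * (A ^ 2 * B ^ 2))) := by gcongr
      _ = (18 * 2 ^ (n + 2) * ρ ^ 2) * (1 / 2 * ((A ^ 2) ^ (n + 1) * B ^ 2)) := by ring
      _ ≤ 1 * (1 / 2 * ((A ^ 2) ^ (n + 1) * B ^ 2)) := by gcongr
      _ ≤ _ := by
        have : 0 ≤ (B ^ 2) ^ (n + 2) := by positivity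
        linarith
  · have hy1 : |y| ≤ 3 * ρ * B ^ 2 := hy.trans (by nlinarith [mul_le_mul_of_nonneg_left hAB hB])
    have hy2 : y ^ 2 ≤ 9 * ρ ^ 2 * (B ^ 2) ^ 2 := by
      rw [← sq_abs]
      calc |y| ^ 2 ≤ (3 * ρ * B ^ 2) ^ 2 := by gcongr
        _ = _ := by ring
    have hy3 : |y| ≤ B ^ 2 := hy1.trans (by nlinarith [sq_nonneg B])
    have hm : max (A ^ 2) |y| ≤ B ^ 2 := max_le (by gcongr) hy3
    calc (2 : ℝ) ^ (n + 2) * (max (A ^ 2) |y| ^ n * y ^ 2)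
        ≤ 2 ^ (n + 2) * ((B ^ 2) ^ n * (9 * ρ ^ 2 * (B ^ 2) ^ 2)) := by gcongr
      _ = (18 * 2 ^ (n + 2) * ρ ^ 2) * (1 / 2 * (B ^ 2) ^ (n + 2)) := by ring
      _ ≤ 1 * (1 / 2 * (B ^ 2) ^ (n + 2)) := by gcongr
      _ ≤ _ := by
        have : 0 ≤ (A ^ 2) ^ (n + 1) * B ^ 2 := by positivity
        linarith

set_option maxHeartbeats 800000 in
/-- One-variable hypercontractive estimate for vector valued functions. -/
theorem sum_sq_add_pow_le {κ τ : Type*} [Fintype κ] [Fintype τ] [Nonempty τ] (a : κ → ℝ)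
    (b : κ → τ → ℝ) (hb : ∀ c, ∑ t, b c t = 0) {ρ : ℝ} {n : ℕ} (hρ0 : 0 ≤ ρ)
    (hρ : 18 * 2 ^ (n + 2) * ρ ^ 2 ≤ 1) :
    (∑ t, (∑ c, (a c + ρ * b c t) ^ 2) ^ (n + 2)) / (Fintype.card τ : ℝ)
      ≤ (∑ c, a c ^ 2 + (∑ t, ∑ c, b c t ^ 2) / (Fintype.card τ : ℝ)) ^ (n + 2)
        + (∑ t, (∑ c, b c t ^ 2) ^ (n + 2)) / (Fintype.card τ : ℝ) := by
  have hn : (0 : ℝ) < Fintype.card τ := by exact_mod_cast Fintype.card_pos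
  set A := √(∑ c, a c ^ 2) with hA
  have hA2 : A ^ 2 = ∑ c, a c ^ 2 := Real.sq_sqrt (Finset.sum_nonneg fun _ _ => sq_nonneg _)
  set B := fun t => √(∑ c, b c t ^ 2) with hB
  have hB2 : ∀ t, (B t) ^ 2 = ∑ c, b c t ^ 2 :=
    fun t => Real.sq_sqrt (Finset.sum_nonneg fun _ _ => sq_nonneg _)
  set I := fun t => ∑ c, a c * b c t with hI
  have hIsum : ∑ t, I t = 0 := by
    simp only [hI]
    rw [Finset.sum_comm]
    simp [← Finset.mul_sum, hb]
  have hCS : ∀ t, |I t| ≤ A * B t := by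
    intro t
    apply abs_le_of_sq_le_sq _ (by positivity)
    rw [mul_pow, hA2, hB2]
    exact Finset.sum_mul_sq_le_sq_mul_sq _ _ _
  set y := fun t => 2 * ρ * I t + ρ ^ 2 * (B t) ^ 2 with hy
  have hexp : ∀ t, ∑ c, (a c + ρ * b c t) ^ 2 = A ^ 2 + y t := by
    intro t
    simp only [hy, hI, hA2, hB2, Finset.mul_sum, ← Finset.sum_add_distrib]
    exact Finset.sum_congr rfl fun c _ => by ring
  have h2 : (1 : ℝ) ≤ 2 ^ (n + 2) := one_le_pow₀ (by norm_num)
  have hρ1 : ρ ≤ 1 := by nlinarith [sq_nonneg ρ]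
  have hyb : ∀ t, |y t| ≤ ρ * (2 * A * B t + (B t) ^ 2) := by
    intro t
    calc |y t| ≤ |2 * ρ * I t| + |ρ ^ 2 * (B t) ^ 2| := abs_add_le _ _
      _ = 2 * ρ * |I t| + ρ ^ 2 * (B t) ^ 2 := by
        rw [abs_mul, abs_of_nonneg (by positivity : 0 ≤ 2 * ρ),
          abs_of_nonneg (by positivity : 0 ≤ ρ ^ 2 * (B t) ^ 2)]
      _ ≤ 2 * ρ * (A * B t) + ρ * (B t) ^ 2 := by
        gcongr
        · exact hCS t
        · nlinarith
      _ = _ := by ring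
  simp only [hexp]
  have hpt : ∀ t, (A ^ 2 + y t) ^ (n + 2) ≤ (A ^ 2) ^ (n + 2) + (n + 2) * (A ^ 2) ^ (n + 1) * y t
      + 1 / 2 * ((A ^ 2) ^ (n + 1) * (B t) ^ 2 + ((B t) ^ 2) ^ (n + 2)) := fun t =>
    add_pow_le_of_abs_le (Real.sqrt_nonneg _) (Real.sqrt_nonneg _) hρ0 hρ (hyb t)
  simp only [← hB2, ← hA2]
  set m := (Fintype.card τ : ℝ) with hm
  set E := (∑ t, (B t) ^ 2) / m with hE
  have hE0 : 0 ≤ E := by positivity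
  set F := (∑ t, ((B t) ^ 2) ^ (n + 2)) / m with hF
  have hF0 : 0 ≤ F := by positivity
  have hys : (∑ t, y t) / m = ρ ^ 2 * E := by
    simp only [hy, Finset.sum_add_distrib, ← Finset.mul_sum, hIsum, hE]
    ring
  have hsum : (∑ t, (A ^ 2 + y t) ^ (n + 2)) / m ≤ (A ^ 2) ^ (n + 2)
      + (n + 2) * (A ^ 2) ^ (n + 1) * (ρ ^ 2 * E) + 1 / 2 * ((A ^ 2) ^ (n + 1) * E + F) := by
    calc _ ≤ (∑ t, ((A ^ 2) ^ (n + 2) + (n + 2) * (A ^ 2) ^ (n + 1) * y t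
      + 1 / 2 * ((A ^ 2) ^ (n + 1) * (B t) ^ 2 + ((B t) ^ 2) ^ (n + 2)))) / m := by
          gcongr; exact hpt _
      _ = _ := by
        rw [← hys, hE, hF]
        simp only [Finset.sum_add_distrib, ← Finset.mul_sum, Finset.sum_const, Finset.card_univ,
          nsmul_eq_mul, ← hm]
        field_simp
  refine hsum.trans ?_
  clear_value E F
  clear hpt hyb hexp hys hsum hCS hIsum hB2
  clear_value A
  have hn2 : ((n : ℝ) + 2) ≤ 2 ^ (n + 2) := by
    have := (Nat.lt_two_pow_self (n := n + 2)).le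
    exact_mod_cast this
  have hr : (n + 2) * ρ ^ 2 ≤ 1 / 2 := by
    have := mul_le_mul_of_nonneg_right hn2 (sq_nonneg ρ)
    linarith
  have hbern : (A ^ 2) ^ (n + 2) + (A ^ 2) ^ (n + 1) * E ≤ (A ^ 2 + E) ^ (n + 2) := by
    have h0 : 0 ≤ A ^ 2 := sq_nonneg A
    calc (A ^ 2) ^ (n + 2) + (A ^ 2) ^ (n + 1) * E = (A ^ 2) ^ (n + 1) * (A ^ 2 + E) := by ring
      _ ≤ (A ^ 2 + E) ^ (n + 1) * (A ^ 2 + E) := by gcongr; linarith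
      _ = _ := by ring
  have hAE : 0 ≤ (A ^ 2) ^ (n + 1) * E := by positivity
  have := mul_le_mul_of_nonneg_right hr hAE
  have e : (n + 2) * (A ^ 2) ^ (n + 1) * (ρ ^ 2 * E)
      = (n + 2) * ρ ^ 2 * ((A ^ 2) ^ (n + 1) * E) := by ring
  rw [e]
  linarith

section Hypercontractivity

variable {ι : Type} [Fintype ι] [DecidableEq ι] {Ω : ι → Type} [∀ i, Fintype (Ω i)]
  [∀ i, Nonempty (Ω i)]

theorem coordAvg_update_comm {i j : ι} (hij : j ≠ i) (f : (∀ i, Ω i) → ℝ) (t : Ω i)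
    (x : ∀ i, Ω i) :
    coordAvg j (fun z => f (Function.update z i t)) x = coordAvg j f (Function.update x i t) := by
  simp only [coordAvg]
  congr 1
  exact Finset.sum_congr rfl fun s _ => by rw [Function.update_comm hij]

/-- Average-case hypercontractivity on product spaces: the moments of a low-degree function are
controlled by averages of its generalized derivatives. -/
theorem hypercontractive {ρ : ℝ} {n : ℕ} (hρ0 : 0 ≤ ρ) (hρ : 18 * 2 ^ (n + 2) * ρ ^ 2 ≤ 1)
    (I : Finset ι) : ∀ (κ : Type) [Fintype κ] (g : κ → Finset ι → (∀ i, Ω i) → ℝ),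
    (∀ c T i, T ⊆ I → i ∈ T → ∀ x, coordAvg i (g c T) x = 0) →
    (∀ c T i, T ⊆ I → i ∈ I → i ∉ T → ∀ x t, g c T (Function.update x i t) = g c T x) →
    ∀ x, partAvg I (fun z => (∑ c, (∑ T ∈ I.powerset, ρ ^ T.card * g c T z) ^ 2) ^ (n + 2)) x
      ≤ ∑ S ∈ I.powerset, partAvg S (fun z => (∑ c, ∑ T ∈ (I \ S).powerset,
          partAvg T (fun w => g c (S ∪ T) w ^ 2) z) ^ (n + 2)) x := by
  induction I using Finset.induction_on with
  | empty =>
    intro κ _ g _ _ x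
    simp [partAvg_empty]
  | insert i I hi ih =>
    intro κ _ g h0 hc x
    have hn : (0 : ℝ) < Fintype.card (Ω i) := by exact_mod_cast Fintype.card_pos
    have hsub : ∀ {T : Finset ι}, T ⊆ I → T ⊆ insert i I :=
      fun h => h.trans (Finset.subset_insert _ _)
    have hnot : ∀ {T : Finset ι}, T ⊆ I → i ∉ T := fun h h' => hi (h h')
    set a : κ → (∀ i, Ω i) → ℝ := fun c z => ∑ T ∈ I.powerset, ρ ^ T.card * g c T z with ha
    set b : κ → (∀ i, Ω i) → ℝ :=
      fun c z => ∑ T ∈ I.powerset, ρ ^ T.card * g c (insert i T) z with hb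
    have hsplit : ∀ c z, ∑ T ∈ (insert i I).powerset, ρ ^ T.card * g c T z
        = a c z + ρ * b c z := by
      intro c z
      rw [Finset.sum_powerset_insert hi, ha, hb]
      simp only [Finset.mul_sum]
      congr 1
      refine Finset.sum_congr rfl fun T hT => ?_
      rw [Finset.card_insert_of_notMem (hnot (Finset.mem_powerset.1 hT))]
      ring
    simp only [hsplit]
    have hau : ∀ c z t, a c (Function.update z i t) = a c z := by
      intro c z t
      refine Finset.sum_congr rfl fun T hT => ?_
      have hT := Finset.mem_powerset.1 hT
      rw [hc c T i (hsub hT) (Finset.mem_insert_self _ _) (hnot hT)]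
    have hbs : ∀ c z, ∑ t, b c (Function.update z i t) = 0 := by
      intro c z
      simp only [hb]
      rw [Finset.sum_comm]
      refine Finset.sum_eq_zero fun T hT => ?_
      rw [← Finset.mul_sum]
      have := h0 c (insert i T) i (Finset.insert_subset_insert _ (Finset.mem_powerset.1 hT))
        (Finset.mem_insert_self _ _) z
      rw [coordAvg, div_eq_zero_iff] at this
      rw [this.resolve_right hn.ne', mul_zero]
    have hone : ∀ z, coordAvg i (fun z => (∑ c, (a c z + ρ * b c z) ^ 2) ^ (n + 2)) z
        ≤ (∑ c, a c z ^ 2 + coordAvg i (fun z => ∑ c, b c z ^ 2) z) ^ (n + 2)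
          + coordAvg i (fun z => (∑ c, b c z ^ 2) ^ (n + 2)) z := by
      intro z
      simp only [coordAvg, hau]
      exact sum_sq_add_pow_le (fun c => a c z) (fun c t => b c (Function.update z i t))
        (fun c => hbs c z) hρ0 hρ
    rw [partAvg_insert' hi]
    refine (partAvg_mono hone x).trans ?_
    rw [partAvg_add, Finset.sum_powerset_insert hi]
    refine add_le_add ?_ ?_
    · let g1 : κ ⊕ (κ × Ω i) → Finset ι → (∀ i, Ω i) → ℝ := fun d T z =>
        Sum.elim (fun c => g c T z)
          (fun p => g p.1 (insert i T) (Function.update z i p.2) / √(Fintype.card (Ω i))) d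
      have key := ih (κ ⊕ (κ × Ω i)) g1 ?_ ?_ x
      · have e1 : ∀ z, ∑ d, (∑ T ∈ I.powerset, ρ ^ T.card * g1 d T z) ^ 2
            = ∑ c, a c z ^ 2 + coordAvg i (fun z => ∑ c, b c z ^ 2) z := by
          intro z
          rw [Fintype.sum_sum_type, Fintype.sum_prod_type]
          simp only [g1, Sum.elim_inl, Sum.elim_inr]
          congr 1
          rw [coordAvg_sum]
          refine Finset.sum_congr rfl fun c _ => ?_
          rw [coordAvg, Finset.sum_div]
          refine Finset.sum_congr rfl fun t _ => ?_
          simp only [hb, mul_div_assoc']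
          rw [← Finset.sum_div, div_pow, Real.sq_sqrt hn.le]
        simp only [e1] at key
        refine key.trans (Finset.sum_le_sum fun S hS => le_of_eq ?_)
        have hS := Finset.mem_powerset.1 hS
        congr 1
        ext z
        congr 1
        rw [Fintype.sum_sum_type, Fintype.sum_prod_type, ← Finset.sum_add_distrib]
        refine Finset.sum_congr rfl fun c _ => ?_
        have hIS : i ∉ I \ S := fun h => hi (Finset.mem_sdiff.1 h).1
        rw [Finset.insert_sdiff_of_notMem _ (hnot hS), Finset.sum_powerset_insert hIS]
        simp only [g1, Sum.elim_inl, Sum.elim_inr]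
        congr 1
        rw [Finset.sum_comm]
        refine Finset.sum_congr rfl fun T hT => ?_
        have hiT : i ∉ T := fun h => hIS (Finset.mem_powerset.1 hT h)
        rw [partAvg_insert hiT, coordAvg, Finset.sum_div]
        refine Finset.sum_congr rfl fun t _ => ?_
        rw [← partAvg_update hiT, Finset.union_insert]
        simp only [partAvg, div_pow, Real.sq_sqrt hn.le]
        simp only [div_eq_mul_inv, prodAvg_mul_const]
      · rintro (c | ⟨c, t⟩) T j hT hj z
        · exact h0 c T j (hsub hT) hj z
        · have hji : j ≠ i := fun h => hi (h ▸ hT hj)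
          have h := coordAvg_update_comm hji (g c (insert i T)) t z
          rw [h0 c _ j (Finset.insert_subset_insert _ hT) (Finset.mem_insert_of_mem hj)] at h
          simp only [g1, Sum.elim_inr, coordAvg] at h ⊢
          rw [← Finset.sum_div, div_right_comm, h, zero_div]
      · rintro (c | ⟨c, t⟩) T j hT hj hjT z s
        · exact hc c T j (hsub hT) (Finset.mem_insert_of_mem hj) hjT z s
        · have hji : j ≠ i := fun h => hi (h ▸ hj)
          simp only [g1, Sum.elim_inr]
          rw [Function.update_comm hji, hc c _ j (Finset.insert_subset_insert _ hT)
            (Finset.mem_insert_of_mem hj) (by simp [hji, hjT])]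
    · have key : ∀ z, _ := ih κ (fun c T => g c (insert i T)) ?_ ?_
      · rw [← coordAvg_partAvg hi]
        refine (coordAvg_mono key x).trans ?_
        rw [coordAvg_sum]
        refine Finset.sum_le_sum fun S hS => le_of_eq ?_
        have hS := Finset.mem_powerset.1 hS
        rw [partAvg_insert (hnot hS), Finset.insert_sdiff_insert, Finset.sdiff_insert_of_notMem hi]
        simp only [Finset.insert_union]
      · intro c T j hT hj z
        exact h0 c _ j (Finset.insert_subset_insert _ hT) (Finset.mem_insert_of_mem hj) z
      · intro c T j hT hj hjT z s
        have hji : j ≠ i := fun h => hi (h ▸ hj)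
        exact hc c _ j (Finset.insert_subset_insert _ hT)
            (Finset.mem_insert_of_mem hj) (by simp [hji, hjT]) z s

end Hypercontractivity

section Kernels

variable {ι : Type} [Fintype ι] [DecidableEq ι] {Ω : ι → Type} [∀ i, Fintype (Ω i)]
  [∀ i, Nonempty (Ω i)] [∀ i, DecidableEq (Ω i)]

/-- The normalized indicator that `z` agrees with `x` on `V`. -/
noncomputable def indKer (V : Finset ι) (x z : ∀ i, Ω i) : ℝ :=
  ∏ i ∈ V, if z i = x i then (Fintype.card (Ω i) : ℝ) else 0

/-- The kernel of the projection onto functions depending exactly on the coordinates in `T`. -/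
noncomputable def balKer (T : Finset ι) (y z : ∀ i, Ω i) : ℝ :=
  ∏ i ∈ T, ((if z i = y i then (Fintype.card (Ω i) : ℝ) else 0) - 1)

theorem prodAvg_prod (T : Finset ι) (φ : ∀ i, Ω i → ℝ) :
    prodAvg (fun y => ∏ i ∈ T, φ i (y i)) = ∏ i ∈ T, (∑ t, φ i t) / (Fintype.card (Ω i) : ℝ) := by
  have h := Finset.prod_univ_sum (fun i => (Finset.univ : Finset (Ω i)))
    (fun i t => if i ∈ T then φ i t else 1)
  rw [Fintype.piFinset_univ] at h
  have e : ∀ y : ∀ i, Ω i, ∏ i, (if i ∈ T then φ i (y i) else 1) = ∏ i ∈ T, φ i (y i) := by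
    intro y
    rw [Finset.prod_ite_mem, Finset.univ_inter]
  simp only [e] at h
  rw [prodAvg, ← h, Fintype.card_pi, Nat.cast_prod, ← Finset.prod_div_distrib,
    ← Finset.univ_inter T, ← Finset.prod_ite_mem Finset.univ T]
  refine Finset.prod_congr rfl fun i _ => ?_
  have hn : (Fintype.card (Ω i) : ℝ) ≠ 0 := by exact_mod_cast Fintype.card_ne_zero
  by_cases hi : i ∈ T <;> simp [hi, hn]

theorem prodAvg_balKer_mul (T : Finset ι) (z z' : ∀ i, Ω i) :
    prodAvg (fun y => balKer T y z * balKer T y z') = balKer T z z' := by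
  simp only [balKer, ← Finset.prod_mul_distrib]
  rw [prodAvg_prod T (fun i t => ((if z i = t then (Fintype.card (Ω i) : ℝ) else 0) - 1) *
    ((if z' i = t then (Fintype.card (Ω i) : ℝ) else 0) - 1))]
  refine Finset.prod_congr rfl fun i _ => ?_
  have hn : (Fintype.card (Ω i) : ℝ) ≠ 0 := by exact_mod_cast Fintype.card_ne_zero
  simp only [sub_mul, mul_sub, ite_mul, mul_ite, mul_one, zero_mul, mul_zero, one_mul,
    Finset.sum_sub_distrib, Finset.sum_ite_eq, Finset.mem_univ, if_true, Finset.sum_const,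
    Finset.card_univ, nsmul_eq_mul]
  by_cases h : z' i = z i
  · simp [h]; field_simp
  · have h' : ¬ z i = z' i := fun e => h e.symm
    simp [h, h']

theorem indKer_nonneg (V : Finset ι) (x z : ∀ i, Ω i) : 0 ≤ indKer V x z := by
  refine Finset.prod_nonneg fun i _ => ?_
  split_ifs <;> positivity

theorem prodAvg_indKer (W : Finset ι) (z : ∀ i, Ω i) : prodAvg (fun y => indKer W y z) = 1 := by
  simp only [indKer]
  rw [prodAvg_prod W (fun i t => if z i = t then (Fintype.card (Ω i) : ℝ) else 0)]
  refine Finset.prod_eq_one fun i _ => ?_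
  have hn : (Fintype.card (Ω i) : ℝ) ≠ 0 := by exact_mod_cast Fintype.card_ne_zero
  simp [hn]

theorem mul_indKer_eq (W : Finset ι) (φ : (∀ i, Ω i) → ℝ)
    (hφ : ∀ y z, (∀ i ∈ W, y i = z i) → φ y = φ z) (y z : ∀ i, Ω i) :
    φ y * indKer W y z = φ z * indKer W y z := by
  by_cases h : ∀ i ∈ W, y i = z i
  · rw [hφ y z h]
  · push Not at h
    obtain ⟨i, hi, hne⟩ := h
    have : indKer W y z = 0 :=
      Finset.prod_eq_zero hi (if_neg fun h => hne h.symm)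
    rw [this, mul_zero, mul_zero]

theorem indKer_mul (V W : Finset ι) (h : Disjoint V W) (x y z : ∀ i, Ω i) :
    indKer V x z * indKer W y z = indKer (V ∪ W) (V.piecewise x y) z := by
  rw [indKer, indKer, indKer, Finset.prod_union h]
  congr 1
  · refine Finset.prod_congr rfl fun i hi => ?_
    rw [Finset.piecewise_eq_of_mem _ _ _ hi]
  · refine Finset.prod_congr rfl fun i hi => ?_
    rw [Finset.piecewise_eq_of_notMem _ _ _ (Finset.disjoint_right.1 h hi)]

theorem indKer_congr {V : Finset ι} {x y : ∀ i, Ω i} (h : ∀ i ∈ V, x i = y i) (z : ∀ i, Ω i) :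
    indKer V x z = indKer V y z :=
  Finset.prod_congr rfl fun i hi => by rw [h i hi]

theorem balKer_congr {T : Finset ι} {x y : ∀ i, Ω i} (h : ∀ i ∈ T, x i = y i) (z : ∀ i, Ω i) :
    balKer T x z = balKer T y z :=
  Finset.prod_congr rfl fun i hi => by rw [h i hi]

theorem coordAvg_balKer {T : Finset ι} {i : ι} (hi : i ∈ T) (y z : ∀ i, Ω i) :
    coordAvg i (fun y => balKer T y z) y = 0 := by
  have hn : (Fintype.card (Ω i) : ℝ) ≠ 0 := by exact_mod_cast Fintype.card_ne_zero
  have e : ∀ t : Ω i, balKer T (Function.update y i t) z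
      = ((if z i = t then (Fintype.card (Ω i) : ℝ) else 0) - 1) * balKer (T.erase i) y z := by
    intro t
    rw [balKer, ← Finset.mul_prod_erase _ _ hi, Function.update_self]
    congr 1
    refine balKer_congr (fun j hj => ?_) z
    rw [Function.update_of_ne (Finset.ne_of_mem_erase hj)]
  simp only [coordAvg, e]
  rw [← Finset.sum_mul, Finset.sum_sub_distrib]
  simp

theorem abs_balKer_le (T : Finset ι) (y z : ∀ i, Ω i) :
    |balKer T y z| ≤ ∑ U ∈ T.powerset, indKer U y z := by
  have : ∑ U ∈ T.powerset, indKer U y z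
      = ∏ i ∈ T, ((if z i = y i then (Fintype.card (Ω i) : ℝ) else 0) + 1) := by
    rw [Finset.prod_add]
    simp [indKer]
  rw [this, balKer, Finset.abs_prod]
  refine Finset.prod_le_prod (fun _ _ => abs_nonneg _) fun i _ => ?_
  have : (0 : ℝ) ≤ if z i = y i then (Fintype.card (Ω i) : ℝ) else 0 := by
    split_ifs <;> positivity
  rw [abs_le]; constructor <;> linarith

theorem balKer_union {S T : Finset ι} (h : Disjoint S T) (y z : ∀ i, Ω i) :
    balKer (S ∪ T) y z
      = ∑ V ∈ S.powerset, (-1) ^ (S \ V).card * (indKer V y z * balKer T y z) := by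
  rw [balKer, Finset.prod_union h]
  have e : ∏ i ∈ S, ((if z i = y i then (Fintype.card (Ω i) : ℝ) else 0) - 1)
      = ∑ V ∈ S.powerset, indKer V y z * (-1) ^ (S \ V).card := by
    simp only [sub_eq_add_neg]
    rw [Finset.prod_add]
    simp only [Finset.prod_const, indKer]
  rw [e, Finset.sum_mul]
  refine Finset.sum_congr rfl fun V _ => ?_
  rw [balKer]
  ring

/-- Weighted power mean inequality. -/
theorem weighted_sum_pow_le {σ : Type*} (J : Finset σ) (w a : σ → ℝ) (hw : ∀ j ∈ J, 0 ≤ w j)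
    (ha : ∀ j ∈ J, 0 ≤ a j) (N : ℕ) :
    (∑ j ∈ J, w j * a j) ^ (N + 1) ≤ (∑ j ∈ J, w j) ^ N * ∑ j ∈ J, w j * a j ^ (N + 1) := by
  rcases (Finset.sum_nonneg hw).eq_or_lt with h | h
  · have h0 := (Finset.sum_eq_zero_iff_of_nonneg hw).1 h.symm
    rw [Finset.sum_eq_zero fun j hj => by rw [h0 j hj, zero_mul], ← h,
      Finset.sum_eq_zero (s := J) (f := fun j => w j * a j ^ (N + 1))
        fun j hj => by rw [h0 j hj, zero_mul]]
    simp
  · set W := ∑ j ∈ J, w j with hW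
    have := Real.pow_arith_mean_le_arith_mean_pow J (fun j => w j / W) a
      (fun j hj => div_nonneg (hw j hj) h.le) (by rw [← Finset.sum_div, div_self h.ne']) ha (N + 1)
    simp only [div_mul_eq_mul_div, ← Finset.sum_div] at this
    rw [div_pow, div_le_div_iff₀ (by positivity) h] at this
    have e : (∑ j ∈ J, w j * a j ^ (N + 1)) * W ^ (N + 1)
      = (W ^ N * ∑ j ∈ J, w j * a j ^ (N + 1)) * W := by ring
    rw [e] at this
    exact le_of_mul_le_mul_right this h

variable {σ : Type} (J : Finset σ) (π : σ → ∀ i, Ω i)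

/-- If `π` is nearly equidistributed then weighted sums along `π` are close to averages. -/
theorem abs_sum_sub_prodAvg_le {μ ε : ℝ} {V W : Finset ι} (hVW : Disjoint V W)
    (hε : ∀ x, |∑ j ∈ J, μ * indKer (V ∪ W) x (π j) - 1| ≤ ε) (φ : (∀ i, Ω i) → ℝ)
    (hφ : ∀ y z, (∀ i ∈ W, y i = z i) → φ y = φ z) (x : ∀ i, Ω i) :
    |∑ j ∈ J, μ * indKer V x (π j) * φ (π j) - prodAvg φ| ≤ ε * prodAvg fun y => |φ y| := by
  have e : ∑ j ∈ J, μ * indKer V x (π j) * φ (π j) - prodAvg φ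
      = prodAvg fun y => φ y * (∑ j ∈ J, μ * indKer (V ∪ W) (V.piecewise x y) (π j) - 1) := by
    have : ∀ j, φ (π j) = prodAvg fun y => φ y * indKer W y (π j) := by
      intro j
      simp only [mul_indKer_eq W φ hφ _ (π j), prodAvg_const_mul, prodAvg_indKer, mul_one]
    have hs : ∀ y, φ y * (∑ j ∈ J, μ * indKer (V ∪ W) (V.piecewise x y) (π j) - 1)
        = φ y * ∑ j ∈ J, μ * indKer (V ∪ W) (V.piecewise x y) (π j) + -1 * φ y := fun y => by ring
    simp only [hs, prodAvg_add, prodAvg_const_mul]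
    rw [neg_one_mul, ← sub_eq_add_neg]
    congr 1
    calc ∑ j ∈ J, μ * indKer V x (π j) * φ (π j)
          = ∑ j ∈ J, prodAvg fun y =>
              μ * indKer V x (π j) * (φ y * indKer W y (π j)) := by
            refine Finset.sum_congr rfl fun j _ => ?_
            rw [prodAvg_const_mul, ← this j]
        _ = _ := by
          rw [← prodAvg_sum]
          congr 1; ext y
          rw [Finset.mul_sum]
          refine Finset.sum_congr rfl fun j _ => ?_
          rw [← indKer_mul V W hVW]; ring
  rw [e, ← prodAvg_const_mul]
  refine (abs_prodAvg_le _).trans (prodAvg_mono fun y => ?_)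
  rw [abs_mul, mul_comm]
  exact mul_le_mul_of_nonneg_right (hε _) (abs_nonneg _)

theorem prodAvg_le_of_le {f : (∀ i, Ω i) → ℝ} {b : ℝ} (h : ∀ x, f x ≤ b) : prodAvg f ≤ b :=
  (prodAvg_mono h).trans (prodAvg_const b).le

/-- Moments of low-degree functions along a nearly equidistributed sequence. -/
theorem sum_moment_le {μ ε b : ℝ} {V : Finset ι} {s N : ℕ}
    (hε : ∀ W : Finset ι, W.card ≤ V.card + N * s → ∀ x, |∑ j ∈ J, μ * indKer W x (π j) - 1| ≤ ε)
    (𝒯 : Finset (Finset ι)) (h𝒯 : ∀ T ∈ 𝒯, Disjoint V T ∧ T.card ≤ s)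
    (φ : Finset ι → (∀ i, Ω i) → ℝ)
    (hφ : ∀ T ∈ 𝒯, ∀ y z, (∀ i ∈ T, y i = z i) → φ T y = φ T z)
    (hb : ∀ T ∈ 𝒯, ∀ y, |φ T y| ≤ b) (x : ∀ i, Ω i) :
    ∑ j ∈ J, μ * indKer V x (π j) * (∑ T ∈ 𝒯, φ T (π j)) ^ N
      ≤ prodAvg (fun y => (∑ T ∈ 𝒯, φ T y) ^ N) + ε * (𝒯.card * b) ^ N := by
  have hε0 : 0 ≤ ε := (abs_nonneg _).trans (hε V (Nat.le_add_right _ _) x)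
  have hexp : ∀ y, (∑ T ∈ 𝒯, φ T y) ^ N
      = ∑ p ∈ Fintype.piFinset (fun _ : Fin N => 𝒯), ∏ i, φ (p i) y := by
    intro y
    rw [Finset.sum_pow' 𝒯 (fun T => φ T y) N]
  have hone : ∀ p ∈ Fintype.piFinset (fun _ : Fin N => 𝒯),
      ∑ j ∈ J, μ * indKer V x (π j) * ∏ i, φ (p i) (π j)
        ≤ prodAvg (fun y => ∏ i, φ (p i) y) + ε * b ^ N := by
    intro p hp
    have hp : ∀ i, p i ∈ 𝒯 := Fintype.mem_piFinset.1 hp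
    have hdisj : Disjoint V (Finset.univ.biUnion p) := by
      rw [Finset.disjoint_biUnion_right]
      exact fun i _ => (h𝒯 _ (hp i)).1
    have hcard : (V ∪ Finset.univ.biUnion p).card ≤ V.card + N * s := by
      refine (Finset.card_union_le _ _).trans (Nat.add_le_add_left ?_ _)
      refine (Finset.card_biUnion_le_card_mul _ _ s fun i _ => (h𝒯 _ (hp i)).2).trans ?_
      simp
    have := abs_sum_sub_prodAvg_le J π hdisj (hε _ hcard) (fun y => ∏ i, φ (p i) y) ?_ x
    · have h2 : prodAvg (fun y => |∏ i, φ (p i) y|) ≤ b ^ N := by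
        refine prodAvg_le_of_le fun y => ?_
        rw [Finset.abs_prod]
        refine (Finset.prod_le_prod (fun _ _ => abs_nonneg _) fun i _ => hb _ (hp i) y).trans ?_
        simp
      have h3 := mul_le_mul_of_nonneg_left h2 hε0
      have h4 := (abs_le.1 this).2
      linarith
    · intro y z hyz
      refine Finset.prod_congr rfl fun i _ => hφ _ (hp i) _ _ fun k hk => hyz k ?_
      exact Finset.mem_biUnion.2 ⟨i, Finset.mem_univ _, hk⟩
  simp only [hexp, Finset.mul_sum]
  rw [Finset.sum_comm, prodAvg_sum]
  refine (Finset.sum_le_sum hone).trans (le_of_eq ?_)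
  rw [Finset.sum_add_distrib, Finset.sum_const, Fintype.card_piFinset]
  simp
  ring

end Kernels

section LevelInequality

variable {ι : Type} [Fintype ι] [DecidableEq ι] {Ω : ι → Type} [∀ i, Fintype (Ω i)]
  [∀ i, Nonempty (Ω i)] [∀ i, DecidableEq (Ω i)]

variable {σ : Type} (J : Finset σ) (ν : σ → ℝ) (π : σ → ∀ i, Ω i)

/-- The `T`-component of the measure `∑ ν j δ_{π j}`, after conditioning on the coordinates in
`V` being equal to those of `x`. -/
noncomputable def levelFn (V T : Finset ι) (x y : ∀ i, Ω i) : ℝ :=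
  ∑ j ∈ J, ν j * indKer V x (π j) * balKer T y (π j)

/-- The sets of size at most `s` disjoint from `V`. -/
def levelSets (s : ℕ) (V : Finset ι) : Finset (Finset ι) :=
  Finset.univ.filter fun T => Disjoint V T ∧ T.card ≤ s

/-- The energy of the conditioned measure at levels at most `s`. -/
noncomputable def levelEnergy (s : ℕ) (V : Finset ι) (x : ∀ i, Ω i) : ℝ :=
  ∑ T ∈ levelSets s V, prodAvg fun y => levelFn J ν π V T x y ^ 2

theorem mem_levelSets {s : ℕ} {V T : Finset ι} :
    T ∈ levelSets s V ↔ Disjoint V T ∧ T.card ≤ s := by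
  simp [levelSets]

theorem levelFn_congr {V T : Finset ι} {x x' y y' : ∀ i, Ω i} (hx : ∀ i ∈ V, x i = x' i)
    (hy : ∀ i ∈ T, y i = y' i) : levelFn J ν π V T x y = levelFn J ν π V T x' y' := by
  refine Finset.sum_congr rfl fun j _ => ?_
  rw [indKer_congr hx, balKer_congr hy]

theorem coordAvg_levelFn {V T : Finset ι} {i : ι} (hi : i ∈ T) (x y : ∀ i, Ω i) :
    coordAvg i (levelFn J ν π V T x) y = 0 := by
  have : levelFn J ν π V T x = fun y => ∑ j ∈ J, ν j * indKer V x (π j) * balKer T y (π j) := rfl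
  rw [this, coordAvg_sum]
  refine Finset.sum_eq_zero fun j _ => ?_
  have := coordAvg_balKer hi y (π j)
  simp only [coordAvg] at this ⊢
  rw [← Finset.mul_sum, mul_div_assoc, this, mul_zero]

theorem prodAvg_levelFn_sq (V T : Finset ι) (x : ∀ i, Ω i) :
    prodAvg (fun y => levelFn J ν π V T x y ^ 2)
      = ∑ j ∈ J, ν j * indKer V x (π j) * levelFn J ν π V T x (π j) := by
  have e : ∀ y, levelFn J ν π V T x y ^ 2 = ∑ j ∈ J, ∑ l ∈ J,
      (ν j * indKer V x (π j)) * (ν l * indKer V x (π l))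
        * (balKer T y (π j) * balKer T y (π l)) := by
    intro y
    rw [sq, levelFn, Finset.sum_mul_sum]
    exact Finset.sum_congr rfl fun j _ => Finset.sum_congr rfl fun l _ => by ring
  simp only [e, prodAvg_sum, prodAvg_const_mul, prodAvg_balKer_mul]
  refine Finset.sum_congr rfl fun j _ => ?_
  rw [levelFn, Finset.mul_sum]
  exact Finset.sum_congr rfl fun l _ => by ring

theorem levelEnergy_eq (s : ℕ) (V : Finset ι) (x : ∀ i, Ω i) :
    levelEnergy J ν π s V x = ∑ j ∈ J, ν j * indKer V x (π j)
      * ∑ T ∈ levelSets s V, levelFn J ν π V T x (π j) := by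
  simp only [levelEnergy, prodAvg_levelFn_sq, Finset.mul_sum]
  rw [Finset.sum_comm]

theorem abs_levelFn_le {e : ℕ} {κ : ℝ}
    (hκ : ∀ U : Finset ι, U.card ≤ e → ∀ x, ∑ j ∈ J, |ν j| * indKer U x (π j) ≤ κ)
    {V T : Finset ι} (hVT : Disjoint V T) (hcard : V.card + T.card ≤ e) (x y : ∀ i, Ω i) :
    |levelFn J ν π V T x y| ≤ 2 ^ T.card * κ := by
  calc |levelFn J ν π V T x y|
      ≤ ∑ j ∈ J, |ν j| * indKer V x (π j) * ∑ U ∈ T.powerset, indKer U y (π j) := by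
        refine (Finset.abs_sum_le_sum_abs _ _).trans (Finset.sum_le_sum fun j _ => ?_)
        rw [abs_mul, abs_mul, abs_of_nonneg (indKer_nonneg _ _ _)]
        exact mul_le_mul_of_nonneg_left (abs_balKer_le _ _ _)
          (mul_nonneg (abs_nonneg _) (indKer_nonneg _ _ _))
    _ = ∑ U ∈ T.powerset, ∑ j ∈ J, |ν j| * (indKer V x (π j) * indKer U y (π j)) := by
        rw [Finset.sum_comm]
        refine Finset.sum_congr rfl fun j _ => ?_
        rw [Finset.mul_sum]
        exact Finset.sum_congr rfl fun _ _ => by ring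
    _ ≤ ∑ U ∈ T.powerset, κ := by
        refine Finset.sum_le_sum fun U hU => ?_
        have hU := Finset.mem_powerset.1 hU
        simp only [indKer_mul V U (Finset.disjoint_of_subset_right hU hVT)]
        refine hκ _ ?_ _
        have := Finset.card_union_le V U
        have := Finset.card_le_card hU
        omega
    _ = _ := by simp

theorem levelFn_union {V S T : Finset ι} (hST : Disjoint S T) (hVS : Disjoint V S)
    (x y : ∀ i, Ω i) :
    levelFn J ν π V (S ∪ T) x y = ∑ V' ∈ S.powerset,
      (-1) ^ (S \ V').card * levelFn J ν π (V ∪ V') T (V.piecewise x y) y := by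
  simp only [levelFn, balKer_union hST, Finset.mul_sum]
  rw [Finset.sum_comm]
  refine Finset.sum_congr rfl fun V' hV' => Finset.sum_congr rfl fun j _ => ?_
  rw [← indKer_mul V V' (Finset.disjoint_of_subset_right (Finset.mem_powerset.1 hV') hVS)]
  ring

theorem partAvg_levelFn_sq_le {V S T : Finset ι} (hST : Disjoint S T) (hV : Disjoint V (S ∪ T))
    (x y : ∀ i, Ω i) :
    partAvg T (fun w => levelFn J ν π V (S ∪ T) x w ^ 2) y
      ≤ 2 ^ S.card * ∑ V' ∈ S.powerset,
        prodAvg fun w => levelFn J ν π (V ∪ V') T (V.piecewise x y) w ^ 2 := by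
  have hVS := Finset.disjoint_of_subset_right Finset.subset_union_left hV
  have hVT := Finset.disjoint_of_subset_right Finset.subset_union_right hV
  rw [← prodAvg_sum, ← prodAvg_const_mul]
  refine prodAvg_mono fun w => ?_
  beta_reduce
  rw [levelFn_union J ν π hST hVS]
  have e : ∀ V' ∈ S.powerset, (-1) ^ (S \ V').card * levelFn J ν π (V ∪ V') T
      (V.piecewise x (T.piecewise w y)) (T.piecewise w y)
      = (-1) ^ (S \ V').card * levelFn J ν π (V ∪ V') T (V.piecewise x y) w := by
    intro V' hV'
    have hV' := Finset.mem_powerset.1 hV'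
    congr 1
    refine levelFn_congr J ν π (fun i hi => ?_) (fun i hi => ?_)
    · by_cases hiV : i ∈ V
      · simp [hiV]
      · have hiT : i ∉ T := Finset.disjoint_left.1 hST (hV' ((Finset.mem_union.1 hi).resolve_left hiV))
        simp [hiV, hiT]
    · simp [hi]
  rw [Finset.sum_congr rfl e]
  refine (sq_sum_le_card_mul_sum_sq).trans (le_of_eq ?_)
  rw [Finset.card_powerset]
  push_cast
  congr 1
  refine Finset.sum_congr rfl fun V' _ => ?_
  rw [mul_pow, ← pow_mul, mul_comm _ 2, pow_mul]
  norm_num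

theorem sum_sum_union_eq (F : Finset ι → ℝ) :
    ∑ S ∈ (Finset.univ : Finset ι).powerset, ∑ T ∈ (Finset.univ \ S).powerset, F (S ∪ T)
      = ∑ R : Finset ι, 2 ^ R.card * F R := by
  have h : ∀ R : Finset ι, (2 : ℝ) ^ R.card * F R = ∑ S ∈ R.powerset, F R := by
    intro R; simp
  simp only [h]
  rw [Finset.sum_sigma', Finset.sum_sigma']
  refine Finset.sum_nbij' (fun p => ⟨p.1 ∪ p.2, p.1⟩) (fun p => ⟨p.2, p.1 \ p.2⟩) ?_ ?_ ?_ ?_ ?_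
  · rintro ⟨S, T⟩ _
    exact Finset.mem_sigma.2 ⟨Finset.mem_univ _, Finset.mem_powerset.2 Finset.subset_union_left⟩
  · rintro ⟨R, S⟩ _
    simp only [Finset.mem_sigma, Finset.mem_powerset]
    exact ⟨Finset.subset_univ _, Finset.sdiff_subset_sdiff (Finset.subset_univ _) subset_rfl⟩
  · rintro ⟨S, T⟩ h
    simp only [Finset.mem_sigma, Finset.mem_powerset] at h
    have : Disjoint S T := Finset.disjoint_left.2 fun i hi hi' => (Finset.mem_sdiff.1 (h.2 hi')).2 hi
    simp [Finset.union_sdiff_cancel_left this]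
  · rintro ⟨R, S⟩ h
    simp only [Finset.mem_sigma, Finset.mem_powerset] at h
    simp [Finset.union_sdiff_of_subset h.2]
  · rintro ⟨S, T⟩ _
    rfl

/-- The high moments of the low-level part are controlled by its energy. -/
theorem levelFn_moment_le {ρ : ℝ} {n : ℕ} (hρ0 : 0 < ρ) (hρ1 : ρ ≤ 1)
    (hρ : 18 * 2 ^ (n + 2) * ρ ^ 2 ≤ 1) {s : ℕ} {V : Finset ι} {Y : ℝ}
    (hY : 0 ≤ Y) (x : ∀ i, Ω i)
    (ih : ∀ s' < s, ∀ V' : Finset ι, V'.card + s' ≤ V.card + s → ∀ x,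
      levelEnergy J ν π s' V' x ≤ Y) :
    prodAvg (fun y => (∑ T ∈ levelSets s V, levelFn J ν π V T x y) ^ (2 * (n + 2)))
      ≤ (ρ⁻¹ ^ (2 * s) * levelEnergy J ν π s V x) ^ (n + 2)
        + (ρ⁻¹ ^ (2 * s) * 4 ^ s * Y) ^ (n + 1)
          * (ρ⁻¹ ^ (2 * s) * 2 ^ s * levelEnergy J ν π s V x) := by
  set r := ρ⁻¹ with hr
  have hr1 : 1 ≤ r := (one_le_inv₀ hρ0).2 hρ1
  set E := levelEnergy J ν π s V x with hE
  let g : Unit → Finset ι → (∀ i, Ω i) → ℝ := fun _ T y =>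
    if T ∈ levelSets s V then r ^ T.card * levelFn J ν π V T x y else 0
  have hg : ∀ c T y, g c T y = if T ∈ levelSets s V then r ^ T.card * levelFn J ν π V T x y else 0 :=
    fun _ _ _ => rfl
  have hsum : ∀ y, ∑ T ∈ (Finset.univ : Finset ι).powerset, ρ ^ T.card * g () T y
      = ∑ T ∈ levelSets s V, levelFn J ν π V T x y := by
    intro y
    simp only [hg, mul_ite, mul_zero, Finset.powerset_univ]
    rw [Finset.sum_ite_mem, Finset.univ_inter]
    refine Finset.sum_congr rfl fun T _ => ?_
    rw [← mul_assoc, ← mul_pow, hr, mul_inv_cancel₀ hρ0.ne', one_pow, one_mul]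
  have key : ∀ z, _ := hypercontractive hρ0.le hρ (Finset.univ : Finset ι) Unit g ?_ ?_
  · simp only [Fintype.sum_unique, partAvg_univ] at key
    have hd : (default : Unit) = () := rfl
    rw [hd] at key
    simp only [hsum, ← pow_mul] at key
    set D : Finset ι → (∀ i, Ω i) → ℝ := fun S z => ∑ T ∈ (Finset.univ \ S).powerset,
      partAvg T (fun w => g () (S ∪ T) w ^ 2) z with hD
    have hD0 : ∀ S z, 0 ≤ D S z := fun S z =>
      Finset.sum_nonneg fun T _ => partAvg_nonneg (fun _ => sq_nonneg _) _
    have hgsq : ∀ R, prodAvg (fun w => g () R w ^ 2) ≤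
        if R ∈ levelSets s V then r ^ (2 * s) * prodAvg (fun w => levelFn J ν π V R x w ^ 2)
          else 0 := by
      intro R
      by_cases hR : R ∈ levelSets s V
      · simp only [hg, if_pos hR, mul_pow, prodAvg_const_mul]
        rw [← pow_mul, mul_comm R.card]
        refine mul_le_mul_of_nonneg_right ?_ (prodAvg_nonneg fun _ => sq_nonneg _)
        exact pow_le_pow_right₀ hr1 (Nat.mul_le_mul_left 2 (mem_levelSets.1 hR).2)
      · simp only [hg, if_neg hR]
        rw [prodAvg_const]; norm_num
    have hDempty : ∀ z, D ∅ z ≤ r ^ (2 * s) * E := by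
      intro z
      have e1 : ∀ T, partAvg T (fun w => g () T w ^ 2) z = prodAvg (fun w => g () T w ^ 2) := by
        intro T
        simp only [partAvg, hg]
        congr 1; ext w
        by_cases hT : T ∈ levelSets s V
        · rw [if_pos hT, if_pos hT, levelFn_congr J ν π (x' := x) (y' := w) (fun _ _ => rfl)]
          intro i hi; simp [hi]
        · rw [if_neg hT, if_neg hT]
      simp only [hD, Finset.sdiff_empty, Finset.powerset_univ, Finset.empty_union, e1]
      refine (Finset.sum_le_sum fun R _ => hgsq R).trans (le_of_eq ?_)
      rw [Finset.sum_ite_mem, Finset.univ_inter, ← Finset.mul_sum, hE, levelEnergy]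
    have hDne : ∀ S, S ≠ ∅ → ∀ z, D S z ≤ r ^ (2 * s) * 4 ^ s * Y := by
      intro S hS z
      have hSc : 0 < S.card := Finset.card_pos.2 (Finset.nonempty_iff_ne_empty.2 hS)
      by_cases hSs : S.card ≤ s ∧ Disjoint V S
      · calc D S z ≤ ∑ T ∈ (Finset.univ \ S).powerset, if S ∪ T ∈ levelSets s V then
              r ^ (2 * s) * (2 ^ S.card * ∑ V' ∈ S.powerset,
                prodAvg fun w => levelFn J ν π (V ∪ V') T (V.piecewise x z) w ^ 2) else 0 := by
              refine Finset.sum_le_sum fun T hT => ?_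
              by_cases hR : S ∪ T ∈ levelSets s V
              · simp only [hg, if_pos hR, mul_pow]
                have hdisj : Disjoint S T := Finset.disjoint_left.2 fun i hi hi' =>
                  (Finset.mem_sdiff.1 (Finset.mem_powerset.1 hT hi')).2 hi
                have h1 := partAvg_levelFn_sq_le J ν π hdisj (mem_levelSets.1 hR).1 x z
                have h2 : (r ^ (S ∪ T).card) ^ 2 ≤ r ^ (2 * s) := by
                  rw [← pow_mul, mul_comm (S ∪ T).card]
                  exact pow_le_pow_right₀ hr1 (Nat.mul_le_mul_left 2 (mem_levelSets.1 hR).2)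
                have h3 : partAvg T (fun w => (r ^ (S ∪ T).card) ^ 2
                    * levelFn J ν π V (S ∪ T) x w ^ 2) z = (r ^ (S ∪ T).card) ^ 2 *
                    partAvg T (fun w => levelFn J ν π V (S ∪ T) x w ^ 2) z :=
                  prodAvg_const_mul _ _
                rw [h3]
                exact mul_le_mul h2 h1 (partAvg_nonneg (fun _ => sq_nonneg _) _) (by positivity)
              · simp only [hg, if_neg hR]
                refine le_of_eq ?_
                simp [partAvg, prodAvg_const]
          _ ≤ ∑ T ∈ levelSets (s - S.card) V,
              r ^ (2 * s) * (2 ^ S.card * ∑ V' ∈ S.powerset, if Disjoint S T then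
                prodAvg (fun w => levelFn J ν π (V ∪ V') T (V.piecewise x z) w ^ 2) else 0) := by
              rw [← Finset.sum_filter]
              refine (Finset.sum_le_sum fun T hT => le_of_eq ?_).trans
                (Finset.sum_le_sum_of_subset_of_nonneg ?_ ?_)
              · have hT := (Finset.mem_filter.1 hT).1
                have hdisj : Disjoint S T := Finset.disjoint_left.2 fun i hi hi' =>
                  (Finset.mem_sdiff.1 (Finset.mem_powerset.1 hT hi')).2 hi
                simp only [if_pos hdisj]
              · intro T hT
                rw [Finset.mem_filter] at hT
                have hdisj : Disjoint S T := Finset.disjoint_left.2 fun i hi hi' =>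
                  (Finset.mem_sdiff.1 (Finset.mem_powerset.1 hT.1 hi')).2 hi
                have h2 := mem_levelSets.1 hT.2
                rw [Finset.card_union_of_disjoint hdisj] at h2
                exact mem_levelSets.2 ⟨Finset.disjoint_of_subset_right
                  Finset.subset_union_right h2.1, by omega⟩
              · intro T _ _
                refine mul_nonneg (by positivity) (mul_nonneg (by positivity)
                  (Finset.sum_nonneg fun V' _ => ?_))
                split_ifs
                · exact prodAvg_nonneg fun _ => sq_nonneg _
                · exact le_rfl
          _ = r ^ (2 * s) * (2 ^ S.card * ∑ V' ∈ S.powerset, ∑ T ∈ levelSets (s - S.card) V,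
              if Disjoint S T then
                prodAvg (fun w => levelFn J ν π (V ∪ V') T (V.piecewise x z) w ^ 2) else 0) := by
              rw [← Finset.mul_sum, ← Finset.mul_sum, Finset.sum_comm]
          _ ≤ r ^ (2 * s) * (2 ^ S.card * ∑ V' ∈ S.powerset, Y) := by
              gcongr with V' hV'
              have hV' := Finset.mem_powerset.1 hV'
              refine le_trans ?_ (ih (s - S.card) (by omega) (V ∪ V') ?_ (V.piecewise x z))
              · rw [← Finset.sum_filter, levelEnergy]
                refine Finset.sum_le_sum_of_subset_of_nonneg ?_
                  fun _ _ _ => prodAvg_nonneg fun _ => sq_nonneg _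
                intro T hT
                rw [Finset.mem_filter, mem_levelSets] at hT
                exact mem_levelSets.2 ⟨Finset.disjoint_union_left.2
                  ⟨hT.1.1, Finset.disjoint_of_subset_left hV' hT.2⟩, hT.1.2⟩
              · have := Finset.card_union_le V V'
                have := Finset.card_le_card hV'
                omega
          _ = r ^ (2 * s) * (4 ^ S.card * Y) := by
              rw [Finset.sum_const, Finset.card_powerset, nsmul_eq_mul]
              push_cast
              rw [← mul_assoc (2 ^ S.card), ← mul_pow]
              norm_num
          _ ≤ r ^ (2 * s) * (4 ^ s * Y) := by
              gcongr
              · norm_num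
              · exact hSs.1
          _ = _ := by ring
      · have : D S z = 0 := by
          refine Finset.sum_eq_zero fun T _ => ?_
          have hR : S ∪ T ∉ levelSets s V := by
            intro h
            have h := mem_levelSets.1 h
            exact hSs ⟨(Finset.card_le_card Finset.subset_union_left).trans h.2,
              Finset.disjoint_of_subset_right Finset.subset_union_left h.1⟩
          simp [hg, if_neg hR, partAvg, prodAvg_const]
        rw [this]
        positivity
    have hEnn : 0 ≤ E := Finset.sum_nonneg fun _ _ => prodAvg_nonneg fun _ => sq_nonneg _
    have hDsum : ∑ S ∈ (Finset.univ : Finset ι).powerset, prodAvg (D S)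
        ≤ r ^ (2 * s) * 2 ^ s * E := by
      have e1 : ∀ S, prodAvg (D S) = ∑ T ∈ (Finset.univ \ S).powerset,
          prodAvg (fun w => g () (S ∪ T) w ^ 2) := by
        intro S
        simp only [hD, prodAvg_sum]
        exact Finset.sum_congr rfl fun T _ => prodAvg_partAvg _ _
      simp only [e1]
      rw [sum_sum_union_eq (fun R => prodAvg (fun w => g () R w ^ 2))]
      calc ∑ R : Finset ι, (2 : ℝ) ^ R.card * prodAvg (fun w => g () R w ^ 2)
          ≤ ∑ R : Finset ι, if R ∈ levelSets s V then
              2 ^ s * (r ^ (2 * s) * prodAvg (fun w => levelFn J ν π V R x w ^ 2)) else 0 := by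
            refine Finset.sum_le_sum fun R _ => ?_
            have := hgsq R
            split_ifs at this ⊢ with hR
            · refine mul_le_mul (pow_le_pow_right₀ (by norm_num) (mem_levelSets.1 hR).2) this
                (prodAvg_nonneg fun _ => sq_nonneg _) (by positivity)
            · exact mul_nonpos_of_nonneg_of_nonpos (by positivity) this
        _ = _ := by
            rw [Finset.sum_ite_mem, Finset.univ_inter, ← Finset.mul_sum, ← Finset.mul_sum, hE,
              levelEnergy]
            ring
    have key2 := prodAvg_mono key
    rw [prodAvg_const, prodAvg_sum] at key2
    refine key2.trans ?_
    have e2 : ∀ S : Finset ι, prodAvg (partAvg S fun z => D S z ^ (n + 2))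
        = prodAvg fun z => D S z ^ (n + 2) := fun S => prodAvg_partAvg _ _
    have e3 := Finset.sum_congr (rfl : (Finset.univ : Finset ι).powerset = _) fun S _ => e2 S
    refine e3.le.trans ?_
    rw [← Finset.sum_erase_add _ _ (Finset.empty_mem_powerset _), add_comm]
    refine add_le_add ?_ ?_
    · exact prodAvg_le_of_le fun z => pow_le_pow_left₀ (hD0 _ _) (hDempty z) _
    · refine le_trans ?_ (mul_le_mul_of_nonneg_left hDsum (by positivity))
      rw [Finset.mul_sum]
      refine (Finset.sum_le_sum fun S hS => ?_).trans (Finset.sum_le_sum_of_subset_of_nonneg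
        (Finset.erase_subset _ _) fun S _ _ => mul_nonneg (by positivity) (prodAvg_nonneg (hD0 S)))
      rw [← prodAvg_const_mul]
      refine prodAvg_mono fun z => ?_
      rw [pow_succ]
      exact mul_le_mul_of_nonneg_right
        (pow_le_pow_left₀ (hD0 _ _) (hDne S (Finset.ne_of_mem_erase hS) z) _) (hD0 _ _)
  · intro _ T i _ hi y
    simp only [hg, coordAvg]
    by_cases hT : T ∈ levelSets s V
    · have := coordAvg_levelFn J ν π (V := V) hi x y
      simp only [if_pos hT, coordAvg, ← Finset.mul_sum] at this ⊢
      rw [mul_div_assoc, this, mul_zero]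
    · simp [if_neg hT]
  · intro _ T i _ _ hi y t
    simp only [hg]
    split_ifs
    · congr 1
      refine levelFn_congr J ν π (fun _ _ => rfl) fun j hj => ?_
      rw [Function.update_of_ne]
      rintro rfl
      exact hi hj
    · rfl

/-- **Level inequality.** The low-level energy of a bounded function along a nearly
equidistributed sequence is small. -/
theorem levelEnergy_le {ρ : ℝ} {n : ℕ} (hρ0 : 0 < ρ) (hρ1 : ρ ≤ 1)
    (hρ : 18 * 2 ^ (n + 2) * ρ ^ 2 ≤ 1) {e : ℕ} {μ ε κ Y K : ℝ} (hν : ∀ j ∈ J, |ν j| ≤ μ)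
    (hκ : ∀ U : Finset ι, U.card ≤ e → ∀ x, ∑ j ∈ J, |ν j| * indKer U x (π j) ≤ κ)
    (hε : ∀ W : Finset ι, W.card ≤ (2 * (n + 2) + 1) * e →
      ∀ x, |∑ j ∈ J, μ * indKer W x (π j) - 1| ≤ ε)
    (hK : ((Finset.univ.filter fun T : Finset ι => T.card ≤ e).card : ℝ) ≤ K)
    (hεK : ε * (K * 2 ^ e) ^ (2 * (n + 2)) ≤ 1) (hκY : κ ^ 2 ≤ Y)
    (hY : 3 * (4 * ρ⁻¹ ^ 2) ^ (e * (n + 2)) * κ ^ (2 * n + 3) ≤ Y ^ (n + 2)) (s : ℕ) :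
    ∀ V : Finset ι, V.card + s ≤ e → ∀ x, levelEnergy J ν π s V x ≤ Y := by
  induction s using Nat.strong_induction_on with
  | _ s ih =>
    intro V hV x
    by_contra! hlt
    have hμ : ∀ j ∈ J, 0 ≤ μ := fun j hj => (abs_nonneg _).trans (hν j hj)
    have hκ0 : 0 ≤ κ := le_trans (Finset.sum_nonneg fun j _ =>
      mul_nonneg (abs_nonneg _) (indKer_nonneg _ _ _)) (hκ ∅ (by simp) x)
    have hY0 : 0 ≤ Y := (sq_nonneg κ).trans hκY
    have hε0 : 0 ≤ ε := (abs_nonneg _).trans (hε ∅ (by simp) x)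
    set E := levelEnergy J ν π s V x with hE
    have hE0 : 0 < E := hY0.trans_lt hlt
    have hmom := levelFn_moment_le J ν π hρ0 hρ1 hρ (s := s) (V := V) hY0 x
      fun s' hs' V' hV' x' => ih s' hs' V' (hV'.trans hV) x'
    rw [← hE] at hmom
    set G : (∀ i, Ω i) → ℝ := fun z => ∑ T ∈ levelSets s V, levelFn J ν π V T x z with hG
    have h1 : E ≤ ∑ j ∈ J, (|ν j| * indKer V x (π j)) * |G (π j)| := by
      rw [hE, levelEnergy_eq]
      refine Finset.sum_le_sum fun j _ => (le_abs_self _).trans (le_of_eq ?_)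
      rw [abs_mul, abs_mul, abs_of_nonneg (indKer_nonneg _ _ _)]
    have h2 := weighted_sum_pow_le J (fun j => |ν j| * indKer V x (π j)) (fun j => |G (π j)|)
      (fun j _ => mul_nonneg (abs_nonneg _) (indKer_nonneg _ _ _)) (fun j _ => abs_nonneg _)
      (2 * n + 3)
    have h3 : ∑ j ∈ J, (|ν j| * indKer V x (π j)) * |G (π j)| ^ (2 * n + 3 + 1)
        ≤ ∑ j ∈ J, μ * indKer V x (π j) * G (π j) ^ (2 * (n + 2)) := by
      refine Finset.sum_le_sum fun j hj => ?_
      have : 2 * n + 3 + 1 = 2 * (n + 2) := by ring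
      rw [this, Even.pow_abs (even_two_mul _)]
      refine mul_le_mul_of_nonneg_right (mul_le_mul_of_nonneg_right (hν j hj)
        (indKer_nonneg _ _ _)) ((even_two_mul _).pow_nonneg _)
    have h4 := sum_moment_le J π (μ := μ) (ε := ε) (b := 2 ^ e * κ) (V := V) (s := s)
      (N := 2 * (n + 2)) (fun W hW => hε W (hW.trans (by nlinarith))) (levelSets s V)
      (fun T hT => mem_levelSets.1 hT) (fun T y => levelFn J ν π V T x y)
      (fun T _ y z h => levelFn_congr J ν π (fun _ _ => rfl) h)
      (fun T hT y => by
        have hT := mem_levelSets.1 hT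
        refine (abs_levelFn_le J ν π hκ hT.1 (by omega) x y).trans ?_
        gcongr
        · norm_num
        · omega) x
    have h5 : ε * ((levelSets s V).card * (2 ^ e * κ)) ^ (2 * (n + 2)) ≤ κ ^ (2 * (n + 2)) := by
      have hc : ((levelSets s V).card : ℝ) ≤ K := by
        refine le_trans ?_ hK
        have : levelSets s V ⊆ Finset.univ.filter fun T : Finset ι => T.card ≤ e := by
          intro T hT
          have hT := mem_levelSets.1 hT
          simp only [Finset.mem_filter, Finset.mem_univ, true_and]
          omega
        exact_mod_cast Finset.card_le_card this
      calc ε * ((levelSets s V).card * (2 ^ e * κ)) ^ (2 * (n + 2))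
          ≤ ε * (K * (2 ^ e * κ)) ^ (2 * (n + 2)) := by gcongr
        _ = (ε * (K * 2 ^ e) ^ (2 * (n + 2))) * κ ^ (2 * (n + 2)) := by
            rw [← mul_assoc, mul_pow _ κ, mul_assoc]
        _ ≤ 1 * κ ^ (2 * (n + 2)) := by gcongr
        _ = _ := one_mul _
    set r := ρ⁻¹ with hr
    have hr1 : 1 ≤ r := (one_le_inv₀ hρ0).2 hρ1
    have h6 : E ^ (2 * (n + 2)) ≤ κ ^ (2 * n + 3) *
        ((r ^ (2 * s) * E) ^ (n + 2) + (r ^ (2 * s) * 4 ^ s * Y) ^ (n + 1)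
          * (r ^ (2 * s) * 2 ^ s * E) + κ ^ (2 * (n + 2))) := by
      have hexp : 2 * (n + 2) = 2 * n + 3 + 1 := by ring
      calc E ^ (2 * (n + 2)) = E ^ (2 * n + 3 + 1) := by rw [hexp]
        _ ≤ (∑ j ∈ J, (|ν j| * indKer V x (π j)) * |G (π j)|) ^ (2 * n + 3 + 1) := by gcongr
        _ ≤ _ := h2
        _ ≤ κ ^ (2 * n + 3) * _ := by
          refine mul_le_mul (pow_le_pow_left₀ (Finset.sum_nonneg fun j _ =>
            mul_nonneg (abs_nonneg _) (indKer_nonneg _ _ _)) (hκ V (by omega) x) _)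
            (h3.trans (h4.trans (add_le_add hmom h5))) ?_ (by positivity)
          exact Finset.sum_nonneg fun j _ => mul_nonneg
            (mul_nonneg (abs_nonneg _) (indKer_nonneg _ _ _)) (by positivity)
    have hs : s ≤ e := by omega
    have h7 : ((r ^ (2 * s) * E) ^ (n + 2) + (r ^ (2 * s) * 4 ^ s * Y) ^ (n + 1)
          * (r ^ (2 * s) * 2 ^ s * E) + κ ^ (2 * (n + 2)))
        ≤ 3 * ((4 * r ^ 2) ^ (e * (n + 2)) * E ^ (n + 2)) := by
      have ha : r ^ (2 * s) * 4 ^ s ≤ (4 * r ^ 2) ^ e := by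
        rw [pow_mul, ← mul_pow, mul_comm]
        exact pow_le_pow_right₀ (by nlinarith) hs
      have hb1 : r ^ (2 * s) ≤ (4 * r ^ 2) ^ e :=
        le_trans (le_mul_of_one_le_right (by positivity) (one_le_pow₀ (by norm_num))) ha
      have hb2 : r ^ (2 * s) * 2 ^ s ≤ (4 * r ^ 2) ^ e :=
        le_trans (by gcongr; norm_num) ha
      have hb3 : 1 ≤ (4 * r ^ 2) ^ e := one_le_pow₀ (by nlinarith)
      have i1 : (r ^ (2 * s) * E) ^ (n + 2) ≤ (4 * r ^ 2) ^ (e * (n + 2)) * E ^ (n + 2) := by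
        rw [pow_mul (4 * r ^ 2), ← mul_pow]; gcongr
      have i2 : (r ^ (2 * s) * 4 ^ s * Y) ^ (n + 1) * (r ^ (2 * s) * 2 ^ s * E)
          ≤ (4 * r ^ 2) ^ (e * (n + 2)) * E ^ (n + 2) := by
        calc _ ≤ ((4 * r ^ 2) ^ e * E) ^ (n + 1) * ((4 * r ^ 2) ^ e * E) := by gcongr
          _ = _ := by rw [pow_mul (4 * r ^ 2), ← mul_pow, pow_succ _ (n + 1)]
      have i3 : κ ^ (2 * (n + 2)) ≤ (4 * r ^ 2) ^ (e * (n + 2)) * E ^ (n + 2) := by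
        rw [pow_mul, pow_mul, ← mul_pow]
        refine pow_le_pow_left₀ (by positivity) ?_ _
        nlinarith
      linarith
    have h8 : E ^ (n + 2) * E ^ (n + 2) ≤ Y ^ (n + 2) * E ^ (n + 2) := by
      calc E ^ (n + 2) * E ^ (n + 2) = E ^ (2 * (n + 2)) := by ring
        _ ≤ κ ^ (2 * n + 3) * (3 * ((4 * r ^ 2) ^ (e * (n + 2)) * E ^ (n + 2))) :=
          h6.trans (mul_le_mul_of_nonneg_left h7 (by positivity))
        _ = (3 * (4 * r ^ 2) ^ (e * (n + 2)) * κ ^ (2 * n + 3)) * E ^ (n + 2) := by ring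
        _ ≤ _ := by gcongr
    have h9 := le_of_mul_le_mul_right h8 (by positivity)
    exact absurd (lt_of_pow_lt_pow_left₀ _ hE0.le
      (h9.trans_lt (pow_lt_pow_left₀ hlt hY0 (by omega)))) (lt_irrefl _)

end LevelInequality

open ComplexConjugate in
/-- **Bessel's inequality** for characters of a finite abelian group. -/
theorem AddChar.bessel {G : Type} [AddCommGroup G] [Fintype G] (𝒳 : Finset (AddChar G ℂ))
    (F : G → ℂ) :
    ∑ χ ∈ 𝒳, ‖∑ y, conj (χ y) * F y‖ ^ 2 ≤ Fintype.card G * ∑ y, ‖F y‖ ^ 2 := by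
  have hn : (0 : ℝ) < Fintype.card G := by exact_mod_cast Fintype.card_pos
  set c : ℝ := √(Fintype.card G) with hc
  have hc2 : c * c = Fintype.card G := Real.mul_self_sqrt hn.le
  have hc0 : 0 < c := Real.sqrt_pos.2 hn
  let v : AddChar G ℂ → EuclideanSpace ℂ G := fun χ => WithLp.toLp 2 fun y => χ y * (c : ℂ)⁻¹
  have hv : Orthonormal ℂ v := by
    classical
    rw [orthonormal_iff_ite]
    intro χ ψ
    rw [PiLp.inner_apply]
    have e : ∀ y, inner ℂ (v χ y) (v ψ y) = (c : ℂ)⁻¹ * (c : ℂ)⁻¹ * (ψ - χ) y := by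
      intro y
      simp only [v, RCLike.inner_apply, map_mul, map_inv₀, Complex.conj_ofReal,
        AddChar.sub_apply', div_eq_mul_inv, AddChar.inv_apply_eq_conj]
      ring
    simp only [e]
    rw [← Finset.mul_sum, AddChar.sum_eq_ite, ← mul_inv, ← Complex.ofReal_mul, hc2]
    have hn' : (Fintype.card G : ℂ) ≠ 0 := by exact_mod_cast Fintype.card_ne_zero
    by_cases h : χ = ψ
    · simp [h]
    · have : ψ - χ ≠ 0 := fun h' => h (sub_eq_zero.1 h').symm
      simp [h, this]
  have key := hv.sum_inner_products_le (s := 𝒳) (WithLp.toLp 2 F)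
  rw [EuclideanSpace.norm_sq_eq] at key
  have e : ∀ χ, ‖inner ℂ (v χ) (WithLp.toLp 2 F)‖ ^ 2
      = (Fintype.card G : ℝ)⁻¹ * ‖∑ y, conj (χ y) * F y‖ ^ 2 := by
    intro χ
    rw [PiLp.inner_apply]
    have e1 : ∀ y, inner ℂ (v χ y) (F y) = (c : ℂ)⁻¹ * (conj (χ y) * F y) := by
      intro y
      simp only [v, RCLike.inner_apply, map_mul, map_inv₀, Complex.conj_ofReal]
      ring
    simp only [e1]
    rw [← Finset.mul_sum, norm_mul, mul_pow, norm_inv, Complex.norm_real, Real.norm_of_nonneg hc0.le,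
      ← hc2]
    field_simp
  simp only [e] at key
  rw [← Finset.mul_sum, inv_mul_le_iff₀ hn] at key
  exact key

section CharacterSupport

variable {ι : Type} [Fintype ι] [DecidableEq ι] {Ω : ι → Type} [∀ i, Fintype (Ω i)]
  [∀ i, DecidableEq (Ω i)] [∀ i, AddCommGroup (Ω i)]

open Classical in
/-- The coordinates on which a character of a product group is nontrivial. -/
noncomputable def charSupp (χ : AddChar (∀ i, Ω i) ℂ) : Finset ι :=
  Finset.univ.filter fun i => ∃ t, χ (Pi.single i t) ≠ 1

theorem apply_single_of_notMem {χ : AddChar (∀ i, Ω i) ℂ} {i : ι} (hi : i ∉ charSupp χ)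
    (t : Ω i) : χ (Pi.single i t) = 1 := by
  by_contra h
  exact hi (Finset.mem_filter.2 ⟨Finset.mem_univ _, t, h⟩)

theorem addChar_pi_apply (χ : AddChar (∀ i, Ω i) ℂ) (y : ∀ i, Ω i) :
    χ y = ∏ i, χ (Pi.single i (y i)) := by
  conv_lhs => rw [← Finset.univ_sum_single y]
  generalize (Finset.univ : Finset ι) = s
  induction s using Finset.induction_on with
  | empty => simp
  | insert i s hi ih => rw [Finset.sum_insert hi, Finset.prod_insert hi, AddChar.map_add_eq_mul, ih]

theorem sum_apply_single {χ : AddChar (∀ i, Ω i) ℂ} {i : ι} (hi : i ∈ charSupp χ) :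
    ∑ t : Ω i, χ (Pi.single i t) = 0 := by
  classical
  let ψ : AddChar (Ω i) ℂ := χ.compAddMonoidHom (AddMonoidHom.single Ω i)
  have hψ : ∀ t, ψ t = χ (Pi.single i t) := fun _ => rfl
  obtain ⟨t, ht⟩ := (Finset.mem_filter.1 hi).2
  have hne : ψ ≠ 0 := by
    intro h
    exact ht (by rw [← hψ, h]; rfl)
  have := AddChar.sum_eq_ite ψ
  rwa [if_neg hne] at this

theorem sum_balKer_mul_addChar (χ : AddChar (∀ i, Ω i) ℂ) (z : ∀ i, Ω i) :
    ∑ y, (balKer (charSupp χ) y z : ℂ) * χ y = Fintype.card (∀ i, Ω i) * χ z := by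
  have e : ∀ y, (balKer (charSupp χ) y z : ℂ) * χ y = ∏ i,
      ((if i ∈ charSupp χ then ((if z i = y i then (Fintype.card (Ω i) : ℂ) else 0) - 1) else 1)
        * χ (Pi.single i (y i))) := by
    intro y
    rw [Finset.prod_mul_distrib, ← addChar_pi_apply, Finset.prod_ite_mem, Finset.univ_inter, balKer,
      Complex.ofReal_prod]
    congr 1
    refine Finset.prod_congr rfl fun i _ => ?_
    split_ifs <;> simp
  simp only [e]
  have h := Finset.prod_univ_sum (fun i => (Finset.univ : Finset (Ω i)))
    (fun i t => ((if i ∈ charSupp χ then ((if z i = t then (Fintype.card (Ω i) : ℂ) else 0) - 1)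
      else 1) * χ (Pi.single i t)))
  rw [Fintype.piFinset_univ] at h
  rw [← h, Fintype.card_pi, addChar_pi_apply χ z, Nat.cast_prod, ← Finset.prod_mul_distrib]
  refine Finset.prod_congr rfl fun i _ => ?_
  by_cases hi : i ∈ charSupp χ
  · simp only [if_pos hi, sub_mul, one_mul, ite_mul, zero_mul, Finset.sum_sub_distrib,
      Finset.sum_ite_eq, Finset.mem_univ, if_true, sum_apply_single hi, sub_zero]
  · simp [if_neg hi, apply_single_of_notMem hi]

open ComplexConjugate in
/-- The level energy controls the Fourier coefficients at characters of small support. -/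
theorem sum_norm_sq_le_levelEnergy {σ : Type} (J : Finset σ) (ν : σ → ℝ) (π : σ → ∀ i, Ω i)
    (e : ℕ) (𝒳 : Finset (AddChar (∀ i, Ω i) ℂ)) (h𝒳 : ∀ χ ∈ 𝒳, (charSupp χ).card ≤ e)
    (x : ∀ i, Ω i) :
    ∑ χ ∈ 𝒳, ‖∑ j ∈ J, (ν j : ℂ) * conj (χ (π j))‖ ^ 2 ≤ levelEnergy J ν π e ∅ x := by
  classical
  have hn : (0 : ℝ) < Fintype.card (∀ i, Ω i) := by exact_mod_cast Fintype.card_pos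
  have h1 : ∀ χ, ∑ j ∈ J, (ν j : ℂ) * conj (χ (π j)) = (Fintype.card (∀ i, Ω i) : ℂ)⁻¹ *
      ∑ y, conj (χ y) * (levelFn J ν π ∅ (charSupp χ) x y : ℂ) := by
    intro χ
    have hn' : (Fintype.card (∀ i, Ω i) : ℂ) ≠ 0 := by exact_mod_cast hn.ne'
    rw [eq_inv_mul_iff_mul_eq₀ hn', Finset.mul_sum]
    simp only [levelFn, Complex.ofReal_sum, Complex.ofReal_mul, Finset.mul_sum]
    rw [Finset.sum_comm]
    refine Finset.sum_congr rfl fun j _ => ?_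
    have h2 := congrArg conj (sum_balKer_mul_addChar χ (π j))
    simp only [map_sum, map_mul, Complex.conj_ofReal, Complex.conj_natCast] at h2
    rw [mul_left_comm, ← h2, Finset.mul_sum]
    refine Finset.sum_congr rfl fun y _ => ?_
    simp only [indKer, Finset.prod_empty, Complex.ofReal_one]
    ring
  have hmaps : ∀ χ ∈ 𝒳, charSupp χ ∈ levelSets e (∅ : Finset ι) := fun χ hχ =>
    mem_levelSets.2 ⟨Finset.disjoint_empty_left _, h𝒳 χ hχ⟩
  rw [← Finset.sum_fiberwise_of_maps_to hmaps, levelEnergy]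
  refine Finset.sum_le_sum fun T _ => ?_
  have h3 : ∀ χ ∈ 𝒳.filter fun χ => charSupp χ = T, ‖∑ j ∈ J, (ν j : ℂ) * conj (χ (π j))‖ ^ 2
      = ((Fintype.card (∀ i, Ω i) : ℝ)⁻¹) ^ 2 *
        ‖∑ y, conj (χ y) * (levelFn J ν π ∅ T x y : ℂ)‖ ^ 2 := by
    intro χ hχ
    rw [h1, (Finset.mem_filter.1 hχ).2, norm_mul, mul_pow, norm_inv, Complex.norm_natCast]
  rw [Finset.sum_congr rfl h3, ← Finset.mul_sum]
  have h4 := AddChar.bessel (𝒳.filter fun χ => charSupp χ = T)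
    (fun y => (levelFn J ν π ∅ T x y : ℂ))
  simp only [Complex.norm_real, Real.norm_eq_abs, sq_abs] at h4
  refine (mul_le_mul_of_nonneg_left h4 (by positivity)).trans (le_of_eq ?_)
  rw [prodAvg]
  field_simp

end CharacterSupport

/-- The additive character `e(t) = exp(2πit)`. -/
noncomputable def ex (t : ℝ) : ℂ := Complex.exp (2 * Real.pi * Complex.I * t)

theorem ex_add (s t : ℝ) : ex (s + t) = ex s * ex t := by
  rw [ex, ex, ex, ← Complex.exp_add]
  push_cast
  ring_nf

@[simp] theorem ex_zero : ex 0 = 1 := by simp [ex]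

@[simp] theorem ex_intCast (n : ℤ) : ex n = 1 := by
  rw [ex, Complex.exp_eq_one_iff]
  exact ⟨n, by push_cast; ring⟩

@[simp] theorem norm_ex (t : ℝ) : ‖ex t‖ = 1 := by
  rw [ex, show (2 * Real.pi * Complex.I * t : ℂ) = ((2 * Real.pi * t : ℝ) : ℂ) * Complex.I by
    push_cast; ring]
  exact Complex.norm_exp_ofReal_mul_I _

theorem ex_add_intCast (t : ℝ) (n : ℤ) : ex (t + n) = ex t := by simp [ex_add]

theorem ex_neg (t : ℝ) : ex (-t) = (ex t)⁻¹ := by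
  refine eq_inv_of_mul_eq_one_left ?_
  rw [← ex_add]
  simp

open ComplexConjugate in
theorem conj_ex (t : ℝ) : conj (ex t) = ex (-t) := by
  rw [ex_neg, Complex.inv_def, Complex.normSq_eq_norm_sq]
  simp

theorem ex_nsmul (n : ℕ) (t : ℝ) : ex (n * t) = ex t ^ n := by
  induction n with
  | zero => simp
  | succ n ih => rw [pow_succ, ← ih, ← ex_add]; push_cast; ring_nf

theorem norm_ex_sub_one (t : ℝ) : ‖ex t - 1‖ = 2 * |Real.sin (Real.pi * t)| := by
  have h := Complex.norm_exp_I_mul_ofReal_sub_one (2 * Real.pi * t)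
  rw [ex, show (2 * Real.pi * Complex.I * t : ℂ) = Complex.I * ((2 * Real.pi * t : ℝ) : ℂ) by
    push_cast; ring, h, Real.norm_eq_abs, abs_mul, abs_two]
  ring_nf

theorem norm_ex_sub_one_le (t : ℝ) : ‖ex t - 1‖ ≤ 8 * |t| := by
  rw [norm_ex_sub_one]
  have h := Real.abs_sin_le_one (Real.pi * t)
  have h2 : |Real.sin (Real.pi * t)| ≤ |Real.pi * t| := Real.abs_sin_le_abs
  rw [abs_mul, abs_of_pos Real.pi_pos] at h2
  nlinarith [abs_nonneg t, Real.pi_lt_four]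

theorem le_norm_ex_sub_one {t : ℝ} (ht : |t| ≤ 1 / 2) : 4 * |t| ≤ ‖ex t - 1‖ := by
  rw [norm_ex_sub_one]
  have h := Real.mul_abs_le_abs_sin (x := Real.pi * t) (by
    rw [abs_mul, abs_of_pos Real.pi_pos]; nlinarith [Real.pi_pos])
  rw [abs_mul, abs_of_pos Real.pi_pos] at h
  have : 2 / Real.pi * (Real.pi * |t|) = 2 * |t| := by field_simp
  linarith

/-- `x` is within `ε` of an integer. -/
def NearInt (x ε : ℝ) : Prop := ∃ r : ℤ, |x - r| ≤ ε

theorem NearInt.mono {x ε ε' : ℝ} (h : NearInt x ε) (hε : ε ≤ ε') : NearInt x ε' := by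
  obtain ⟨r, hr⟩ := h
  exact ⟨r, hr.trans hε⟩

theorem NearInt.int_mul {x ε : ℝ} (h : NearInt x ε) (m : ℤ) : NearInt (m * x) (|(m : ℝ)| * ε) := by
  obtain ⟨r, hr⟩ := h
  refine ⟨m * r, ?_⟩
  push_cast
  rw [← mul_sub, abs_mul]
  exact mul_le_mul_of_nonneg_left hr (abs_nonneg _)

theorem NearInt.nat_mul {x ε : ℝ} (h : NearInt x ε) (m : ℕ) : NearInt (m * x) (m * ε) := by
  simpa using h.int_mul (m : ℤ)

theorem NearInt.add {x y ε δ : ℝ} (hx : NearInt x ε) (hy : NearInt y δ) :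
    NearInt (x + y) (ε + δ) := by
  obtain ⟨r, hr⟩ := hx
  obtain ⟨s, hs⟩ := hy
  refine ⟨r + s, ?_⟩
  push_cast
  rw [add_sub_add_comm]
  exact (abs_add_le _ _).trans (add_le_add hr hs)

theorem NearInt.sub {x y ε δ : ℝ} (hx : NearInt x ε) (hy : NearInt y δ) :
    NearInt (x - y) (ε + δ) := by
  obtain ⟨r, hr⟩ := hx
  obtain ⟨s, hs⟩ := hy
  refine ⟨r - s, ?_⟩
  push_cast
  rw [sub_sub_sub_comm]
  exact (abs_sub _ _).trans (add_le_add hr hs)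

theorem NearInt.sum {α : Type*} (s : Finset α) (x ε : α → ℝ) (h : ∀ i ∈ s, NearInt (x i) (ε i)) :
    NearInt (∑ i ∈ s, x i) (∑ i ∈ s, ε i) := by
  classical
  induction s using Finset.induction_on with
  | empty => exact ⟨0, by simp⟩
  | insert a s ha ih =>
    rw [Finset.sum_insert ha, Finset.sum_insert ha]
    exact (h a (Finset.mem_insert_self _ _)).add
      (ih fun i hi => h i (Finset.mem_insert_of_mem hi))

theorem nearInt_of_one_le (x : ℝ) {ε : ℝ} (hε : 1 ≤ ε) : NearInt x ε :=
  ⟨round x, (abs_sub_round x).trans (by linarith)⟩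

theorem nearInt_of_abs_le {x ε : ℝ} (h : |x| ≤ ε) : NearInt x ε := ⟨0, by simpa using h⟩

/-- A dense set of integers has two elements in a short window that are far apart relative to the
window length. -/
theorem exists_pair_in_window {X L : ℕ} {δ : ℝ} (H : Finset ℕ) (hH : ∀ h ∈ H, h < X)
    (hcard : δ * X ≤ H.card) (hδ : 0 < δ) (hL : 1 ≤ L) (hLX : L ≤ X) :
    ∃ h ∈ H, ∃ t : ℕ, h + t ∈ H ∧ t < L ∧ δ * L / 2 - 1 ≤ t := by
  have hL' : (0 : ℝ) < L := by exact_mod_cast hL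
  have hX' : (0 : ℝ) < X := lt_of_lt_of_le hL' (by exact_mod_cast hLX)
  have hmaps : ∀ h ∈ H, h / L ∈ Finset.range (X / L + 1) := fun h hh =>
    Finset.mem_range.2 (Nat.lt_succ_of_le (Nat.div_le_div_right (hH h hh).le))
  have hblocks : ((Finset.range (X / L + 1)).card : ℝ) * (δ * L / 2) ≤ H.card := by
    rw [Finset.card_range]
    refine le_trans ?_ hcard
    have h1 : ((X / L : ℕ) : ℝ) * L ≤ X := by exact_mod_cast Nat.div_mul_le_self X L
    have h2 : (L : ℝ) ≤ X := by exact_mod_cast hLX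
    push_cast
    nlinarith
  obtain ⟨b, -, hb⟩ := Finset.exists_le_card_fiber_of_nsmul_le_card_of_maps_to
    (b := δ * L / 2) hmaps ⟨0, by simp⟩ (by rw [nsmul_eq_mul]; exact hblocks)
  set F := H.filter fun h => h / L = b with hF
  have hne : F.Nonempty := by
    rw [← Finset.card_pos]
    have : (0 : ℝ) < F.card := lt_of_lt_of_le (by positivity) hb
    exact_mod_cast this
  have hmin := Finset.mem_filter.1 (F.min'_mem hne)
  have hmax := Finset.mem_filter.1 (F.max'_mem hne)
  have hle : F.min' hne ≤ F.max' hne := F.min'_le _ (F.max'_mem hne)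
  have hsub : F ⊆ Finset.Icc (F.min' hne) (F.max' hne) := fun x hx =>
    Finset.mem_Icc.2 ⟨F.min'_le _ hx, F.le_max' _ hx⟩
  have hcard' := Finset.card_le_card hsub
  rw [Nat.card_Icc] at hcard'
  refine ⟨F.min' hne, hmin.1, F.max' hne - F.min' hne, ?_, ?_, ?_⟩
  · rw [Nat.add_sub_cancel' hle]; exact hmax.1
  · have h1 := Nat.div_add_mod (F.min' hne) L
    have h2 := Nat.div_add_mod (F.max' hne) L
    have h3 := Nat.mod_lt (F.max' hne) hL
    rw [hmin.2] at h1
    rw [hmax.2] at h2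
    omega
  · rw [Nat.cast_sub hle]
    have : (F.card : ℝ) ≤ F.max' hne + 1 - F.min' hne := by
      have : F.card + F.min' hne ≤ F.max' hne + 1 := by omega
      have : (F.card : ℝ) + F.min' hne ≤ F.max' hne + 1 := by exact_mod_cast this
      linarith
    linarith

/-- **Vinogradov's lemma**: if many multiples of `β` are very close to integers, then so is a small
multiple of `β`, with a much better error. -/
theorem exists_small_multiple {X : ℕ} {δ η β : ℝ} (H : Finset ℕ) (hH : ∀ h ∈ H, h < X)
    (hcard : δ * X ≤ H.card) (hδ : 0 < δ) (hδ1 : δ ≤ 1) (hX : 8 ≤ δ * X) (hη0 : 0 ≤ η)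
    (hη : 256 * η < δ ^ 2) (hnear : ∀ h ∈ H, NearInt (h * β) η) :
    ∃ q : ℕ, 1 ≤ q ∧ q * δ ≤ 4 ∧ NearInt (q * β) (32 * η / (δ ^ 2 * X)) := by
  have hdiff : ∀ h ∈ H, ∀ t : ℕ, h + t ∈ H → NearInt (t * β) (2 * η) := by
    intro h hh t ht
    have := (hnear _ ht).sub (hnear h hh)
    push_cast at this
    rw [show ((h : ℝ) + t) * β - h * β = t * β by ring] at this
    exact this.mono (by linarith)
  have hX0 : (0 : ℝ) < X := by nlinarith
  obtain ⟨h, hh, q, hhq, hq1, hq2⟩ := exists_pair_in_window (L := ⌈4 / δ⌉₊) H hH hcard hδ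
    (Nat.one_le_iff_ne_zero.2 (Nat.ceil_pos.2 (by positivity)).ne') (by
      refine Nat.ceil_le.2 ?_
      rw [div_le_iff₀ hδ]; nlinarith)
  have hqδ : q * δ ≤ 4 := by
    have := Nat.lt_ceil.1 hq1
    rw [lt_div_iff₀ hδ] at this
    exact this.le
  have hq : 1 ≤ q := by
    have h1 := Nat.le_ceil (4 / δ)
    rw [div_le_iff₀ hδ] at h1
    have : (1 : ℝ) ≤ q := by nlinarith
    exact_mod_cast this
  refine ⟨q, hq, hqδ, ?_⟩
  obtain ⟨a, ha⟩ := hdiff h hh q hhq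
  refine ⟨a, ?_⟩
  set γ := (q : ℝ) * β - a with hγ
  rcases eq_or_ne γ 0 with h0 | h0
  · rw [h0, abs_zero]; positivity
  have hγ0 : 0 < |γ| := abs_pos.2 h0
  have hη1 : 256 * η < δ := by nlinarith
  set M := ⌊1 / (4 * |γ|)⌋₊ with hM
  have hM1 : (M : ℝ) * (4 * |γ|) ≤ 1 := by
    have := Nat.floor_le (show 0 ≤ 1 / (4 * |γ|) by positivity)
    rwa [le_div_iff₀ (by positivity)] at this
  have hM2 : 1 ≤ M * (8 * |γ|) := by
    have := Nat.lt_floor_add_one (1 / (4 * |γ|))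
    rw [div_lt_iff₀ (by positivity)] at this
    have h2 : 4 * |γ| ≤ 1 / 2 := by linarith
    rw [← hM] at this
    nlinarith
  have hM3 : 4 ≤ δ * M := by
    by_contra hcon
    push Not at hcon
    have h1 : M * (8 * |γ|) ≤ M * (16 * η) :=
      mul_le_mul_of_nonneg_left (by linarith) (Nat.cast_nonneg _)
    have h2 : (M : ℝ) * (16 * η) * 16 ≤ M * δ := by
      have : (0 : ℝ) ≤ M := by positivity
      nlinarith
    nlinarith
  have hM0 : 1 ≤ M := by
    by_contra hcon
    have : M = 0 := by omega
    rw [this] at hM3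
    norm_num at hM3
  have hXnat : 1 ≤ X := by exact_mod_cast (Nat.cast_pos.1 hX0)
  obtain ⟨h', hh', t, ht, htL, htL'⟩ := exists_pair_in_window (L := min X M) H hH hcard hδ
    (le_min hXnat hM0) (min_le_left _ _)
  have hmin4 : 4 ≤ δ * (min X M : ℕ) := by
    rcases le_total X M with h | h
    · rw [min_eq_left h]; linarith
    · rw [min_eq_right h]; exact hM3
  have htlow : δ * (min X M : ℕ) / 4 ≤ t := by linarith
  have htM : (t : ℝ) ≤ M := by
    have : t ≤ M := by omega
    exact_mod_cast this
  have htγ : t * |γ| ≤ 1 / 4 := by nlinarith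
  obtain ⟨b, hb⟩ := (hdiff h' hh' t ht).nat_mul q
  have hqη : (q : ℝ) * (2 * η) < 1 / 4 := by
    have h1 : (q : ℝ) * (256 * η) ≤ q * δ ^ 2 := by gcongr
    nlinarith
  have hid : (q : ℝ) * (t * β) - b = t * γ + ((t * a - b : ℤ) : ℝ) := by
    rw [hγ]; push_cast; ring
  have hzero : (t * a - b : ℤ) = 0 := by
    by_contra hne
    have h1 : (1 : ℝ) ≤ |((t * a - b : ℤ) : ℝ)| := by exact_mod_cast Int.one_le_abs hne
    have h2 : |((t * a - b : ℤ) : ℝ)| ≤ |(q : ℝ) * (t * β) - b| + |t * γ| := by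
      rw [hid]
      have := abs_sub (t * γ + ((t * a - b : ℤ) : ℝ)) (t * γ)
      rwa [add_sub_cancel_left] at this
    rw [abs_mul, Nat.abs_cast] at h2
    linarith
  rw [hid, hzero, Int.cast_zero, add_zero, abs_mul, Nat.abs_cast] at hb
  rcases le_total X M with h | h
  · rw [min_eq_left h] at htlow
    rw [le_div_iff₀ (by positivity)]
    have h1 : δ * X / 4 * |γ| ≤ q * (2 * η) := (mul_le_mul_of_nonneg_right htlow hγ0.le).trans hb
    have h2 : q * δ * (2 * η) ≤ 4 * (2 * η) := by gcongr
    nlinarith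
  · exfalso
    rw [min_eq_right h] at htlow
    have h1 : δ * M / 4 * |γ| ≤ q * (2 * η) := (mul_le_mul_of_nonneg_right htlow hγ0.le).trans hb
    have h2 : q * δ * (2 * η) ≤ 4 * (2 * η) := by gcongr
    have h3 : δ * δ ≤ δ * δ * (M * (8 * |γ|)) := le_mul_of_one_le_right (by positivity) hM2
    nlinarith

/-- Coefficients of a translated polynomial. -/
theorem Polynomial.coeff_taylor_eq_sum {R : Type*} [CommRing R] (P : Polynomial R) (r : R) {D : ℕ}
    (hD : P.natDegree ≤ D) (j : ℕ) : (Polynomial.taylor r P).coeff j =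
      ∑ i ∈ Finset.range (D + 1), (i.choose j : R) * P.coeff i * r ^ (i - j) := by
  conv_lhs => rw [P.as_sum_range' (D + 1) (Nat.lt_succ_of_le hD)]
  rw [map_sum, Polynomial.finsetSum_coeff]
  refine Finset.sum_congr rfl fun i _ => ?_
  rw [Polynomial.taylor_monomial, Polynomial.coeff_C_mul, Polynomial.coeff_X_add_C_pow]
  ring

open ComplexConjugate in
theorem sum_mul_conj_eq (F : ℕ → ℂ) (hF : ∀ n, ‖F n‖ = 1) (X : ℕ) :
    (∑ n ∈ Finset.range X, F n) * conj (∑ n ∈ Finset.range X, F n) =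
      X + ∑ h ∈ Finset.range X, (∑ n ∈ Finset.range (X - 1 - h), F (n + (h + 1)) * conj (F n) +
        conj (∑ n ∈ Finset.range (X - 1 - h), F (n + (h + 1)) * conj (F n))) := by
  induction X with
  | zero => simp
  | succ X ih =>
    have hsplit : ∀ h ∈ Finset.range X,
        ∑ n ∈ Finset.range (X + 1 - 1 - h), F (n + (h + 1)) * conj (F n) =
        ∑ n ∈ Finset.range (X - 1 - h), F (n + (h + 1)) * conj (F n) +
          F X * conj (F (X - 1 - h)) := by
      intro h hh
      have hh' := Finset.mem_range.1 hh
      rw [show X + 1 - 1 - h = (X - 1 - h) + 1 by omega, Finset.sum_range_succ,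
        show X - 1 - h + (h + 1) = X by omega]
    have hrefl := Finset.sum_range_reflect (fun n => conj (F n)) X
    have h1 : F X * conj (F X) = 1 := by
      rw [Complex.mul_conj, Complex.normSq_eq_norm_sq, hF]; simp
    have h4 : ∑ h ∈ Finset.range (X + 1), (∑ n ∈ Finset.range (X + 1 - 1 - h),
          F (n + (h + 1)) * conj (F n) +
        conj (∑ n ∈ Finset.range (X + 1 - 1 - h), F (n + (h + 1)) * conj (F n))) =
        ∑ h ∈ Finset.range X, ((∑ n ∈ Finset.range (X - 1 - h), F (n + (h + 1)) * conj (F n) +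
          F X * conj (F (X - 1 - h))) + (conj (∑ n ∈ Finset.range (X - 1 - h),
          F (n + (h + 1)) * conj (F n)) + conj (F X) * F (X - 1 - h))) := by
      rw [Finset.sum_range_succ, Finset.sum_congr rfl fun h hh => by rw [hsplit h hh]]
      simp
    rw [h4]
    have h2 : ∑ h ∈ Finset.range X, F X * conj (F (X - 1 - h)) =
        F X * conj (∑ n ∈ Finset.range X, F n) := by
      rw [← Finset.mul_sum, hrefl, map_sum]
    have h3 : ∑ h ∈ Finset.range X, conj (F X) * F (X - 1 - h) =
        conj (F X) * ∑ n ∈ Finset.range X, F n := by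
      rw [← Finset.mul_sum, Finset.sum_range_reflect F X]
    simp only [Finset.sum_add_distrib] at ih ⊢
    rw [h2, h3, Finset.sum_range_succ, map_add]
    push_cast
    linear_combination ih + h1

open ComplexConjugate in
/-- **Van der Corput's inequality.** -/
theorem norm_sq_sum_le (F : ℕ → ℂ) (hF : ∀ n, ‖F n‖ = 1) (X : ℕ) :
    ‖∑ n ∈ Finset.range X, F n‖ ^ 2 ≤ X + 2 * ∑ h ∈ Finset.range X,
      ‖∑ n ∈ Finset.range (X - 1 - h), F (n + (h + 1)) * conj (F n)‖ := by
  have h := congrArg norm (sum_mul_conj_eq F hF X)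
  rw [norm_mul, RCLike.norm_conj, ← sq] at h
  rw [h]
  refine (norm_add_le _ _).trans ?_
  rw [Complex.norm_natCast]
  gcongr
  refine (norm_sum_le _ _).trans ?_
  rw [Finset.mul_sum]
  refine Finset.sum_le_sum fun h _ => (norm_add_le _ _).trans ?_
  rw [RCLike.norm_conj, two_mul]

/-- The inverse theorem for Weyl sums of degree at most `d`, with power-type dependence. -/
def WeylInverse (d C : ℕ) : Prop :=
  ∀ X : ℕ, 1 ≤ X → ∀ T : ℝ, 2 ≤ T → ∀ P : Polynomial ℝ, P.natDegree ≤ d →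
    X / T ≤ ‖∑ n ∈ Finset.range X, ex (P.eval (n : ℝ))‖ →
    ∃ q : ℕ, 1 ≤ q ∧ (q : ℝ) ≤ T ^ C ∧ ∀ j, 1 ≤ j → NearInt (q * P.coeff j) (T ^ C / X ^ j)

theorem weylInverse_one : WeylInverse 1 1 := by
  intro X hX T hT P hP hS
  have hX0 : (0 : ℝ) < X := by exact_mod_cast hX
  have hT0 : 0 < T := by linarith
  refine ⟨1, le_rfl, by simpa using by linarith, fun j hj => ?_⟩
  rcases Nat.lt_or_ge 1 j with h | h
  · rw [Polynomial.coeff_eq_zero_of_natDegree_lt (by omega)]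
    exact nearInt_of_abs_le (by simp; positivity)
  obtain rfl : j = 1 := by omega
  set θ := P.coeff 1 with hθ
  refine ⟨round θ, ?_⟩
  set t := θ - round θ with ht
  have ht2 : |t| ≤ 1 / 2 := abs_sub_round θ
  have hev : ∀ n : ℕ, ex (P.eval (n : ℝ)) = ex (P.coeff 0) * ex t ^ n := by
    intro n
    rw [Polynomial.eval_eq_sum_range' (Nat.lt_succ_of_le hP), Finset.sum_range_succ,
      Finset.sum_range_one, ← ex_nsmul, pow_zero, mul_one, pow_one, ex_add, ← hθ]
    congr 1
    have : θ * n = n * t + ((n * round θ : ℤ) : ℝ) := by rw [ht]; push_cast; ring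
    rw [this, ex_add_intCast]
  have hsum : ‖∑ n ∈ Finset.range X, ex (P.eval (n : ℝ))‖ * ‖ex t - 1‖ ≤ 2 := by
    rw [Finset.sum_congr rfl fun n _ => hev n, ← Finset.mul_sum, norm_mul, norm_ex, one_mul,
      ← norm_mul, geom_sum_mul, ← ex_nsmul]
    refine (norm_sub_le _ _).trans ?_
    simp; norm_num
  have h1 := le_norm_ex_sub_one ht2
  have h2 : X / T * (4 * |t|) ≤ 2 :=
    (mul_le_mul hS h1 (by positivity) (norm_nonneg _)).trans hsum
  rw [div_mul_eq_mul_div, div_le_iff₀ hT0] at h2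
  rw [Nat.cast_one, one_mul, pow_one, pow_one, le_div_iff₀ hX0]
  nlinarith [abs_nonneg t]

theorem norm_sum_ex_le {α : Type*} (s : Finset α) (f : α → ℝ) :
    ‖∑ i ∈ s, ex (f i)‖ ≤ s.card := by
  refine (norm_sum_le _ _).trans ?_
  simp

theorem coeff_taylor_sub_self {d : ℕ} {P : Polynomial ℝ} (hP : P.natDegree ≤ d + 1) (r : ℝ) :
    (Polynomial.taylor r P - P).natDegree ≤ d ∧
      (Polynomial.taylor r P - P).coeff d = (d + 1) * r * P.coeff (d + 1) := by
  constructor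
  · rw [Polynomial.natDegree_le_iff_coeff_eq_zero]
    intro j hj
    rw [Polynomial.coeff_sub, Polynomial.coeff_taylor_eq_sum P r hP]
    rcases Nat.lt_or_ge (d + 1) j with h | h
    · rw [Polynomial.coeff_eq_zero_of_natDegree_lt (by omega), sub_zero]
      refine Finset.sum_eq_zero fun i hi => ?_
      rw [Nat.choose_eq_zero_of_lt (by have := Finset.mem_range.1 hi; omega)]
      simp
    · obtain rfl : j = d + 1 := by omega
      rw [Finset.sum_range_succ, Finset.sum_eq_zero fun i hi => ?_]
      · simp
      · rw [Nat.choose_eq_zero_of_lt (Finset.mem_range.1 hi)]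
        simp
  · rw [Polynomial.coeff_sub, Polynomial.coeff_taylor_eq_sum P r hP, Finset.sum_range_succ,
      Finset.sum_range_succ, Finset.sum_eq_zero fun i hi => ?_]
    · simp
      ring
    · rw [Nat.choose_eq_zero_of_lt (Finset.mem_range.1 hi)]
      simp

theorem weyl_top_coeff {d C : ℕ} (hd : 1 ≤ d) (hW : WeylInverse d C) (X : ℕ) (T : ℝ) (hT : 2 ≤ T)
    (hX : T ^ (20 + 15 * C + 5 * d) ≤ X) (P : Polynomial ℝ) (hP : P.natDegree ≤ d + 1)
    (hS : X / T ≤ ‖∑ n ∈ Finset.range X, ex (P.eval (n : ℝ))‖) :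
    ∃ q : ℕ, 1 ≤ q ∧ (q : ℝ) ≤ T ^ (20 + 15 * C + 5 * d) ∧
      NearInt (q * P.coeff (d + 1)) (T ^ (20 + 15 * C + 5 * d) / X ^ (d + 1)) := by
  classical
  have hT1 : 1 ≤ T := by linarith
  have hT0 : 0 < T := by linarith
  have hmono : ∀ {a b : ℕ}, a ≤ b → T ^ a ≤ T ^ b := fun h => pow_le_pow_right₀ hT1 h
  have hX0 : (0 : ℝ) < X := lt_of_lt_of_le (by positivity) hX
  set U := 8 * T ^ 2 with hU
  have hU5 : U ≤ T ^ 5 := by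
    have : (2 : ℝ) ^ 3 ≤ T ^ 3 := by gcongr
    rw [hU, show T ^ 5 = T ^ 3 * T ^ 2 by ring]
    nlinarith [sq_nonneg T]
  have hU2 : 2 ≤ U := by nlinarith
  have hU0 : 0 < U := by linarith
  set B := U ^ C with hB
  have hB5 : B ≤ T ^ (5 * C) := by
    rw [pow_mul]; exact pow_le_pow_left₀ hU0.le hU5 _
  have hB1 : 1 ≤ B := one_le_pow₀ (by linarith)
  have hB0 : 0 < B := by linarith
  set c : ℕ → ℂ := fun h => ∑ n ∈ Finset.range (X - 1 - h),
    ex (P.eval ((n + (h + 1) : ℕ) : ℝ)) * (starRingEnd ℂ) (ex (P.eval (n : ℝ))) with hc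
  have hcval : ∀ h, c h = ∑ n ∈ Finset.range (X - 1 - h),
      ex ((Polynomial.taylor ((h + 1 : ℕ) : ℝ) P - P).eval (n : ℝ)) := by
    intro h
    refine Finset.sum_congr rfl fun n _ => ?_
    rw [conj_ex, ← ex_add, Polynomial.eval_sub, Polynomial.taylor_eval, sub_eq_add_neg]
    push_cast
    rfl
  have hclen : ∀ h, ‖c h‖ ≤ (X - 1 - h : ℕ) := by
    intro h
    rw [hcval]
    simpa using norm_sum_ex_le (Finset.range (X - 1 - h))
      (fun n => (Polynomial.taylor ((h + 1 : ℕ) : ℝ) P - P).eval (n : ℝ))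
  have hvdc := norm_sq_sum_le (fun n => ex (P.eval (n : ℝ))) (fun n => norm_ex _) X
  have hXT : 2 * T ^ 2 ≤ X := by
    refine le_trans ?_ ((hmono (show 5 ≤ 20 + 15 * C + 5 * d by omega)).trans hX)
    nlinarith
  have hbig : (X : ℝ) ^ 2 / (4 * T ^ 2) ≤ ∑ h ∈ Finset.range X, ‖c h‖ := by
    have h1 : (X / T) ^ 2 ≤ ‖∑ n ∈ Finset.range X, ex (P.eval (n : ℝ))‖ ^ 2 := by gcongr
    have h2 := h1.trans hvdc
    have h3 : (X : ℝ) ≤ X ^ 2 / (2 * T ^ 2) := by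
      rw [le_div_iff₀ (by positivity)]; nlinarith
    have h4 : ((X : ℝ) / T) ^ 2 = 2 * (X ^ 2 / (2 * T ^ 2)) := by field_simp
    have h5 : (X : ℝ) ^ 2 / (4 * T ^ 2) = X ^ 2 / (2 * T ^ 2) / 2 := by field_simp; norm_num
    rw [h4] at h2
    rw [h5]
    linarith
  set H0 := (Finset.range X).filter fun h => X / U ≤ ‖c h‖ with hH0
  have hH0card : X / U ≤ H0.card := by
    have h1 : ∑ h ∈ Finset.range X, ‖c h‖ ≤ H0.card * X + X * (X / U) := by
      rw [← Finset.sum_filter_add_sum_filter_not _ (fun h => X / U ≤ ‖c h‖)]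
      refine add_le_add ?_ ?_
      · refine (Finset.sum_le_card_nsmul _ _ (X : ℝ) fun h _ => (hclen h).trans ?_).trans ?_
        · exact_mod_cast (by omega : X - 1 - h ≤ X)
        · rw [nsmul_eq_mul]
      · refine (Finset.sum_le_card_nsmul _ _ (X / U : ℝ) fun h hh => ?_).trans ?_
        · exact (not_le.1 (Finset.mem_filter.1 hh).2).le
        · rw [nsmul_eq_mul]
          gcongr
          exact_mod_cast (Finset.card_filter_le _ _).trans (by simp)
    have h2 := hbig.trans h1
    have h3 : (X : ℝ) ^ 2 / (4 * T ^ 2) = X * (2 * (X / U)) := by rw [hU]; field_simp; norm_num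
    rw [h3] at h2
    have h4 : (X : ℝ) * (X / U) ≤ X * H0.card := by linarith
    exact le_of_mul_le_mul_left h4 hX0
  have hlen : ∀ h ∈ H0, X / U ≤ (X - 1 - h : ℕ) := fun h hh =>
    (Finset.mem_filter.1 hh).2.trans (hclen h)
  have hlen1 : ∀ h ∈ H0, 1 ≤ X - 1 - h := by
    intro h hh
    have : (0 : ℝ) < (X - 1 - h : ℕ) := lt_of_lt_of_le (by positivity) (hlen h hh)
    exact_mod_cast this
  have hex : ∀ h ∈ H0, ∃ q : ℕ, 1 ≤ q ∧ (q : ℝ) ≤ B ∧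
      NearInt (((h + 1 : ℕ) : ℝ) * (q * (d + 1) * P.coeff (d + 1))) (B * U ^ d / X ^ d) := by
    intro h hh
    obtain ⟨hdeg, hco⟩ := coeff_taylor_sub_self hP ((h + 1 : ℕ) : ℝ)
    obtain ⟨q, hq1, hqB, hq⟩ := hW (X - 1 - h) (hlen1 h hh) U hU2 _ hdeg (by
      rw [← hcval]
      refine le_trans ?_ (Finset.mem_filter.1 hh).2
      gcongr
      omega)
    refine ⟨q, hq1, hqB, ?_⟩
    have := hq d hd
    rw [hco] at this
    rw [show ((h + 1 : ℕ) : ℝ) * (q * (d + 1) * P.coeff (d + 1)) =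
      q * ((d + 1) * ((h + 1 : ℕ) : ℝ) * P.coeff (d + 1)) by ring]
    refine this.mono ?_
    rw [← hB, mul_div_assoc, ← div_pow, div_eq_mul_inv, ← inv_pow]
    have h1 := hlen h hh
    have h2 : (0 : ℝ) < (X - 1 - h : ℕ) := lt_of_lt_of_le (by positivity) h1
    gcongr
    rw [div_le_iff₀ hU0] at h1
    rw [inv_le_iff_one_le_mul₀ h2, div_mul_eq_mul_div, le_div_iff₀ hX0]
    linarith
  choose! qf hqf1 hqfB hqf using hex
  have hmaps : ∀ h ∈ H0, qf h ∈ Finset.Icc 1 ⌊B⌋₊ := fun h hh =>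
    Finset.mem_Icc.2 ⟨hqf1 h hh, Nat.le_floor (hqfB h hh)⟩
  obtain ⟨q, hq, hqcard⟩ := Finset.exists_le_card_fiber_of_nsmul_le_card_of_maps_to
    (b := X / U / B) hmaps ⟨1, Finset.mem_Icc.2 ⟨le_rfl, Nat.le_floor (by simpa using hB1)⟩⟩ (by
      rw [nsmul_eq_mul, Nat.card_Icc, Nat.add_sub_cancel]
      refine le_trans ?_ hH0card
      rw [mul_div_assoc', div_le_iff₀ hB0, mul_comm]
      exact mul_le_mul_of_nonneg_left (Nat.floor_le hB0.le) (by positivity))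
  rw [Finset.mem_Icc] at hq
  have hqB : (q : ℝ) ≤ B := (Nat.cast_le.2 hq.2).trans (Nat.floor_le hB0.le)
  set H := (H0.filter fun h => qf h = q).image (· + 1) with hH
  have hHcard : 1 / (U * B) * X ≤ H.card := by
    rw [hH, Finset.card_image_of_injective _ (add_left_injective 1)]
    refine le_trans (le_of_eq ?_) hqcard
    field_simp
  have hUB : U * B ≤ T ^ (5 + 5 * C) := by
    rw [pow_add]; exact mul_le_mul hU5 hB5 hB0.le (by positivity)
  have hUd : U ^ d ≤ T ^ (5 * d) := by
    rw [pow_mul]; exact pow_le_pow_left₀ hU0.le hU5 _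
  have h256 : (256 : ℝ) ≤ T ^ 8 := by
    have : (2 : ℝ) ^ 8 ≤ T ^ 8 := by gcongr
    linarith
  have h32 : (32 : ℝ) ≤ T ^ 5 := by
    have : (2 : ℝ) ^ 5 ≤ T ^ 5 := by gcongr
    linarith
  have hη : B * U ^ d * (U * B) ^ 2 ≤ T ^ (10 + 15 * C + 5 * d) := by
    calc B * U ^ d * (U * B) ^ 2 ≤ T ^ (5 * C) * T ^ (5 * d) * (T ^ (5 + 5 * C)) ^ 2 := by gcongr
      _ = T ^ (10 + 15 * C + 5 * d) := by ring
  obtain ⟨q', hq'1, hq'δ, hq'⟩ := exists_small_multiple (X := X) (δ := 1 / (U * B))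
    (η := B * U ^ d / X ^ d) (β := q * (d + 1) * P.coeff (d + 1)) H (by
      intro h hh
      obtain ⟨h', hh', rfl⟩ := Finset.mem_image.1 hh
      have := hlen1 h' (Finset.mem_filter.1 hh').1
      omega) hHcard (by positivity) (by
      rw [div_le_one (by positivity)]; nlinarith) (by
      rw [one_div, ← div_eq_inv_mul, le_div_iff₀ (by positivity)]
      calc 8 * (U * B) ≤ T ^ 8 * T ^ (5 + 5 * C) := by gcongr; linarith
        _ = T ^ (13 + 5 * C) := by ring
        _ ≤ X := (hmono (by omega)).trans hX) (by positivity) (by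
      rw [div_pow, one_pow, lt_div_iff₀ (by positivity), mul_div_assoc', div_mul_eq_mul_div,
        div_lt_iff₀ (by positivity), one_mul]
      have h1 : T ^ (18 + 15 * C + 5 * d) < T ^ (20 + 15 * C + 5 * d) :=
        pow_lt_pow_right₀ (by linarith) (by omega)
      have h2 : (X : ℝ) ≤ X ^ d := by
        have h1X : (1 : ℝ) ≤ X := (one_le_pow₀ hT1).trans hX
        exact le_self_pow₀ h1X (by omega)
      calc 256 * (B * U ^ d) * (U * B) ^ 2 = 256 * (B * U ^ d * (U * B) ^ 2) := by ring
        _ ≤ T ^ 8 * T ^ (10 + 15 * C + 5 * d) := by gcongr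
        _ = T ^ (18 + 15 * C + 5 * d) := by ring
        _ < X ^ d := h1.trans_le (hX.trans h2)) (by
      intro h hh
      obtain ⟨h', hh', rfl⟩ := Finset.mem_image.1 hh
      obtain ⟨hm, rfl⟩ := Finset.mem_filter.1 hh'
      exact hqf h' hm)
  have hd2 : ((d : ℝ) + 1) ≤ T ^ d := by
    have h1 : ((d + 1 : ℕ) : ℝ) ≤ ((2 ^ d : ℕ) : ℝ) := by exact_mod_cast Nat.lt_two_pow_self
    push_cast at h1
    exact h1.trans (pow_le_pow_left₀ (by norm_num) hT _)
  refine ⟨q' * q * (d + 1), by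
    have : 0 < q' * q * (d + 1) := by have := hq.1; positivity
    omega, ?_, ?_⟩
  · have hq'2 : (q' : ℝ) ≤ 4 * (U * B) := by
      rw [mul_one_div, div_le_iff₀ (by positivity)] at hq'δ
      exact hq'δ
    push_cast
    calc (q' : ℝ) * q * (d + 1) ≤ (4 * (U * B)) * B * T ^ d := by gcongr
      _ ≤ (T ^ 5 * T ^ (5 + 5 * C)) * T ^ (5 * C) * T ^ d := by gcongr; linarith
      _ = T ^ (10 + 10 * C + d) := by ring
      _ ≤ _ := hmono (by omega)
  · rw [show ((q' * q * (d + 1) : ℕ) : ℝ) * P.coeff (d + 1) =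
      q' * (q * (d + 1) * P.coeff (d + 1)) by push_cast; ring]
    refine hq'.mono ?_
    have : 32 * (B * U ^ d / X ^ d) / ((1 / (U * B)) ^ 2 * X) =
        32 * (B * U ^ d * (U * B) ^ 2) / X ^ (d + 1) := by
      field_simp
      ring
    rw [this]
    gcongr
    calc 32 * (B * U ^ d * (U * B) ^ 2) ≤ T ^ 5 * T ^ (10 + 15 * C + 5 * d) := by gcongr
      _ = T ^ (15 + 15 * C + 5 * d) := by ring
      _ ≤ _ := hmono (by omega)

theorem norm_sum_sub_sum_shift_le (F : ℕ → ℂ) (hF : ∀ n, ‖F n‖ = 1) (X s : ℕ) :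
    ‖∑ n ∈ Finset.range X, F n - ∑ n ∈ Finset.range X, F (n + s)‖ ≤ 2 * s := by
  induction s with
  | zero => simp
  | succ s ih =>
    have h1 : ∑ n ∈ Finset.range X, F (n + s) - ∑ n ∈ Finset.range X, F (n + (s + 1)) =
        F s - F (X + s) := by
      have := Finset.sum_range_sub' (fun n => F (n + s)) X
      rw [Finset.sum_sub_distrib, zero_add] at this
      rw [← this]
      congr 1
      exact Finset.sum_congr rfl fun n _ => by congr 1; ring
    have h2 : ‖F s - F (X + s)‖ ≤ 2 := (norm_sub_le _ _).trans (by rw [hF, hF]; norm_num)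
    rw [← h1] at h2
    have h3 := norm_add_le (∑ n ∈ Finset.range X, F n - ∑ n ∈ Finset.range X, F (n + s))
      (∑ n ∈ Finset.range X, F (n + s) - ∑ n ∈ Finset.range X, F (n + (s + 1)))
    rw [sub_add_sub_cancel] at h3
    push_cast
    linarith

theorem exists_large_block (F : ℕ → ℂ) (hF : ∀ n, ‖F n‖ = 1) {X : ℕ} (hX : 1 ≤ X) (q Y : ℕ) :
    ∃ n₀ < X, Y * (‖∑ n ∈ Finset.range X, F n‖ - 2 * q * Y) ≤
      X * ‖∑ m ∈ Finset.range Y, F (n₀ + q * m)‖ := by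
  have hX0 : (0 : ℝ) < X := by exact_mod_cast hX
  have h1 : ‖(Y : ℂ) * ∑ n ∈ Finset.range X, F n -
      ∑ m ∈ Finset.range Y, ∑ n ∈ Finset.range X, F (n + q * m)‖ ≤ Y * (2 * q * Y) := by
    have : (Y : ℂ) * ∑ n ∈ Finset.range X, F n =
        ∑ m ∈ Finset.range Y, ∑ n ∈ Finset.range X, F n := by simp
    rw [this, ← Finset.sum_sub_distrib]
    refine (norm_sum_le _ _).trans ?_
    refine (Finset.sum_le_card_nsmul _ _ (2 * q * Y : ℝ) fun m hm => ?_).trans (by simp)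
    refine (norm_sum_sub_sum_shift_le F hF X (q * m)).trans ?_
    have : (m : ℝ) ≤ Y := by exact_mod_cast (Finset.mem_range.1 hm).le
    push_cast
    rw [mul_assoc]
    gcongr
  have h2 : ‖∑ m ∈ Finset.range Y, ∑ n ∈ Finset.range X, F (n + q * m)‖ ≤
      ∑ n ∈ Finset.range X, ‖∑ m ∈ Finset.range Y, F (n + q * m)‖ := by
    rw [Finset.sum_comm]
    exact norm_sum_le _ _
  have h3 : (Y : ℝ) * ‖∑ n ∈ Finset.range X, F n‖ - Y * (2 * q * Y) ≤
      ∑ n ∈ Finset.range X, ‖∑ m ∈ Finset.range Y, F (n + q * m)‖ := by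
    have := norm_sub_norm_le ((Y : ℂ) * ∑ n ∈ Finset.range X, F n)
      (∑ m ∈ Finset.range Y, ∑ n ∈ Finset.range X, F (n + q * m))
    rw [norm_mul, Complex.norm_natCast] at this
    linarith
  obtain ⟨n₀, hn₀, h4⟩ := Finset.exists_le_of_sum_le (s := Finset.range X)
    (f := fun _ => ((Y : ℝ) * ‖∑ n ∈ Finset.range X, F n‖ - Y * (2 * q * Y)) / X)
    (g := fun n => ‖∑ m ∈ Finset.range Y, F (n + q * m)‖) ⟨0, Finset.mem_range.2 hX⟩ (by
      rw [Finset.sum_const, Finset.card_range, nsmul_eq_mul, mul_div_cancel₀ _ hX0.ne']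
      exact h3)
  refine ⟨n₀, Finset.mem_range.1 hn₀, ?_⟩
  rw [div_le_iff₀ hX0] at h4
  linarith

/-- Undoing a translation costs a bounded factor in the approximation of the coefficients. -/
theorem nearInt_coeff_of_taylor {D : ℕ} {P : Polynomial ℝ} (hP : P.natDegree ≤ D) {X n₀ : ℕ}
    (hn₀ : n₀ ≤ X) (hX : 1 ≤ X) {q G : ℝ} (hG : 0 ≤ G)
    (h : ∀ j, 1 ≤ j → j ≤ D → NearInt (q * (Polynomial.taylor (n₀ : ℝ) P).coeff j) (G / X ^ j))
    {j : ℕ} (hj : 1 ≤ j) :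
    NearInt (q * P.coeff j) (4 ^ D * G / X ^ j) := by
  have hX0 : (0 : ℝ) < X := by exact_mod_cast hX
  set P' := Polynomial.taylor (n₀ : ℝ) P with hP'
  have hP'D : P'.natDegree ≤ D := by rwa [hP', Polynomial.natDegree_taylor]
  have hPP' : P = Polynomial.taylor (-(n₀ : ℝ)) P' := by
    rw [hP', Polynomial.taylor_taylor]
    simp
  rw [hPP', Polynomial.coeff_taylor_eq_sum P' _ hP'D, Finset.mul_sum]
  have hterm : ∀ i ∈ Finset.range (D + 1), NearInt
      (q * ((i.choose j : ℝ) * P'.coeff i * (-(n₀ : ℝ)) ^ (i - j)))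
      ((i.choose j : ℝ) * (G / X ^ j)) := by
    intro i hi
    rcases Nat.lt_or_ge i j with hij | hij
    · rw [Nat.choose_eq_zero_of_lt hij]
      exact nearInt_of_abs_le (by simp)
    have h1 := (h i (hj.trans hij) (by have := Finset.mem_range.1 hi; omega)).int_mul
      ((i.choose j : ℤ) * (-(n₀ : ℤ)) ^ (i - j))
    push_cast at h1
    rw [show q * ((i.choose j : ℝ) * P'.coeff i * (-(n₀ : ℝ)) ^ (i - j)) =
      (i.choose j : ℝ) * (-(n₀ : ℝ)) ^ (i - j) * (q * P'.coeff i) by ring]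
    refine h1.mono ?_
    rw [abs_mul, abs_pow, abs_neg, Nat.abs_cast, Nat.abs_cast, mul_assoc]
    gcongr
    have h2 : (n₀ : ℝ) ^ (i - j) ≤ X ^ (i - j) := by gcongr
    calc (n₀ : ℝ) ^ (i - j) * (G / X ^ i) ≤ X ^ (i - j) * (G / X ^ i) := by gcongr
      _ = G / X ^ j := by
        conv_lhs => rw [← Nat.sub_add_cancel hij, pow_add]
        rw [Nat.sub_add_cancel hij]
        field_simp
  refine (NearInt.sum _ _ _ hterm).mono ?_
  rw [← Finset.sum_mul, mul_div_assoc]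
  gcongr
  have h3 : ∀ i ∈ Finset.range (D + 1), (i.choose j : ℝ) ≤ 2 ^ D := by
    intro i hi
    have h4 : i.choose j ≤ 2 ^ i := Nat.choose_le_two_pow i j
    have h5 : 2 ^ i ≤ 2 ^ D := Nat.pow_le_pow_right (by norm_num)
      (by have := Finset.mem_range.1 hi; omega)
    exact_mod_cast h4.trans h5
  refine (Finset.sum_le_card_nsmul _ _ _ h3).trans ?_
  have h6 : ((D + 1 : ℕ) : ℝ) ≤ 2 ^ D := by exact_mod_cast Nat.lt_two_pow_self
  rw [Finset.card_range, nsmul_eq_mul, show (4 : ℝ) ^ D = 2 ^ D * 2 ^ D by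
    rw [← mul_pow]; norm_num]
  gcongr

theorem weylInverse_succ {d C : ℕ} (hd : 1 ≤ d) (hW : WeylInverse d C) :
    ∃ C', WeylInverse (d + 1) C' := by
  set K := 20 + 15 * C + 5 * d with hK
  set A := K + 6 with hA
  set G := K * (d + 1) + 3 * C + (A + 1) * d with hG
  refine ⟨G + 2 * (d + 1) + A * (d + 1), ?_⟩
  clear_value K A G
  intro X hX T hT P hP hS
  have hT1 : 1 ≤ T := by linarith
  have hT0 : 0 < T := by linarith
  have hmono : ∀ {a b : ℕ}, a ≤ b → T ^ a ≤ T ^ b := fun h => pow_le_pow_right₀ hT1 h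
  have hX0 : (0 : ℝ) < X := by exact_mod_cast hX
  rcases lt_or_ge (X : ℝ) (T ^ A) with hsmall | hlarge
  · refine ⟨1, le_rfl, by simpa using one_le_pow₀ hT1, fun j hj => ?_⟩
    rcases Nat.lt_or_ge (d + 1) j with h | h
    · rw [Polynomial.coeff_eq_zero_of_natDegree_lt (by omega)]
      exact nearInt_of_abs_le (by simp; positivity)
    · refine nearInt_of_one_le _ ?_
      rw [one_le_div (by positivity)]
      calc (X : ℝ) ^ j ≤ (T ^ A) ^ j := by gcongr
        _ = T ^ (A * j) := by rw [pow_mul]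
        _ ≤ _ := hmono (by
          have : A * j ≤ A * (d + 1) := Nat.mul_le_mul_left _ h
          omega)
  obtain ⟨q₁, hq₁, hq₁T, a, ha⟩ := weyl_top_coeff hd hW X T hT
    ((hmono (by omega)).trans hlarge) P hP hS
  rw [← hK] at hq₁T ha
  set θ := P.coeff (d + 1) with hθ
  set Y := ⌊(X : ℝ) / T ^ A⌋₊ with hY
  have hYle : (Y : ℝ) * T ^ A ≤ X := by
    have := Nat.floor_le (show 0 ≤ (X : ℝ) / T ^ A by positivity)
    rwa [le_div_iff₀ (by positivity)] at this
  have hY1 : 1 ≤ Y := by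
    rw [hY, Nat.one_le_floor_iff, one_le_div (by positivity)]
    exact hlarge
  have hY0 : (0 : ℝ) < Y := by exact_mod_cast hY1
  have hYge : (X : ℝ) ≤ Y * T ^ (A + 1) := by
    have := Nat.lt_floor_add_one ((X : ℝ) / T ^ A)
    rw [div_lt_iff₀ (by positivity), ← hY] at this
    have h1 : (1 : ℝ) ≤ Y := by exact_mod_cast hY1
    have h2 : (0 : ℝ) < T ^ A := by positivity
    rw [pow_succ]
    nlinarith
  obtain ⟨n₀, hn₀, hblock⟩ := exists_large_block (fun n => ex (P.eval (n : ℝ)))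
    (fun n => norm_ex _) hX q₁ Y
  have hqY : 2 * (q₁ : ℝ) * Y ≤ X / (2 * T) := by
    rw [le_div_iff₀ (by positivity)]
    have h4 : (4 : ℝ) ≤ T ^ 2 := by nlinarith
    calc 2 * (q₁ : ℝ) * Y * (2 * T) = 4 * (q₁ * (Y * T)) := by ring
      _ ≤ T ^ 2 * (T ^ K * (Y * T)) := by gcongr
      _ = Y * T ^ (K + 3) := by ring
      _ ≤ Y * T ^ A := by gcongr; omega
      _ ≤ X := hYle
  have hblock' : (Y : ℝ) / (2 * T) ≤ ‖∑ m ∈ Finset.range Y, ex (P.eval ((n₀ + q₁ * m : ℕ) : ℝ))‖ := by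
    have h1 : (Y : ℝ) * (X / (2 * T)) ≤ X * ‖∑ m ∈ Finset.range Y,
        ex (P.eval ((n₀ + q₁ * m : ℕ) : ℝ))‖ := by
      refine le_trans ?_ hblock
      gcongr
      have : (X : ℝ) / T = X / (2 * T) + X / (2 * T) := by field_simp; norm_num
      linarith
    have h2 : (Y : ℝ) * (X / (2 * T)) = X * (Y / (2 * T)) := by ring
    rw [h2] at h1
    exact le_of_mul_le_mul_left h1 hX0
  set P' := Polynomial.taylor (n₀ : ℝ) P with hP'
  have hP'deg : P'.natDegree ≤ d + 1 := by rwa [hP', Polynomial.natDegree_taylor]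
  have hP'top : P'.coeff (d + 1) = θ := by
    rw [hP', Polynomial.coeff_taylor_eq_sum P _ hP, Finset.sum_range_succ,
      Finset.sum_eq_zero fun i hi => ?_]
    · simp [hθ]
    · rw [Nat.choose_eq_zero_of_lt (Finset.mem_range.1 hi)]
      simp
  set Q := P'.comp (Polynomial.C (q₁ : ℝ) * Polynomial.X) -
    Polynomial.monomial (d + 1) (θ * (q₁ : ℝ) ^ (d + 1)) with hQ
  have hQcoeff : ∀ j, j ≤ d → Q.coeff j = (q₁ : ℝ) ^ j * P'.coeff j := by
    intro j hj
    rw [hQ, Polynomial.coeff_sub, Polynomial.comp_C_mul_X_coeff, Polynomial.coeff_monomial,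
      if_neg (by omega)]
    ring
  have hQdeg : Q.natDegree ≤ d := by
    rw [Polynomial.natDegree_le_iff_coeff_eq_zero]
    intro j hj
    rw [hQ, Polynomial.coeff_sub, Polynomial.comp_C_mul_X_coeff, Polynomial.coeff_monomial]
    rcases Nat.lt_or_ge (d + 1) j with h | h
    · rw [Polynomial.coeff_eq_zero_of_natDegree_lt (by omega), if_neg (by omega)]
      ring
    · obtain rfl : j = d + 1 := by omega
      rw [hP'top, if_pos rfl, sub_self]
  set ε := (q₁ : ℝ) * θ - a with hε
  have hQeval : ∀ m : ℕ, ex (P.eval ((n₀ + q₁ * m : ℕ) : ℝ)) =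
      ex (Q.eval (m : ℝ)) * ex ((q₁ : ℝ) ^ d * m ^ (d + 1) * ε) := by
    intro m
    rw [← ex_add, hQ, Polynomial.eval_sub, Polynomial.eval_comp, Polynomial.eval_monomial, hP',
      Polynomial.taylor_eval]
    simp only [Polynomial.eval_mul, Polynomial.eval_C, Polynomial.eval_X]
    rw [← ex_add_intCast (_ + _) ((q₁ : ℤ) ^ d * m ^ (d + 1) * a)]
    congr 1
    rw [hε]
    push_cast
    rw [add_comm (n₀ : ℝ)]
    ring
  have herr : ∀ m ∈ Finset.range Y, ‖ex ((q₁ : ℝ) ^ d * m ^ (d + 1) * ε) - 1‖ ≤ 1 / (4 * T) := by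
    intro m hm
    refine (norm_ex_sub_one_le _).trans ?_
    have hmY : (m : ℝ) ≤ Y := by exact_mod_cast (Finset.mem_range.1 hm).le
    have h1 : |(q₁ : ℝ) ^ d * m ^ (d + 1) * ε| ≤
        (T ^ K) ^ d * (X / T ^ A) ^ (d + 1) * (T ^ K / X ^ (d + 1)) := by
      rw [abs_mul, abs_of_nonneg (by positivity)]
      have : (m : ℝ) ≤ X / T ^ A := hmY.trans ((le_div_iff₀ (by positivity)).2 hYle)
      gcongr
    have h2 : (T ^ K) ^ d * (X / T ^ A) ^ (d + 1) * (T ^ K / X ^ (d + 1)) =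
        1 / (T ^ 6) ^ (d + 1) := by
      rw [hA, pow_add T K 6, div_pow, mul_pow, pow_succ (T ^ K) d]
      have e1 : (T ^ K) ^ d ≠ 0 := by positivity
      have e2 : (X : ℝ) ^ (d + 1) ≠ 0 := by positivity
      have e3 : (T ^ 6) ^ (d + 1) ≠ 0 := by positivity
      have e4 : T ^ K ≠ 0 := by positivity
      generalize (T ^ K) ^ d = a1 at *
      generalize (X : ℝ) ^ (d + 1) = a2 at *
      generalize (T ^ 6) ^ (d + 1) = a3 at *
      generalize T ^ K = a4 at *
      field_simp
    rw [h2] at h1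
    have h3 : T ^ 6 ≤ (T ^ 6) ^ (d + 1) := le_self_pow₀ (one_le_pow₀ hT1) (by omega)
    have h4 : 1 / (T ^ 6) ^ (d + 1) ≤ 1 / T ^ 6 := by gcongr
    have h5 : 8 * (1 / T ^ 6) ≤ 1 / (4 * T) := by
      rw [mul_one_div, div_le_div_iff₀ (by positivity) (by positivity)]
      have : (2 : ℝ) ^ 5 ≤ T ^ 5 := by gcongr
      nlinarith
    linarith
  have hQsum : (Y : ℝ) / (4 * T) ≤ ‖∑ m ∈ Finset.range Y, ex (Q.eval (m : ℝ))‖ := by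
    have h1 : ‖∑ m ∈ Finset.range Y, ex (P.eval ((n₀ + q₁ * m : ℕ) : ℝ)) -
        ∑ m ∈ Finset.range Y, ex (Q.eval (m : ℝ))‖ ≤ Y * (1 / (4 * T)) := by
      rw [← Finset.sum_sub_distrib]
      refine (norm_sum_le _ _).trans ?_
      refine (Finset.sum_le_card_nsmul _ _ (1 / (4 * T)) fun m hm => ?_).trans (by simp)
      rw [hQeval, ← mul_sub_one, norm_mul, norm_ex, one_mul]
      exact herr m hm
    have h2 := norm_sub_norm_le (∑ m ∈ Finset.range Y, ex (P.eval ((n₀ + q₁ * m : ℕ) : ℝ)))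
      (∑ m ∈ Finset.range Y, ex (Q.eval (m : ℝ)))
    have h3 : (Y : ℝ) / (2 * T) = Y / (4 * T) + Y * (1 / (4 * T)) := by field_simp; norm_num
    linarith
  obtain ⟨q₂, hq₂, hq₂T, hq₂Q⟩ := hW Y hY1 (4 * T) (by linarith) Q hQdeg hQsum
  have h4T : (4 * T) ^ C ≤ T ^ (3 * C) := by
    rw [pow_mul]
    refine pow_le_pow_left₀ (by positivity) ?_ _
    have : 4 ≤ T ^ 2 := by nlinarith
    rw [pow_succ]
    gcongr
  have hq₁0 : (1 : ℝ) ≤ q₁ := by exact_mod_cast hq₁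
  have hYinv : ∀ j, j ≤ d → 1 / (Y : ℝ) ^ j ≤ T ^ ((A + 1) * d) / X ^ j := by
    intro j hj
    rw [div_le_div_iff₀ (by positivity) (by positivity), one_mul]
    calc (X : ℝ) ^ j ≤ (Y * T ^ (A + 1)) ^ j := by gcongr
      _ = T ^ ((A + 1) * j) * Y ^ j := by rw [mul_pow, ← pow_mul, mul_comm]
      _ ≤ T ^ ((A + 1) * d) * Y ^ j := by
        gcongr
  refine ⟨q₂ * q₁ ^ (d + 1), Nat.one_le_iff_ne_zero.2 (by positivity), ?_, ?_⟩
  · push_cast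
    calc (q₂ : ℝ) * q₁ ^ (d + 1) ≤ T ^ (3 * C) * (T ^ K) ^ (d + 1) := by
          gcongr; exact hq₂T.trans h4T
      _ = T ^ (K * (d + 1) + 3 * C) := by ring
      _ ≤ _ := hmono (by omega)
  have hmain : ∀ j, 1 ≤ j → j ≤ d + 1 →
      NearInt (((q₂ * q₁ ^ (d + 1) : ℕ) : ℝ) * P'.coeff j) (T ^ G / X ^ j) := by
    intro j hj hjd
    rcases Nat.lt_or_ge d j with h | h
    · obtain rfl : j = d + 1 := by omega
      have h1 : NearInt ((q₁ : ℝ) * θ) (T ^ K / X ^ (d + 1)) := ⟨a, ha⟩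
      have h2 := h1.nat_mul (q₂ * q₁ ^ d)
      rw [hP'top]
      rw [show ((q₂ * q₁ ^ (d + 1) : ℕ) : ℝ) * θ = ((q₂ * q₁ ^ d : ℕ) : ℝ) * (q₁ * θ) by
        push_cast; ring]
      refine h2.mono ?_
      rw [mul_div_assoc']
      gcongr
      push_cast
      calc (q₂ : ℝ) * q₁ ^ d * T ^ K ≤ T ^ (3 * C) * (T ^ K) ^ d * T ^ K := by
            gcongr; exact hq₂T.trans h4T
        _ = T ^ (K * (d + 1) + 3 * C) := by ring
        _ ≤ _ := hmono (by omega)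
    · have h1 := (hq₂Q j hj).nat_mul (q₁ ^ (d + 1 - j))
      rw [hQcoeff j h] at h1
      rw [show ((q₂ * q₁ ^ (d + 1) : ℕ) : ℝ) * P'.coeff j =
        ((q₁ ^ (d + 1 - j) : ℕ) : ℝ) * (q₂ * ((q₁ : ℝ) ^ j * P'.coeff j)) by
        conv_lhs => rw [← Nat.sub_add_cancel hjd, pow_add]
        push_cast
        ring]
      refine h1.mono ?_
      push_cast
      have h2 : (q₁ : ℝ) ^ (d + 1 - j) ≤ (T ^ K) ^ (d + 1) :=
        (pow_le_pow_right₀ hq₁0 (by omega : d + 1 - j ≤ d + 1)).trans (by gcongr)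
      calc (q₁ : ℝ) ^ (d + 1 - j) * ((4 * T) ^ C / Y ^ j) =
            (q₁ : ℝ) ^ (d + 1 - j) * ((4 * T) ^ C * (1 / Y ^ j)) := by ring
        _ ≤ (T ^ K) ^ (d + 1) * (T ^ (3 * C) * (T ^ ((A + 1) * d) / X ^ j)) :=
            mul_le_mul h2 (mul_le_mul h4T (hYinv j h) (by positivity) (by positivity))
              (by positivity) (by positivity)
        _ = T ^ G / X ^ j := by rw [hG]; ring
  intro j hj
  refine (nearInt_coeff_of_taylor hP hn₀.le hX (by positivity) hmain hj).mono ?_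
  gcongr
  have h4 : (4 : ℝ) ^ (d + 1) ≤ T ^ (2 * (d + 1)) := by
    rw [pow_mul]
    exact pow_le_pow_left₀ (by norm_num) (by nlinarith) _
  calc (4 : ℝ) ^ (d + 1) * T ^ G ≤ T ^ (2 * (d + 1)) * T ^ G := by gcongr
    _ = T ^ (G + 2 * (d + 1)) := by ring
    _ ≤ _ := hmono (by omega)

/-- The **inverse theorem for Weyl sums**. -/
theorem exists_weylInverse {d : ℕ} (hd : 1 ≤ d) : ∃ C, WeylInverse d C := by
  induction d, hd using Nat.le_induction with
  | base => exact ⟨1, weylInverse_one⟩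
  | succ d hd ih =>
    obtain ⟨C, hC⟩ := ih
    exact weylInverse_succ hd hC

section

open Polynomial

theorem exists_bezout_of_irreducible {g t : ℤ[X]} (hg : Irreducible g) (hg1 : 1 ≤ g.natDegree)
    (hgt : ¬ g ∣ t) : ∃ u v : ℤ[X], ∃ R : ℤ, R ≠ 0 ∧ u * g + v * t = C R := by
  have hprim : g.IsPrimitive := hg.isPrimitive (by omega)
  have hirr := (IsPrimitive.Int.irreducible_iff_irreducible_map_cast hprim).1 hg
  have hnd : ¬ g.map (Int.castRingHom ℚ) ∣ t.map (Int.castRingHom ℚ) := by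
    intro hd
    exact hgt (hprim.dvd_of_fraction_map_dvd_fraction_map (K := ℚ) hd)
  obtain ⟨a, b, hab⟩ := (hirr.coprime_iff_not_dvd).2 hnd
  obtain ⟨da, hda, hda'⟩ := IsLocalization.integerNormalization_spec (nonZeroDivisors ℤ) a
  obtain ⟨db, hdb, hdb'⟩ := IsLocalization.integerNormalization_spec (nonZeroDivisors ℤ) b
  set a' := IsLocalization.integerNormalization (nonZeroDivisors ℤ) a
  set b' := IsLocalization.integerNormalization (nonZeroDivisors ℤ) b
  refine ⟨C db * a', C da * b', da * db, mul_ne_zero (nonZeroDivisors.ne_zero hda)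
    (nonZeroDivisors.ne_zero hdb), ?_⟩
  apply Polynomial.map_injective (Int.castRingHom ℚ) Int.cast_injective
  have e1 : a'.map (Int.castRingHom ℚ) = C (da : ℚ) * a := by
    refine Eq.trans hda' ?_
    simp [zsmul_eq_mul]
  have e2 : b'.map (Int.castRingHom ℚ) = C (db : ℚ) * b := by
    refine Eq.trans hdb' ?_
    simp [zsmul_eq_mul]
  rw [Polynomial.map_add, Polynomial.map_mul, Polynomial.map_mul, Polynomial.map_mul,
    Polynomial.map_mul, e1, e2, Polynomial.map_C, Polynomial.map_C, Polynomial.map_C]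
  simp only [Int.coe_castRingHom, Int.cast_mul, C_mul]
  linear_combination (C (da : ℚ) * C (db : ℚ)) * hab

theorem exists_factor_data {h g : ℤ[X]} (h0 : h ≠ 0) (hg : Irreducible g)
    (hg1 : 1 ≤ g.natDegree) (hgh : g ∣ h) :
    ∃ e : ℕ, 1 ≤ e ∧ e ≤ h.natDegree ∧ ∃ t : ℤ[X], h = g ^ e * t ∧ ∃ R : ℕ, 0 < R ∧
      ∀ (S : Type) [CommRing S] (z : S), aeval z g = 0 →
        aeval z (derivative g) ^ e * aeval z t ∣ (R : S) := by
  have hfin : FiniteMultiplicity g h := FiniteMultiplicity.of_not_isUnit hg.not_isUnit h0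
  obtain ⟨t, ht, hgt⟩ := hfin.exists_eq_pow_mul_and_not_dvd
  set e := multiplicity g h
  have he : 1 ≤ e := by
    rcases Nat.eq_zero_or_pos e with he | he
    · rw [he, pow_zero, one_mul] at ht
      exact absurd (ht ▸ hgh) hgt
    · exact he
  have hgd : ¬ g ∣ derivative g := by
    intro hd
    have := Polynomial.natDegree_le_of_dvd hd (by
      intro h0'
      have := Polynomial.derivative_eq_zero.1 h0'
      omega)
    have := Polynomial.natDegree_derivative_lt (p := g) (by omega)
    omega
  obtain ⟨u1, v1, R1, hR1, e1⟩ := exists_bezout_of_irreducible hg hg1 hgt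
  obtain ⟨u2, v2, R2, hR2, e2⟩ := exists_bezout_of_irreducible hg hg1 hgd
  refine ⟨e, he, ?_, t, ht, (R2 ^ e * R1).natAbs, ?_, ?_⟩
  · have ht0 : t ≠ 0 := by rintro rfl; simp at hgt
    have := congrArg natDegree ht
    rw [natDegree_mul (pow_ne_zero _ hg.ne_zero) ht0, natDegree_pow] at this
    nlinarith
  · exact Int.natAbs_pos.2 (mul_ne_zero (pow_ne_zero _ hR2) hR1)
  · intro S _ z hz
    have f1 : aeval z v1 * aeval z t = (R1 : S) := by
      have := congrArg (aeval z) e1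
      simpa [hz] using this
    have f2 : aeval z v2 * aeval z (derivative g) = (R2 : S) := by
      have := congrArg (aeval z) e2
      simpa [hz] using this
    have : aeval z (derivative g) ^ e * aeval z t ∣ ((R2 ^ e * R1 : ℤ) : S) := by
      refine ⟨aeval z v2 ^ e * aeval z v1, ?_⟩
      push_cast
      rw [← f1, ← f2]; ring
    have h2 : ((R2 ^ e * R1 : ℤ) : S) ∣ (((R2 ^ e * R1).natAbs : ℤ) : S) := by
      have : (R2 ^ e * R1 : ℤ) ∣ ((R2 ^ e * R1).natAbs : ℤ) := Int.dvd_natAbs.2 dvd_rfl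
      exact map_dvd (Int.castRingHom S) this
    have := this.trans h2
    simpa only [Int.cast_natCast] using this

theorem Intersective.exists_padic_root {h : ℤ[X]} (hint : Intersective h) (p : ℕ)
    [hp : Fact p.Prime] : ∃ z : ℤ_[p], aeval z h = 0 := by
  have hex : ∀ n : ℕ, ∃ a : ℕ, ((p ^ n : ℕ) : ℤ) ∣ h.eval (a : ℤ) := fun n => by
    obtain ⟨a, -, ha⟩ := hint.2 (p ^ n) (pow_pos hp.out.pos n)
    exact ⟨a, ha⟩
  choose a ha using hex
  obtain ⟨z, -, φ, hφ, hlim⟩ := (isCompact_univ (X := ℤ_[p])).tendsto_subseq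
    (x := fun n => ((a n : ℕ) : ℤ_[p])) (fun _ => Set.mem_univ _)
  refine ⟨z, ?_⟩
  have hc : Continuous fun x : ℤ_[p] => aeval x h := by
    exact Polynomial.continuous_aeval h
  have h1 := (hc.tendsto z).comp hlim
  have h2 : Filter.Tendsto ((fun x : ℤ_[p] => aeval x h) ∘ ((fun n => ((a n : ℕ) : ℤ_[p])) ∘ φ))
      Filter.atTop (nhds 0) := by
    rw [tendsto_zero_iff_norm_tendsto_zero]
    have hb : Filter.Tendsto (fun n : ℕ => ((p : ℝ)⁻¹) ^ n) Filter.atTop (nhds 0) :=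
      tendsto_pow_atTop_nhds_zero_of_lt_one (by positivity)
        (inv_lt_one_of_one_lt₀ (by exact_mod_cast hp.out.one_lt))
    refine squeeze_zero (fun _ => norm_nonneg _) (fun n => ?_) (hb.comp hφ.tendsto_atTop)
    have e : aeval ((a (φ n) : ℕ) : ℤ_[p]) h = ((h.eval (a (φ n) : ℤ) : ℤ) : ℤ_[p]) := by
      have := Polynomial.aeval_algebraMap_apply ℤ_[p] (a (φ n) : ℤ) h
      simpa using this
    simp only [Function.comp_apply]
    rw [e]
    have := (PadicInt.norm_int_le_pow_iff_dvd (p := p) (k := h.eval (a (φ n) : ℤ)) (n := φ n)).2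
      (by simpa using ha (φ n))
    refine this.trans (le_of_eq ?_)
    rw [zpow_neg, zpow_natCast, inv_pow]
  exact tendsto_nhds_unique h1 h2

end

section

open Polynomial

theorem local_shift {p : ℕ} [hp : Fact p.Prime] {H : ℤ_[p][X]} {T : ℤ_[p][X]} {e : ℕ} (he : 1 ≤ e)
    {z : ℤ_[p]} (hT : taylor z H = X ^ e * T) (n : ℕ) {a d : ℤ_[p]} (hd : (p : ℤ_[p]) ^ n ∣ d)
    (ha : (p : ℤ_[p]) ^ n ∣ a - z) :
    (∀ j, (p : ℤ_[p]) ^ (e * n) ∣ (H.comp (C a + C d * X)).coeff j) ∧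
      (¬ (p : ℤ_[p]) ^ (n + 1) ∣ d → ∀ w : ℕ,
        (∀ j, 1 ≤ j → (p : ℤ_[p]) ^ (w + e * n) ∣ (H.comp (C a + C d * X)).coeff j) →
        (p : ℤ_[p]) ^ w ∣ T.coeff 0) := by
  obtain ⟨b, hb⟩ := ha
  obtain ⟨d', rfl⟩ := hd
  set P : ℤ_[p] := (p : ℤ_[p]) with hP
  have hP0 : P ≠ 0 := by
    rw [hP]; exact_mod_cast hp.out.ne_zero
  set F := (X ^ e * T.comp (C (P ^ n) * X)).comp (C b + C d' * X) with hF
  have key : H.comp (C a + C (P ^ n * d') * X) = C (P ^ (e * n)) * F := by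
    have h1 : H = (X ^ e * T).comp (X - C z) := by
      rw [← hT, taylor_apply, comp_assoc]; simp
    rw [hF, h1, show a = z + P ^ n * b by rw [← hb]; ring]
    simp only [mul_comp, pow_comp, X_comp, comp_assoc, C_comp, C_mul, C_pow, C_add, sub_comp]
    rw [pow_mul', ← mul_assoc, ← mul_pow]
    congr 2
    · ring
    · ring
  refine ⟨fun j => ?_, fun hnd w hw => ?_⟩
  · rw [key, coeff_C_mul]; exact dvd_mul_right _ _
  · have hu : IsUnit d' := by
      rw [PadicInt.isUnit_iff]
      by_contra hne
      have hlt : ‖d'‖ < 1 := lt_of_le_of_ne (PadicInt.norm_le_one d') hne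
      have := PadicInt.norm_lt_one_iff_dvd d' |>.1 hlt
      exact hnd (by rw [pow_succ]; exact mul_dvd_mul_left _ this)
    obtain ⟨u, rfl⟩ := hu
    have hFj : ∀ j, 1 ≤ j → P ^ w ∣ F.coeff j := fun j hj => by
      have := hw j hj
      rw [key, coeff_C_mul, add_comm w, pow_add] at this
      exact (mul_dvd_mul_iff_left (pow_ne_zero _ hP0)).1 this
    have hG : C (P ^ w) ∣ F - C (F.coeff 0) := by
      rw [Polynomial.C_dvd_iff_dvd_coeff]
      intro j
      rcases Nat.eq_zero_or_pos j with rfl | hj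
      · simp
      · rw [coeff_sub, coeff_C, if_neg (by omega), sub_zero]; exact hFj j hj
    obtain ⟨G, hG⟩ := hG
    have hFc : F.comp (C (↑u⁻¹ : ℤ_[p]) * (X - C b)) = X ^ e * T.comp (C (P ^ n) * X) := by
      rw [hF, comp_assoc]
      have : (C b + C (u : ℤ_[p]) * X).comp (C (↑u⁻¹ : ℤ_[p]) * (X - C b)) = X := by
        simp only [add_comp, mul_comp, C_comp, X_comp]
        rw [← mul_assoc, ← C_mul, Units.mul_inv]; simp
      rw [this, comp_X]
    have h2 : F = C (F.coeff 0) + C (P ^ w) * G := by rw [← hG]; ring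
    rw [h2] at hFc
    have h3 := congrArg (fun q => coeff q e) hFc
    simp only [add_comp, mul_comp, C_comp] at h3
    rw [coeff_add, coeff_C, if_neg (by omega), zero_add, coeff_C_mul, coeff_X_pow_mul',
      if_pos le_rfl, Nat.sub_self, comp_C_mul_X_coeff, pow_zero, mul_one] at h3
    exact ⟨_, h3.symm⟩

theorem exists_local_data {h : ℤ[X]} (hint : Intersective h) :
    ∃ R0 : ℕ, 0 < R0 ∧ ∀ p : ℕ, p.Prime → ∃ m : ℕ, 1 ≤ m ∧ m ≤ h.natDegree ∧ ∃ s : ℕ → ℕ,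
      (∀ n n', n ≤ n' → (p : ℤ) ^ n ∣ (s n' : ℤ) - s n) ∧
      ∀ n (a d : ℤ), (p : ℤ) ^ n ∣ d → (p : ℤ) ^ n ∣ a - s n →
        (∀ j, (p : ℤ) ^ (m * n) ∣ (h.comp (C a + C d * X)).coeff j) ∧
        (¬ (p : ℤ) ^ (n + 1) ∣ d → ∀ w : ℕ,
          (∀ j, 1 ≤ j → (p : ℤ) ^ (w + m * n) ∣ (h.comp (C a + C d * X)).coeff j) →
          p ^ w ∣ R0) := by
  classical
  have h0 := hint.1
  have hR : ∀ g : ℤ[X], ∃ R : ℕ, 0 < R ∧ (Irreducible g → 1 ≤ g.natDegree → g ∣ h →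
      ∃ e : ℕ, 1 ≤ e ∧ e ≤ h.natDegree ∧ ∃ t : ℤ[X], h = g ^ e * t ∧ 
      ∀ (S : Type) [CommRing S] (z : S), aeval z g = 0 →
        aeval z (derivative g) ^ e * aeval z t ∣ (R : S)) := by
    intro g
    by_cases hg : Irreducible g ∧ 1 ≤ g.natDegree ∧ g ∣ h
    · obtain ⟨e, he, he', t, ht, R, hR, hS⟩ := exists_factor_data h0 hg.1 hg.2.1 hg.2.2
      exact ⟨R, hR, fun _ _ _ => ⟨e, he, he', t, ht, hS⟩⟩
    · exact ⟨1, one_pos, fun h1 h2 h3 => absurd ⟨h1, h2, h3⟩ hg⟩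
  choose R hRpos hR using hR
  set 𝒢 := (UniqueFactorizationMonoid.normalizedFactors h).toFinset
  refine ⟨∏ g ∈ 𝒢, R g, Finset.prod_pos fun g _ => hRpos g, fun p hp => ?_⟩
  have : Fact p.Prime := ⟨hp⟩
  obtain ⟨z, hz⟩ := hint.exists_padic_root p
  obtain ⟨g, hgm, hgz⟩ : ∃ g ∈ UniqueFactorizationMonoid.normalizedFactors h, aeval z g = 0 := by
    obtain ⟨u, hu⟩ := UniqueFactorizationMonoid.prod_normalizedFactors h0
    rw [← hu, map_mul, mul_eq_zero] at hz
    rcases hz with hz | hz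
    · rw [map_multiset_prod, Multiset.prod_eq_zero_iff, Multiset.mem_map] at hz
      exact hz
    · exfalso
      have : IsUnit (aeval z (u : ℤ[X])) := u.isUnit.map _
      rw [hz] at this
      exact not_isUnit_zero this
  have hirr := UniqueFactorizationMonoid.irreducible_of_normalized_factor g hgm
  have hdvd := UniqueFactorizationMonoid.dvd_of_mem_normalizedFactors hgm
  have hdeg : 1 ≤ g.natDegree := by
    by_contra hlt
    obtain ⟨c, rfl⟩ := natDegree_eq_zero.1 (by omega : g.natDegree = 0)
    rw [aeval_C] at hgz
    have : c = 0 := by simpa using hgz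
    exact hirr.ne_zero (by simp [this])
  obtain ⟨e, he, hek, t, ht, hS⟩ := hR g hirr hdeg hdvd
  set φ := Int.castRingHom ℤ_[p] with hφ
  have haev : ∀ q : ℤ[X], aeval z q = (q.map φ).eval z := fun q => by
    rw [aeval_def, eval_map]; rfl
  have hX : X ∣ taylor z (g.map φ) := by
    rw [X_dvd_iff, taylor_coeff_zero, ← haev, hgz]
  obtain ⟨G1, hG1⟩ := hX
  have hG10 : G1.coeff 0 = aeval z (derivative g) := by
    have := congrArg (fun q => coeff q 1) hG1
    simp only [taylor_coeff_one] at this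
    rw [show (1 : ℕ) = 0 + 1 from rfl, coeff_X_mul] at this
    rw [← this, haev, derivative_map]
  have hT : taylor z (h.map φ) = X ^ e * (G1 ^ e * taylor z (t.map φ)) := by
    conv_lhs => rw [ht]
    rw [Polynomial.map_mul, Polynomial.map_pow, taylor_mul, taylor_pow, hG1]
    ring
  have hT0 : (G1 ^ e * taylor z (t.map φ)).coeff 0 ∣ ((R g : ℕ) : ℤ_[p]) := by
    rw [mul_coeff_zero, coeff_zero_eq_eval_zero (G1 ^ e), eval_pow, ← coeff_zero_eq_eval_zero,
      hG10, taylor_coeff_zero, ← haev]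
    exact hS _ z hgz
  have hcast : ∀ (n : ℕ) (x : ℤ), (p : ℤ_[p]) ^ n ∣ φ x ↔ (p : ℤ) ^ n ∣ x := fun n x => by
    rw [hφ, eq_intCast]; exact PadicInt.pow_p_dvd_int_iff n x
  refine ⟨e, he, hek, z.appr, ?_, ?_⟩
  · intro n n' hnn
    have := PadicInt.dvd_appr_sub_appr z n n' hnn
    have h2 : ((p ^ n : ℕ) : ℤ) ∣ ((z.appr n' - z.appr n : ℕ) : ℤ) := Int.natCast_dvd_natCast.2 this
    rwa [Nat.cast_sub (PadicInt.appr_mono z hnn), Nat.cast_pow] at h2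
  · intro n a d hd ha
    have ha' : (p : ℤ_[p]) ^ n ∣ φ a - z := by
      have h1 : (p : ℤ_[p]) ^ n ∣ φ (a - z.appr n) := (hcast n _).2 ha
      have h2 := Ideal.mem_span_singleton.1 (PadicInt.appr_spec n z)
      have := dvd_sub h1 h2
      simp only [map_sub, hφ, eq_intCast, Int.cast_natCast] at this ⊢
      rwa [sub_sub_sub_cancel_right] at this
    have hcomp : (h.map φ).comp (C (φ a) + C (φ d) * X) = (h.comp (C a + C d * X)).map φ := by
      rw [Polynomial.map_comp]; simp
    obtain ⟨c1, c2⟩ := local_shift he hT n ((hcast n d).2 hd) ha'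
    rw [hcomp] at c1 c2
    simp only [coeff_map] at c1 c2
    refine ⟨fun j => (hcast _ _).1 (c1 j), fun hnd w hw => ?_⟩
    have := (c2 (fun hh => hnd ((hcast _ _).1 hh)) w fun j hj => (hcast _ _).2 (hw j hj)).trans hT0
    have h3 : (p : ℤ) ^ w ∣ (R g : ℤ) := (hcast _ _).1 (by rw [hφ, eq_intCast, Int.cast_natCast]; exact this)
    have h4 : p ^ w ∣ R g := by exact_mod_cast h3
    exact h4.trans (Finset.dvd_prod_of_mem _ (Multiset.mem_toFinset.2 hgm))

end

section

open Polynomial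

noncomputable def primePowMul (m : ℕ → ℕ) (d : ℕ) : ℕ := d.factorization.prod fun p v => p ^ (m p * v)

theorem primePowMul_mul (m : ℕ → ℕ) {a b : ℕ} (ha : a ≠ 0) (hb : b ≠ 0) :
    primePowMul m (a * b) = primePowMul m a * primePowMul m b := by
  unfold primePowMul
  rw [Nat.factorization_mul ha hb]
  exact Finsupp.prod_add_index' (by simp) (fun p v w => by rw [mul_add, pow_add])

theorem dvd_primePowMul {m : ℕ → ℕ} (hm : ∀ p : ℕ, p.Prime → 1 ≤ m p) {d : ℕ} (hd : d ≠ 0) :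
    d ∣ primePowMul m d := by
  conv_lhs => rw [← Nat.prod_factorization_pow_eq_self hd]
  refine Finset.prod_dvd_prod_of_dvd _ _ fun p hp => pow_dvd_pow _ ?_
  have := hm p (Nat.prime_of_mem_primeFactors (by simpa using hp))
  exact Nat.le_mul_of_pos_left _ this

theorem primePowMul_pos (m : ℕ → ℕ) (d : ℕ) : 0 < primePowMul m d := by
  unfold primePowMul Finsupp.prod
  refine Finset.prod_pos fun p hp => pow_pos (Nat.Prime.pos ?_) _
  exact Nat.prime_of_mem_primeFactors (n := d) (by simpa using hp)

theorem primePowMul_le {m : ℕ → ℕ} {k : ℕ} (hm : ∀ p : ℕ, p.Prime → m p ≤ k) {d : ℕ} (hd : d ≠ 0) :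
    primePowMul m d ≤ d ^ k := by
  conv_rhs => rw [← Nat.prod_factorization_pow_eq_self hd]
  unfold primePowMul Finsupp.prod
  rw [← Finset.prod_pow]
  refine Finset.prod_le_prod' fun p hp => ?_
  have hp := (Nat.prime_of_mem_primeFactors (by simpa using hp))
  rw [← pow_mul, mul_comm]
  exact Nat.pow_le_pow_right hp.pos (Nat.mul_le_mul_right _ (hm p hp))

theorem pow_dvd_primePowMul (m : ℕ → ℕ) (d : ℕ) (p : ℕ) :
    p ^ (m p * d.factorization p) ∣ primePowMul m d := by
  by_cases h : d.factorization p = 0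
  · simp [h]
  · exact Finset.dvd_prod_of_mem (fun p => p ^ (m p * d.factorization p)) (Finsupp.mem_support_iff.2 h)

theorem primePowMul_dvd {m : ℕ → ℕ} {d : ℕ} {z : ℤ}
    (hz : ∀ p : ℕ, p.Prime → (p : ℤ) ^ (m p * d.factorization p) ∣ z) :
    (primePowMul m d : ℤ) ∣ z := by
  unfold primePowMul Finsupp.prod
  rw [Nat.cast_prod]
  have hpr : ∀ p ∈ d.factorization.support, p.Prime := fun p hp =>
    Nat.prime_of_mem_primeFactors (by simpa using hp)
  refine Finset.prod_dvd_of_coprime ?_ fun p hp => ?_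
  · intro p hp q hq hpq
    simp only [Function.onFun]
    rw [Nat.isCoprime_iff_coprime]
    exact Nat.Coprime.pow _ _ ((Nat.coprime_primes (hpr p hp) (hpr q hq)).2 hpq)
  · rw [Nat.cast_pow]; exact hz p (hpr p hp)

theorem exists_crt_rep (s : ℕ → ℕ → ℕ) {d : ℕ} (hd : 1 ≤ d) :
    ∃ r : ℕ, 1 ≤ r ∧ r ≤ d ∧ ∀ p : ℕ, p.Prime →
      (p : ℤ) ^ d.factorization p ∣ (r : ℤ) - s p (d.factorization p) := by
  obtain ⟨x, hx⟩ := Nat.chineseRemainderOfFinset (fun p => s p (d.factorization p))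
    (fun p => p ^ d.factorization p) d.primeFactors
    (fun p hp => pow_ne_zero _ (Nat.prime_of_mem_primeFactors hp).ne_zero)
    (fun p hp q hq hpq => by
      exact Nat.Coprime.pow _ _ ((Nat.coprime_primes (Nat.prime_of_mem_primeFactors hp)
        (Nat.prime_of_mem_primeFactors hq)).2 hpq))
  have key : ∀ r : ℕ, (d : ℤ) ∣ r - x → ∀ p : ℕ, p.Prime →
      (p : ℤ) ^ d.factorization p ∣ (r : ℤ) - s p (d.factorization p) := by
    intro r hr p hp
    by_cases hpd : p ∈ d.primeFactors
    · have h1 := (Nat.modEq_iff_dvd.1 (hx p hpd).symm)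
      have h2 : (p : ℤ) ^ d.factorization p ∣ d := by exact_mod_cast Nat.ordProj_dvd d p
      have := dvd_add (h2.trans hr) (by simpa using h1)
      simpa using this
    · have : d.factorization p = 0 := by
        rw [← Finsupp.notMem_support_iff]; simpa using hpd
      simp [this]
  by_cases h0 : x % d = 0
  · refine ⟨d, hd, le_rfl, key d ?_⟩
    have : (d : ℤ) ∣ x := by exact_mod_cast Nat.dvd_of_mod_eq_zero h0
    exact dvd_sub dvd_rfl this
  · refine ⟨x % d, by omega, (Nat.mod_lt _ hd).le, key _ ?_⟩
    refine ⟨-(x / d : ℕ), ?_⟩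
    have := Nat.mod_add_div x d
    have h2 : (x : ℤ) = (x % d : ℕ) + d * (x / d : ℕ) := by exact_mod_cast this.symm
    push_cast at h2 ⊢
    linarith

theorem exists_intersective_data {h : ℤ[X]} (hint : Intersective h) {k : ℕ} (hk : h.natDegree = k) :
    ∃ R0 H : ℕ, 0 < R0 ∧ 0 < H ∧ ∃ lam : ℕ → ℕ, ∃ hd : ℕ → ℤ[X],
      (∀ d, 1 ≤ d → 1 ≤ lam d ∧ lam d ≤ d ^ k ∧ d ∣ lam d) ∧
      (∀ d t, 1 ≤ d → 1 ≤ t → lam (d * t) = lam d * lam t) ∧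
      (∀ d, 1 ≤ d → (hd d).natDegree = k ∧ (∀ j, |(hd d).coeff j| ≤ (H : ℤ) * d ^ k) ∧
        ∀ g : ℕ, (∀ j, 1 ≤ j → (g : ℤ) ∣ (hd d).coeff j) → g ∣ R0) ∧
      (∀ d t, 1 ≤ d → 1 ≤ t → ∀ n : ℕ, ∃ n' : ℕ,
        (lam t : ℤ) * (hd (d * t)).eval (n : ℤ) = (hd d).eval (n' : ℤ)) ∧
      (∀ n : ℕ, ∃ n' : ℕ, 1 ≤ n' ∧ (hd 1).eval (n : ℤ) = h.eval (n' : ℤ)) := by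
  classical
  obtain ⟨R0, hR0, hloc⟩ := exists_local_data hint
  have hloc' : ∀ p : ℕ, ∃ m : ℕ, ∃ s : ℕ → ℕ, p.Prime → 1 ≤ m ∧ m ≤ h.natDegree ∧ 
      (∀ n n', n ≤ n' → (p : ℤ) ^ n ∣ (s n' : ℤ) - s n) ∧
      ∀ n (a d : ℤ), (p : ℤ) ^ n ∣ d → (p : ℤ) ^ n ∣ a - s n →
        (∀ j, (p : ℤ) ^ (m * n) ∣ (h.comp (C a + C d * X)).coeff j) ∧
        (¬ (p : ℤ) ^ (n + 1) ∣ d → ∀ w : ℕ,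
          (∀ j, 1 ≤ j → (p : ℤ) ^ (w + m * n) ∣ (h.comp (C a + C d * X)).coeff j) →
          p ^ w ∣ R0) := by
    intro p
    by_cases hp : p.Prime
    · obtain ⟨m, h1, h2, s, h3, h4⟩ := hloc p hp
      exact ⟨m, s, fun _ => ⟨h1, h2, h3, h4⟩⟩
    · exact ⟨0, fun _ => 0, fun hh => absurd hh hp⟩
  choose m s hms using hloc'
  have hrex : ∀ d : ℕ, ∃ r : ℕ, 1 ≤ d → 1 ≤ r ∧ r ≤ d ∧ ∀ p : ℕ, p.Prime →
      (p : ℤ) ^ d.factorization p ∣ (r : ℤ) - s p (d.factorization p) := by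
    intro d
    by_cases hd : 1 ≤ d
    · obtain ⟨r, hr⟩ := exists_crt_rep s hd
      exact ⟨r, fun _ => hr⟩
    · exact ⟨0, fun hh => absurd hh hd⟩
  choose r hr using hrex
  set lam := primePowMul m with hlam
  have hpd : ∀ d p : ℕ, (p : ℤ) ^ d.factorization p ∣ d := fun d p => by
    exact_mod_cast Nat.ordProj_dvd d p
  have hdvd : ∀ d, 1 ≤ d → ∀ j, (lam d : ℤ) ∣ (h.comp (C (r d : ℤ) + C (d : ℤ) * X)).coeff j := by
    intro d hd j
    refine primePowMul_dvd fun p hp => ?_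
    exact ((hms p hp).2.2.2 (d.factorization p) (r d) d (hpd d p) ((hr d hd).2.2 p hp)).1 j
  have hdex : ∀ d : ℕ, ∃ q : ℤ[X], 1 ≤ d → h.comp (C (r d : ℤ) + C (d : ℤ) * X) = C (lam d : ℤ) * q := by
    intro d
    by_cases hd : 1 ≤ d
    · obtain ⟨q, hq⟩ := (C_dvd_iff_dvd_coeff _ _).2 (hdvd d hd)
      exact ⟨q, fun _ => hq⟩
    · exact ⟨0, fun hh => absurd hh hd⟩
  choose hd hhd using hdex
  have hlampos : ∀ d, (0 : ℤ) < lam d := fun d => by exact_mod_cast primePowMul_pos m d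
  have heval : ∀ d, 1 ≤ d → ∀ x : ℤ, (lam d : ℤ) * (hd d).eval x = h.eval (r d + d * x) := by
    intro d hd' x
    have := congrArg (eval x) (hhd d hd')
    simp only [eval_comp, eval_mul, eval_add, eval_C, eval_X] at this
    exact this.symm
  have hr1 : r 1 = 1 := by
    have := hr 1 le_rfl
    omega
  have hlam1 : lam 1 = 1 := by simp [hlam, primePowMul]
  refine ⟨R0, 2 ^ k * ∑ i ∈ Finset.range (k + 1), (h.coeff i).natAbs, hR0, ?_, lam, hd, ?_, ?_, ?_,
    ?_, ?_⟩
  · refine Nat.mul_pos (by positivity) (Finset.sum_pos' (fun _ _ => Nat.zero_le _) ⟨k, by simp, ?_⟩)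
    rw [Int.natAbs_pos, ← hk]
    exact leadingCoeff_ne_zero.2 hint.1
  · intro d hd
    exact ⟨primePowMul_pos m d, primePowMul_le (fun p hp => hk ▸ (hms p hp).2.1) (by omega),
      dvd_primePowMul (fun p hp => (hms p hp).1) (by omega)⟩
  · intro d t hd ht
    exact primePowMul_mul m (by omega) (by omega)
  · intro d hd1
    have hd0 : (d : ℤ) ≠ 0 := by exact_mod_cast (by omega : d ≠ 0)
    refine ⟨?_, ?_, ?_⟩
    · have h1 := congrArg natDegree (hhd d hd1)
      rw [natDegree_C_mul (hlampos d).ne', natDegree_comp, hk] at h1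
      rw [← h1, add_comm, natDegree_add_C, natDegree_C_mul hd0, natDegree_X, mul_one]
    · intro j
      have h1 : (lam d : ℤ) * (hd d).coeff j = (h.comp (C (r d : ℤ) + C (d : ℤ) * X)).coeff j := by
        rw [hhd d hd1, coeff_C_mul]
      have h2 : h.comp (C (r d : ℤ) + C (d : ℤ) * X) = (taylor (r d : ℤ) h).comp (C (d : ℤ) * X) := by
        rw [taylor_apply, comp_assoc]; simp [add_comm]
      rw [h2, comp_C_mul_X_coeff, coeff_taylor_eq_sum h _ (le_of_eq hk), Finset.sum_mul] at h1
      have h3 : |(hd d).coeff j| ≤ |(lam d : ℤ) * (hd d).coeff j| := by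
        rw [abs_mul, abs_of_pos (hlampos d)]
        exact le_mul_of_one_le_left (abs_nonneg _) (hlampos d)
      refine h3.trans ?_
      rw [h1]
      refine (Finset.abs_sum_le_sum_abs _ _).trans ?_
      push_cast
      rw [mul_right_comm, Finset.mul_sum]
      refine Finset.sum_le_sum fun i hi => ?_
      have hik : i ≤ k := by simpa [Nat.lt_succ_iff] using hi
      rcases lt_or_ge i j with hij | hij
      · rw [Nat.choose_eq_zero_of_lt hij]; simp only [Nat.cast_zero, zero_mul, abs_zero]; positivity
      · rw [abs_mul, abs_mul, abs_mul, Nat.abs_cast, abs_pow, abs_pow, Nat.abs_cast, Nat.abs_cast]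
        have e1 : (i.choose j : ℤ) ≤ 2 ^ k := by
          exact_mod_cast (Nat.choose_le_two_pow i j).trans (Nat.pow_le_pow_right (by norm_num) hik)
        have e2 : (r d : ℤ) ^ (i - j) * (d : ℤ) ^ j ≤ d ^ k := by
          have h1r : (r d : ℤ) ≤ d := by exact_mod_cast (hr d hd1).2.1
          have h1d : (1 : ℤ) ≤ d := by exact_mod_cast hd1
          calc (r d : ℤ) ^ (i - j) * (d : ℤ) ^ j ≤ (d : ℤ) ^ (i - j) * (d : ℤ) ^ j := by gcongr
            _ = (d : ℤ) ^ i := by rw [← pow_add]; congr 1; omega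
            _ ≤ (d : ℤ) ^ k := pow_le_pow_right₀ h1d hik
        calc (i.choose j : ℤ) * |h.coeff i| * (r d : ℤ) ^ (i - j) * (d : ℤ) ^ j
            = (i.choose j : ℤ) * |h.coeff i| * ((r d : ℤ) ^ (i - j) * (d : ℤ) ^ j) := by ring
          _ ≤ 2 ^ k * |h.coeff i| * (d : ℤ) ^ k := by gcongr
          _ = 2 ^ k * (d : ℤ) ^ k * |h.coeff i| := by ring
    · intro g hg
      rw [Nat.dvd_iff_prime_pow_dvd_dvd]
      intro p w hp hpw
      refine ((hms p hp).2.2.2 (d.factorization p) (r d) d (hpd d p) ((hr d hd1).2.2 p hp)).2 ?_ w ?_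
      · intro hh
        have : p ^ (d.factorization p + 1) ∣ d := by exact_mod_cast hh
        exact Nat.pow_succ_factorization_not_dvd (by omega) hp this
      · intro j hj
        rw [hhd d hd1, coeff_C_mul, pow_add, mul_comm]
        refine mul_dvd_mul ?_ (dvd_trans ?_ (hg j hj))
        · exact_mod_cast pow_dvd_primePowMul m d p
        · exact_mod_cast hpw
  · intro d t hd1 ht1 n
    have hdt : 1 ≤ d * t := Nat.mul_pos hd1 ht1
    have hmod : (d : ℤ) ∣ (r (d * t) : ℤ) - r d := by
      have : d ∣ ((r (d * t) : ℤ) - r d).natAbs := by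
        rw [Nat.dvd_iff_prime_pow_dvd_dvd]
        intro p w hp hpw
        have hw : w ≤ d.factorization p := (hp.pow_dvd_iff_le_factorization (by omega)).1 hpw
        have hle : d.factorization p ≤ (d * t).factorization p := by
          rw [Nat.factorization_mul (by omega) (by omega)]; simp
        have a1 := (hr _ hdt).2.2 p hp
        have a2 := (hr _ hd1).2.2 p hp
        have a3 := (hms p hp).2.2.1 _ _ hle
        have a4 := dvd_sub (dvd_add ((pow_dvd_pow _ hle).trans a1) a3) a2
        rw [← Int.natCast_dvd_natCast, Int.dvd_natAbs]
        push_cast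
        refine (pow_dvd_pow _ hw).trans ?_
        convert a4 using 1
        ring
      rwa [← Int.natCast_dvd_natCast, Int.dvd_natAbs] at this
    obtain ⟨u, hu⟩ := hmod
    have hu0 : 0 ≤ u := by
      by_contra hneg
      have h1 := (hr _ hd1).2.1
      have h2 := (hr _ hdt).1
      have h3 : (d : ℤ) * u ≤ d * (-1) := by
        apply mul_le_mul_of_nonneg_left (by omega) (by positivity)
      have h4 : (r d : ℤ) ≤ d := by exact_mod_cast h1
      have h5 : (1 : ℤ) ≤ r (d * t) := by exact_mod_cast h2
      linarith
    lift u to ℕ using hu0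
    refine ⟨u + t * n, ?_⟩
    apply mul_left_cancel₀ (hlampos d).ne'
    have hm := primePowMul_mul m (a := d) (b := t) (by omega) (by omega)
    have e1 := heval (d * t) hdt n
    have e2 := heval d hd1 ((u + t * n : ℕ) : ℤ)
    rw [e2, ← mul_assoc, ← Nat.cast_mul, ← hm, e1]
    congr 1
    push_cast
    linear_combination hu
  · intro n
    refine ⟨n + 1, by omega, ?_⟩
    have := heval 1 le_rfl n
    rw [hlam1, hr1] at this
    simpa [add_comm] using this

end

section

open Polynomial

/-- Rational approximation of a frequency at which an exponential sum along `q` is large. -/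
theorem exists_denominator_of_large_sum {k : ℕ} (hk : 1 ≤ k) (R0 H : ℕ) (hR0 : 0 < R0) :
    ∃ C : ℕ, 1 ≤ C ∧ ∀ d : ℕ, 1 ≤ d → ∀ q : ℤ[X], q.natDegree = k → (∀ j, |q.coeff j| ≤ (H : ℤ) * d ^ k) →
      (∀ g : ℕ, (∀ j, 1 ≤ j → (g : ℤ) ∣ q.coeff j) → g ∣ R0) →
      ∀ T : ℝ, 2 ≤ T → ∀ X : ℕ, (T * d) ^ C ≤ X → ∀ θ : ℝ,
        X / T ≤ ‖∑ n ∈ Finset.range X, ex (θ * (q.eval (n : ℤ) : ℤ))‖ →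
        ∃ Q : ℕ, 1 ≤ Q ∧ (Q : ℝ) ≤ T ^ C ∧ NearInt (Q * θ) (T ^ C / X ^ k) := by
  obtain ⟨C0, hC0⟩ := exists_weylInverse hk
  refine ⟨C0 + k + R0 + 2 * H, by omega, ?_⟩
  intro d hd q hdeg hcoef hcont T hT X hX θ hlarge
  set CC := C0 + k + R0 + 2 * H with hCC
  have hd' : (1 : ℝ) ≤ d := by exact_mod_cast hd
  have hTd : 1 ≤ T * d := by nlinarith
  have hX1 : (1 : ℝ) ≤ X := (one_le_pow₀ hTd).trans hX
  have hX1' : 1 ≤ X := by exact_mod_cast hX1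
  have hT1 : 1 ≤ T := by linarith
  have hbig : 2 * H * d ^ k * T ^ C0 < (X : ℝ) := by
    have h1 : (2 * H : ℝ) < T ^ (2 * H) := by
      have : ((2 * H : ℕ) : ℝ) < 2 ^ (2 * H) := by exact_mod_cast Nat.lt_two_pow_self
      push_cast at this
      exact this.trans_le (pow_le_pow_left₀ (by norm_num) hT _)
    have h2 : T ^ (2 * H) * d ^ k * T ^ C0 ≤ (T * d) ^ CC := by
      rw [mul_pow, hCC]
      have e1 : (d : ℝ) ^ k ≤ d ^ (C0 + k + R0 + 2 * H) := pow_le_pow_right₀ hd' (by omega)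
      have e2 : T ^ (2 * H + C0) ≤ T ^ (C0 + k + R0 + 2 * H) := pow_le_pow_right₀ hT1 (by omega)
      calc T ^ (2 * H) * d ^ k * T ^ C0 = T ^ (2 * H + C0) * d ^ k := by rw [pow_add]; ring
        _ ≤ _ := by gcongr
    calc 2 * H * d ^ k * T ^ C0 < T ^ (2 * H) * d ^ k * T ^ C0 := by gcongr
      _ ≤ X := h2.trans hX
  set P : ℝ[X] := C θ * q.map (Int.castRingHom ℝ) with hP
  have hPeval : ∀ n : ℕ, P.eval (n : ℝ) = θ * (q.eval (n : ℤ) : ℤ) := by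
    intro n
    rw [hP, eval_mul, eval_C]
    congr 1
    simp
  have hPdeg : P.natDegree ≤ k := by
    refine (natDegree_C_mul_le _ _).trans (natDegree_map_le.trans hdeg.le)
  obtain ⟨Q0, hQ0, hQ0T, hnear⟩ := hC0 X hX1' T hT P hPdeg (by simpa only [hPeval] using hlarge)
  have hPc : ∀ j, P.coeff j = θ * q.coeff j := fun j => by rw [hP, coeff_C_mul, coeff_map]; simp
  have hnear' : ∀ j, ∃ b : ℤ, 1 ≤ j → |Q0 * (θ * q.coeff j) - b| ≤ T ^ C0 / X ^ j := by
    intro j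
    by_cases hj : 1 ≤ j
    · obtain ⟨b, hb⟩ := hnear j hj
      rw [hPc] at hb
      exact ⟨b, fun _ => hb⟩
    · exact ⟨0, fun hh => absurd hh hj⟩
  choose b hb using hnear'
  have hck : q.coeff k ≠ 0 := by
    rw [← hdeg]
    exact leadingCoeff_ne_zero.2 (by rintro rfl; simp at hdeg; omega)
  have hb' : ∀ j, 1 ≤ j → |Q0 * (θ * q.coeff j) - b j| ≤ T ^ C0 / X := by
    intro j hj
    refine (hb j hj).trans ?_
    gcongr
    exact le_self_pow₀ hX1 (by omega)
  have hcr : ∀ j, |(q.coeff j : ℝ)| ≤ H * d ^ k := fun j => by exact_mod_cast hcoef j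
  have hcross : ∀ j, 1 ≤ j → q.coeff k * b j = q.coeff j * b k := by
    intro j hj
    have h1 : |((q.coeff k * b j - q.coeff j * b k : ℤ) : ℝ)| < 1 := by
      have e : ((q.coeff k * b j - q.coeff j * b k : ℤ) : ℝ)
          = q.coeff j * (Q0 * (θ * q.coeff k) - b k) - q.coeff k * (Q0 * (θ * q.coeff j) - b j) := by
        push_cast; ring
      rw [e]
      refine (abs_sub _ _).trans_lt ?_
      rw [abs_mul, abs_mul]
      have hh : ∀ i j, 1 ≤ j → |(q.coeff i : ℝ)| * |Q0 * (θ * q.coeff j) - b j| ≤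
          (H * d ^ k) * (T ^ C0 / X) := fun i j hj =>
        mul_le_mul (hcr i) (hb' j hj) (abs_nonneg _) (by positivity)
      refine (add_le_add (hh j k hk) (hh k j hj)).trans_lt ?_
      rw [← two_mul, ← mul_div_assoc, ← mul_div_assoc, div_lt_one (by linarith)]
      linarith
    have h2 : |q.coeff k * b j - q.coeff j * b k| < 1 := by exact_mod_cast h1
    have := Int.abs_lt_one_iff.1 h2
    linarith
  have hdvd : q.coeff k ∣ R0 * b k := by
    set G := (Finset.Icc 1 k).gcd q.coeff with hG
    have h1 : q.coeff k ∣ G * b k := by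
      have : q.coeff k ∣ (Finset.Icc 1 k).gcd fun j => q.coeff j * b k :=
        Finset.dvd_gcd fun j hj => ⟨b j, (hcross j (Finset.mem_Icc.1 hj).1).symm⟩
      rw [Finset.gcd_mul_right] at this
      exact this.trans (mul_dvd_mul_left _ (normalize_dvd_iff.2 dvd_rfl))
    have h2 : G.natAbs ∣ R0 := by
      refine hcont _ fun j hj => ?_
      rw [Int.natAbs_dvd]
      by_cases hjk : j ≤ k
      · exact Finset.gcd_dvd (Finset.mem_Icc.2 ⟨hj, hjk⟩)
      · rw [coeff_eq_zero_of_natDegree_lt (by omega)]; exact dvd_zero _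
    have h3 : G ∣ (R0 : ℤ) := by
      rw [← Int.natAbs_dvd]; exact_mod_cast h2
    exact h1.trans (mul_dvd_mul_right h3 _)
  obtain ⟨a, ha⟩ := hdvd
  have hRT : (R0 : ℝ) ≤ T ^ R0 := by
    have : ((R0 : ℕ) : ℝ) < 2 ^ R0 := by exact_mod_cast Nat.lt_two_pow_self
    exact this.le.trans (pow_le_pow_left₀ (by norm_num) hT _)
  have hRC : (R0 : ℝ) * T ^ C0 ≤ T ^ CC := by
    calc (R0 : ℝ) * T ^ C0 ≤ T ^ R0 * T ^ C0 := by gcongr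
      _ = T ^ (R0 + C0) := (pow_add _ _ _).symm
      _ ≤ T ^ CC := pow_le_pow_right₀ hT1 (by omega)
  refine ⟨R0 * Q0, Nat.mul_pos hR0 hQ0, ?_, a, ?_⟩
  · push_cast
    refine le_trans ?_ hRC
    gcongr
  · have hck1 : (1 : ℝ) ≤ |(q.coeff k : ℝ)| := by
      exact_mod_cast Int.one_le_abs hck
    have e : (q.coeff k : ℝ) * (((R0 * Q0 : ℕ) : ℝ) * θ - a) = R0 * (Q0 * (θ * q.coeff k) - b k) := by
      have : (R0 : ℝ) * b k = q.coeff k * a := by exact_mod_cast ha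
      push_cast
      linear_combination this
    have h1 : |(q.coeff k : ℝ)| * |((R0 * Q0 : ℕ) : ℝ) * θ - a| ≤ R0 * (T ^ C0 / X ^ k) := by
      rw [← abs_mul, e, abs_mul, Nat.abs_cast]
      gcongr
      exact hb k hk
    calc |((R0 * Q0 : ℕ) : ℝ) * θ - a| ≤ |(q.coeff k : ℝ)| * |((R0 * Q0 : ℕ) : ℝ) * θ - a| :=
          le_mul_of_one_le_left (abs_nonneg _) hck1
      _ ≤ R0 * (T ^ C0 / X ^ k) := h1
      _ = R0 * T ^ C0 / X ^ k := by ring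
      _ ≤ _ := by gcongr

end

section

open scoped ComplexConjugate

noncomputable def zmodFourier {P : ℕ} [NeZero P] (f : ZMod P → ℂ) (r : ZMod P) : ℂ :=
  ∑ x, f x * conj (ZMod.stdAddChar (r * x) : ℂ)

section
variable {P : ℕ} [NeZero P]

theorem norm_stdAddChar (x : ZMod P) : ‖(ZMod.stdAddChar x : ℂ)‖ = 1 := AddChar.norm_apply _ x

theorem sum_conj_zmodFourier_mul (f g : ZMod P → ℂ) :
    ∑ r, conj (zmodFourier f r) * zmodFourier g r = P * ∑ x, conj (f x) * g x := by
  unfold zmodFourier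
  have h1 : ∀ r : ZMod P, conj (∑ x, f x * conj (ZMod.stdAddChar (r * x) : ℂ)) *
      (∑ y, g y * conj (ZMod.stdAddChar (r * y) : ℂ)) =
      ∑ x, ∑ y, conj (f x) * g y * ZMod.stdAddChar (r * (x - y)) := by
    intro r
    rw [map_sum, Finset.sum_mul_sum]
    refine Finset.sum_congr rfl fun x _ => Finset.sum_congr rfl fun y _ => ?_
    rw [map_mul, Complex.conj_conj, mul_sub, sub_eq_add_neg, AddChar.map_add_eq_mul,
      AddChar.map_neg_eq_conj]
    ring
  simp_rw [h1]
  rw [Finset.sum_comm, Finset.mul_sum]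
  refine Finset.sum_congr rfl fun x _ => ?_
  rw [Finset.sum_comm]
  have h2 : ∀ y : ZMod P, ∑ r : ZMod P, conj (f x) * g y * (ZMod.stdAddChar (r * (x - y)) : ℂ) =
      if x = y then P * (conj (f x) * g x) else 0 := by
    intro y
    rw [← Finset.mul_sum, AddChar.sum_mulShift _ (ZMod.isPrimitive_stdAddChar P)]
    by_cases h : x = y
    · subst h; simp [ZMod.card]; ring
    · simp [sub_eq_zero, h]
  simp_rw [h2]
  simp

theorem sum_norm_sq_zmodFourier (f : ZMod P → ℂ) :
    ∑ r, ‖zmodFourier f r‖ ^ 2 = P * ∑ x, ‖f x‖ ^ 2 := by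
  have := sum_conj_zmodFourier_mul f f
  simp_rw [Complex.conj_mul'] at this
  exact_mod_cast this

theorem zmodFourier_shift (f : ZMod P → ℂ) (t r : ZMod P) :
    zmodFourier (fun x => f (x + t)) r = ZMod.stdAddChar (r * t) * zmodFourier f r := by
  unfold zmodFourier
  rw [Finset.mul_sum, ← Equiv.sum_comp (Equiv.addRight t)
    (fun x => (ZMod.stdAddChar (r * t) : ℂ) * (f x * conj (ZMod.stdAddChar (r * x) : ℂ)))]
  refine Finset.sum_congr rfl fun x _ => ?_
  simp only [Equiv.coe_addRight]
  rw [mul_add, AddChar.map_add_eq_mul, map_mul (starRingEnd ℂ)]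
  have h1 : (ZMod.stdAddChar (r * t) : ℂ) * conj (ZMod.stdAddChar (r * t) : ℂ) = 1 := by
    rw [Complex.mul_conj', norm_stdAddChar]; simp
  linear_combination (- f (x + t) * conj (ZMod.stdAddChar (r * x) : ℂ)) * h1

theorem zmodFourier_sum_shift {σ : Type*} (J : Finset σ) (c : σ → ℂ) (t : σ → ZMod P) (f : ZMod P → ℂ)
    (r : ZMod P) :
    zmodFourier (fun x => ∑ j ∈ J, c j * f (x + t j)) r =
      (∑ j ∈ J, c j * ZMod.stdAddChar (r * t j)) * zmodFourier f r := by
  have h1 : zmodFourier (fun x => ∑ j ∈ J, c j * f (x + t j)) r =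
      ∑ j ∈ J, c j * zmodFourier (fun x => f (x + t j)) r := by
    unfold zmodFourier
    simp_rw [Finset.sum_mul, Finset.mul_sum]
    rw [Finset.sum_comm]
    simp_rw [mul_assoc]
  rw [h1, Finset.sum_mul]
  refine Finset.sum_congr rfl fun j _ => ?_
  rw [zmodFourier_shift]; ring

theorem neg_sum_autocorrelation_le (f : ZMod P → ℝ) (X : ℕ) (b : ℕ → ZMod P) :
    -(P * ∑ n ∈ Finset.range X, ∑ x, f x * f (x + b n)) ≤
      ∑ r, ‖zmodFourier (fun x => (f x : ℂ)) r‖ ^ 2 *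
        ‖∑ n ∈ Finset.range X, (ZMod.stdAddChar (r * b n) : ℂ)‖ := by
  set F : ZMod P → ℂ := fun x => (f x : ℂ) with hF
  have h1 : ((P * ∑ n ∈ Finset.range X, ∑ x, f x * f (x + b n) : ℝ) : ℂ) =
      ∑ r, (‖zmodFourier F r‖ ^ 2 : ℝ) * ∑ n ∈ Finset.range X, (ZMod.stdAddChar (r * b n) : ℂ) := by
    have h0 : ∑ r, ((‖zmodFourier F r‖ ^ 2 : ℝ) : ℂ) * ∑ n ∈ Finset.range X, (ZMod.stdAddChar (r * b n) : ℂ)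
        = ∑ n ∈ Finset.range X, ∑ r, ((‖zmodFourier F r‖ ^ 2 : ℝ) : ℂ) * (ZMod.stdAddChar (r * b n) : ℂ) := by
      simp_rw [Finset.mul_sum]
      rw [Finset.sum_comm]
    rw [h0]
    push_cast
    rw [Finset.mul_sum]
    refine Finset.sum_congr rfl fun n _ => ?_
    have h2 := sum_conj_zmodFourier_mul F (fun x => F (x + b n))
    simp_rw [zmodFourier_shift] at h2
    have h3 : ∑ x, (f x : ℂ) * (f (x + b n) : ℂ) = ∑ x, conj (F x) * F (x + b n) := by
      refine Finset.sum_congr rfl fun x _ => ?_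
      simp [hF]
    rw [h3, ← h2]
    refine Finset.sum_congr rfl fun r _ => ?_
    rw [← Complex.conj_mul']; ring
  have h2 : |P * ∑ n ∈ Finset.range X, ∑ x, f x * f (x + b n)| ≤ ∑ r, ‖zmodFourier F r‖ ^ 2 *
        ‖∑ n ∈ Finset.range X, (ZMod.stdAddChar (r * b n) : ℂ)‖ := by
    rw [← Real.norm_eq_abs, ← Complex.norm_real, h1]
    refine (norm_sum_le _ _).trans (Finset.sum_le_sum fun r _ => ?_)
    rw [norm_mul, Complex.norm_real, Real.norm_of_nonneg (by positivity)]
  exact (neg_le_abs _).trans h2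

end

end

section

open scoped ComplexConjugate

/-- Bounds on long-step progressions give bounds on short-step progressions. -/
theorem sum_progression_le {R : Type*} [CommRing R] (g : R → ℝ) (hg : ∀ x, 0 ≤ g x) (y : R) (s N' : ℕ)
    (hN' : 1 ≤ N') (K : ℝ) (hK : ∀ x, ∑ j ∈ Finset.range N', g (x + (s * j : ℕ) * y) ≤ K * N') (x : R)
    (l : ℕ) : ∑ i ∈ Finset.range l, g (x + i * y) ≤ K * (l + s * N') := by
  have hN0 : (0 : ℝ) < N' := by exact_mod_cast hN'
  have h1 : ∑ i ∈ Finset.range (l + s * N'), ∑ j ∈ Finset.range N',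
      g ((x - (s * N' : ℕ) * y + i * y) + (s * j : ℕ) * y) ≤ (l + s * N' : ℕ) * (K * N') := by
    refine (Finset.sum_le_sum fun i _ => hK _).trans ?_
    simp
  rw [Finset.sum_comm] at h1
  have h2 : ∀ j ∈ Finset.range N', ∑ i ∈ Finset.range l, g (x + i * y) ≤
      ∑ i ∈ Finset.range (l + s * N'), g ((x - (s * N' : ℕ) * y + i * y) + (s * j : ℕ) * y) := by
    intro j hj
    have hj := Finset.mem_range.1 hj
    obtain ⟨c, rfl⟩ := Nat.exists_eq_add_of_lt hj
    have hsub : Finset.range (s * (c + 1) + l) ⊆ Finset.range (l + s * (j + c + 1)) := by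
      apply Finset.range_subset_range.2
      nlinarith
    refine le_trans ?_ (Finset.sum_le_sum_of_subset_of_nonneg hsub fun _ _ _ => hg _)
    rw [Finset.sum_range_add]
    refine le_add_of_nonneg_of_le (Finset.sum_nonneg fun _ _ => hg _) (le_of_eq ?_)
    refine Finset.sum_congr rfl fun i _ => ?_
    congr 1
    push_cast
    ring
  have h3 := Finset.sum_le_sum h2
  rw [Finset.sum_const, Finset.card_range, nsmul_eq_mul] at h3
  have h4 := h3.trans h1
  push_cast at h4
  have : N' * ∑ i ∈ Finset.range l, g (x + i * y) ≤ N' * (K * (l + s * N')) := by linarith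
  exact le_of_mul_le_mul_left this hN0

noncomputable def zmodInd (P : ℕ) (A : Finset ℕ) (x : ZMod P) : ℝ := if x.val ∈ A then 1 else 0

section
variable {P : ℕ}

theorem zmodInd_nonneg (A : Finset ℕ) (x : ZMod P) : 0 ≤ zmodInd P A x := by
  unfold zmodInd; split_ifs <;> norm_num

theorem zmodInd_le_one (A : Finset ℕ) (x : ZMod P) : zmodInd P A x ≤ 1 := by
  unfold zmodInd; split_ifs <;> norm_num

theorem zmodInd_mono {A B : Finset ℕ} (h : A ⊆ B) (x : ZMod P) : zmodInd P A x ≤ zmodInd P B x := by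
  unfold zmodInd
  by_cases h1 : x.val ∈ A
  · rw [if_pos h1, if_pos (h h1)]
  · rw [if_neg h1]; split_ifs <;> norm_num

variable [NeZero P]

theorem sum_zmodInd {A : Finset ℕ} (hA : A ⊆ Finset.range P) : ∑ x, zmodInd P A x = A.card := by
  unfold zmodInd
  rw [Finset.sum_boole]
  congr 1
  refine Finset.card_bij (fun x _ => x.val) (fun x hx => by simpa using hx)
    (fun x _ y _ h => ZMod.val_injective P h) fun a ha => ⟨(a : ZMod P), ?_, ?_⟩
  · simp [ZMod.val_natCast_of_lt (Finset.mem_range.1 (hA ha)), ha]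
  · exact ZMod.val_natCast_of_lt (Finset.mem_range.1 (hA ha))

theorem ZMod.val_add_intCast_of_mem {x : ZMod P} {b : ℤ} (h0 : 0 ≤ (x.val : ℤ) + b)
    (h1 : (x.val : ℤ) + b < P) : ((x + (b : ZMod P)).val : ℤ) = x.val + b := by
  have : x + (b : ZMod P) = ((x.val + b : ℤ) : ZMod P) := by
    push_cast; rw [ZMod.natCast_zmod_val]
  rw [this, ZMod.val_intCast, Int.emod_eq_of_lt h0 h1]

theorem sum_zmodInd_range_mul_one_sub {N : ℕ} (hNP : N ≤ P) (b : ℤ) :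
    ∑ x, zmodInd P (Finset.range N) x * (1 - zmodInd P (Finset.range N) (x + b)) ≤ |(b : ℝ)| := by
  have h1 : ∀ x : ZMod P, zmodInd P (Finset.range N) x * (1 - zmodInd P (Finset.range N) (x + b)) =
      if x.val < N ∧ ¬ (x + (b : ZMod P)).val < N then 1 else 0 := by
    intro x
    unfold zmodInd
    simp only [Finset.mem_range]
    by_cases ha : x.val < N <;> by_cases hb : (x + (b : ZMod P)).val < N <;> simp [ha, hb]
  simp_rw [h1]
  rw [Finset.sum_boole, ← Int.cast_abs, Int.abs_eq_natAbs, Int.cast_natCast, Nat.cast_le]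
  rw [← Finset.card_image_of_injective _ (ZMod.val_injective P)]
  rcases le_or_gt 0 b with hb | hb
  · have hsub : ((Finset.univ.filter fun x : ZMod P => x.val < N ∧ ¬ (x + (b : ZMod P)).val < N).image
        ZMod.val) ⊆ Finset.Ico (N - b.natAbs) N := by
      intro y hy
      obtain ⟨x, hx, rfl⟩ := Finset.mem_image.1 hy
      obtain ⟨-, hx1, hx2⟩ := Finset.mem_filter.1 hx
      rw [Finset.mem_Ico]
      refine ⟨?_, hx1⟩
      by_contra hlt
      have := ZMod.val_add_intCast_of_mem (x := x) (b := b) (by positivity) (by omega)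
      omega
    refine (Finset.card_le_card hsub).trans ?_
    rw [Nat.card_Ico]; omega
  · have hsub : ((Finset.univ.filter fun x : ZMod P => x.val < N ∧ ¬ (x + (b : ZMod P)).val < N).image
        ZMod.val) ⊆ Finset.range b.natAbs := by
      intro y hy
      obtain ⟨x, hx, rfl⟩ := Finset.mem_image.1 hy
      obtain ⟨-, hx1, hx2⟩ := Finset.mem_filter.1 hx
      rw [Finset.mem_range]
      by_contra hlt
      have := ZMod.val_add_intCast_of_mem (x := x) (b := b) (by omega) (by omega)
      omega
    refine (Finset.card_le_card hsub).trans ?_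
    rw [Finset.card_range]

noncomputable def balFn (P N : ℕ) (A : Finset ℕ) (x : ZMod P) : ℝ :=
  zmodInd P A x - (A.card / N : ℝ) * zmodInd P (Finset.range N) x

theorem sum_balFn {N : ℕ} (hN : 1 ≤ N) (hNP : N ≤ P) {A : Finset ℕ} (hA : A ⊆ Finset.range N) :
    ∑ x, balFn P N A x = 0 := by
  unfold balFn
  have hN0 : (N : ℝ) ≠ 0 := by positivity
  rw [Finset.sum_sub_distrib, ← Finset.mul_sum, sum_zmodInd (hA.trans (Finset.range_subset_range.2 hNP)),
    sum_zmodInd (Finset.range_subset_range.2 hNP), Finset.card_range]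
  field_simp; ring

theorem sum_balFn_sq_le {N : ℕ} (hN : 1 ≤ N) (hNP : N ≤ P) {A : Finset ℕ} (hA : A ⊆ Finset.range N) :
    ∑ x, balFn P N A x ^ 2 ≤ A.card := by
  unfold balFn
  have hN0 : (N : ℝ) ≠ 0 := by positivity
  set α := (A.card / N : ℝ) with hα
  have h1 : ∀ x : ZMod P, (zmodInd P A x - α * zmodInd P (Finset.range N) x) ^ 2 =
      (1 - 2 * α) * zmodInd P A x + α ^ 2 * zmodInd P (Finset.range N) x := by
    intro x
    unfold zmodInd
    by_cases ha : x.val ∈ A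
    · rw [if_pos ha, if_pos (hA ha)]; ring
    · rw [if_neg ha]; split_ifs <;> ring
  simp_rw [h1]
  rw [Finset.sum_add_distrib, ← Finset.mul_sum, ← Finset.mul_sum,
    sum_zmodInd (hA.trans (Finset.range_subset_range.2 hNP)),
    sum_zmodInd (Finset.range_subset_range.2 hNP), Finset.card_range]
  have : (A.card : ℝ) = α * N := by rw [hα]; field_simp
  rw [this]
  nlinarith [sq_nonneg α, (by positivity : (0:ℝ) ≤ N), mul_nonneg (sq_nonneg α) (by positivity : (0:ℝ) ≤ N)]

theorem autocorrelation_le {N : ℕ} (hN : 1 ≤ N) (hNP : N ≤ P) {A : Finset ℕ}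
    (hA : A ⊆ Finset.range N) (b : ℤ) :
    ∑ x : ZMod P, balFn P N A x * balFn P N A (x + b) ≤
      ∑ x : ZMod P, zmodInd P A x * zmodInd P A (x + b) - (A.card / N : ℝ) ^ 2 * N
        + 2 * (A.card / N : ℝ) * |(b : ℝ)| := by
  have hN0 : (N : ℝ) ≠ 0 := by positivity
  unfold balFn
  set α := (A.card / N : ℝ) with hα
  have hα0 : 0 ≤ α := by positivity
  have hcard : (A.card : ℝ) = α * N := by rw [hα]; field_simp
  set I := Finset.range N
  have hI : I ⊆ Finset.range P := Finset.range_subset_range.2 hNP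
  have e1 := sum_zmodInd (P := P) (hA.trans hI)
  have e2 := sum_zmodInd (P := P) hI
  have key : ∀ x : ZMod P, (zmodInd P A x - α * zmodInd P I x) *
      (zmodInd P A (x + b) - α * zmodInd P I (x + b)) ≤
      zmodInd P A x * zmodInd P A (x + b) - α * zmodInd P A x - α * zmodInd P A (x + b)
      + α * (zmodInd P I x * (1 - zmodInd P I (x + b)))
      + α * (zmodInd P I (x + b) * (1 - zmodInd P I (x + b + ((-b : ℤ) : ZMod P))))
      + α ^ 2 * zmodInd P I x := by
    intro x
    have a1 := zmodInd_mono hA x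
    have a2 := zmodInd_mono hA (x + (b : ZMod P))
    have a3 := zmodInd_le_one I x
    have a4 := zmodInd_le_one I (x + (b : ZMod P))
    have a5 : x + (b : ZMod P) + ((-b : ℤ) : ZMod P) = x := by push_cast; ring
    rw [a5]
    have b1 : zmodInd P A x * (1 - zmodInd P I (x + b)) ≤ zmodInd P I x * (1 - zmodInd P I (x + b)) :=
      mul_le_mul_of_nonneg_right a1 (by linarith)
    have b2 : zmodInd P A (x + b) * (1 - zmodInd P I x) ≤ zmodInd P I (x + b) * (1 - zmodInd P I x) :=
      mul_le_mul_of_nonneg_right a2 (by linarith)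
    have b3 : zmodInd P I x * zmodInd P I (x + b) ≤ zmodInd P I x :=
      mul_le_of_le_one_right (zmodInd_nonneg _ _) a4
    have c1 := mul_le_mul_of_nonneg_left b1 hα0
    have c2 := mul_le_mul_of_nonneg_left b2 hα0
    have c3 := mul_le_mul_of_nonneg_left b3 (sq_nonneg α)
    linarith
  refine (Finset.sum_le_sum fun x _ => key x).trans ?_
  simp only [Finset.sum_add_distrib, Finset.sum_sub_distrib, ← Finset.mul_sum]
  have hs := Equiv.sum_comp (Equiv.addRight (b : ZMod P)) (fun x => zmodInd P A x)
  have hs2 := Equiv.sum_comp (Equiv.addRight (b : ZMod P))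
    (fun x => zmodInd P I x * (1 - zmodInd P I (x + ((-b : ℤ) : ZMod P))))
  simp only [Equiv.coe_addRight] at hs hs2
  rw [hs, hs2, e1, e2, hcard, Finset.card_range]
  have f1 := mul_le_mul_of_nonneg_left (sum_zmodInd_range_mul_one_sub hNP b) hα0
  have f2 := mul_le_mul_of_nonneg_left (sum_zmodInd_range_mul_one_sub hNP (-b)) hα0
  rw [Int.cast_neg (R := ℝ), abs_neg] at f2
  linarith

end

theorem sum_zmodInd_mul_shift_eq_zero {N : ℕ} (hN : 1 ≤ N) {A : Finset ℕ} (hA : A ⊆ Finset.range N)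
    {b : ℤ} (hb : |b| < N) (hb0 : b ≠ 0) (hdiff : ∀ a ∈ A, ∀ a' ∈ A, (a : ℤ) - a' = b → a = a')
    (x : ZMod (2 * N)) : zmodInd (2 * N) A x * zmodInd (2 * N) A (x + b) = 0 := by
  have : NeZero (2 * N) := ⟨by omega⟩
  unfold zmodInd
  by_cases h1 : x.val ∈ A
  · by_cases h2 : (x + (b : ZMod (2 * N))).val ∈ A
    · exfalso
      have h3 := Finset.mem_range.1 (hA h1)
      have h4 := Finset.mem_range.1 (hA h2)
      set y := (x + (b : ZMod (2 * N))).val with hy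
      have h5 : ((2 * N : ℕ) : ℤ) ∣ (y : ℤ) - x.val - b := by
        rw [← ZMod.intCast_zmod_eq_zero_iff_dvd]
        push_cast
        rw [hy, ZMod.natCast_zmod_val, ZMod.natCast_zmod_val]
        ring
      have h6 : (y : ℤ) - x.val - b = 0 := by
        apply Int.eq_zero_of_abs_lt_dvd h5
        rw [abs_lt] at hb ⊢
        push_cast
        constructor <;> omega
      have := hdiff y h2 x.val h1 (by omega)
      omega
    · rw [if_neg h2, mul_zero]
  · rw [if_neg h1, zero_mul]

/-- A set without differences in the image of `q` has a large weighted Fourier mass. -/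
theorem le_sum_fourier_of_no_difference {N : ℕ} (hN : 1 ≤ N) [NeZero (2 * N)] {A : Finset ℕ}
    (hA : A ⊆ Finset.range N) {q : Polynomial ℤ} (hq : q ≠ 0)
    (hdiff : ∀ a ∈ A, ∀ a' ∈ A, ∀ n : ℕ, (a : ℤ) - a' = q.eval (n : ℤ) → a = a') {X : ℕ}
    (hX : 8 * (q.natDegree : ℝ) ≤ 3 * (A.card / N : ℝ) * X)
    (hb : ∀ n < X, |((q.eval (n : ℤ) : ℤ) : ℝ)| ≤ (A.card / N : ℝ) * N / 16) :
    (A.card / N : ℝ) ^ 2 * N * X * N ≤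
      ∑ r, ‖zmodFourier (fun x => (balFn (2 * N) N A x : ℂ)) r‖ ^ 2 *
        ‖∑ n ∈ Finset.range X, (ZMod.stdAddChar (r * ((q.eval (n : ℤ) : ℤ) : ZMod (2 * N))) : ℂ)‖ := by
  classical
  refine le_trans ?_ (neg_sum_autocorrelation_le (balFn (2 * N) N A) X
    (fun n => ((q.eval (n : ℤ) : ℤ) : ZMod (2 * N))))
  have hN0 : (0 : ℝ) < N := by exact_mod_cast hN
  have hNP : N ≤ 2 * N := by omega
  have hcl : (A.card : ℝ) ≤ N := by
    have := Finset.card_le_card hA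
    rw [Finset.card_range] at this
    exact_mod_cast this
  set α := (A.card / N : ℝ) with hα
  have hα0 : 0 ≤ α := by positivity
  have hα1 : α ≤ 1 := by rw [hα, div_le_one hN0]; exact hcl
  have hcard : (A.card : ℝ) = α * N := by rw [hα]; field_simp
  have h1 : ∀ n ∈ Finset.range X, ∑ x : ZMod (2 * N), balFn (2 * N) N A x *
      balFn (2 * N) N A (x + ((q.eval (n : ℤ) : ℤ) : ZMod (2 * N))) ≤
      (if q.eval (n : ℤ) = 0 then α * N else 0) - α ^ 2 * N * (7 / 8) := by
    intro n hn
    have hbn := hb n (Finset.mem_range.1 hn)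
    refine (autocorrelation_le hN hNP hA _).trans ?_
    rw [← hα]
    have h2 : ∑ x : ZMod (2 * N), zmodInd (2 * N) A x *
        zmodInd (2 * N) A (x + ((q.eval (n : ℤ) : ℤ) : ZMod (2 * N))) ≤
        if q.eval (n : ℤ) = 0 then α * N else 0 := by
      split_ifs with h0
      · rw [← hcard, ← sum_zmodInd (P := 2 * N) (hA.trans (Finset.range_subset_range.2 hNP))]
        exact Finset.sum_le_sum fun x _ => mul_le_of_le_one_right (zmodInd_nonneg _ _) (zmodInd_le_one _ _)
      · refine le_of_eq (Finset.sum_eq_zero fun x _ => ?_)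
        refine sum_zmodInd_mul_shift_eq_zero hN hA ?_ h0 (fun a ha a' ha' h => hdiff a ha a' ha' n h) x
        have : |((q.eval (n : ℤ) : ℤ) : ℝ)| < N := by nlinarith
        exact_mod_cast this
    nlinarith
  have h2 := Finset.sum_le_sum h1
  rw [Finset.sum_sub_distrib, ← Finset.sum_filter, Finset.sum_const, Finset.sum_const, Finset.card_range,
    nsmul_eq_mul, nsmul_eq_mul] at h2
  have h3 : (((Finset.range X).filter fun n : ℕ => q.eval (n : ℤ) = 0).card : ℝ) ≤ q.natDegree := by
    have h4 : ((Finset.range X).filter fun n : ℕ => q.eval (n : ℤ) = 0).card ≤ q.roots.toFinset.card := by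
      refine Finset.card_le_card_of_injOn (fun n : ℕ => (n : ℤ)) ?_ (fun a _ b _ h => Nat.cast_injective h)
      intro n hn
      simp only [Finset.coe_filter, Finset.mem_range, Set.mem_ofPred_eq] at hn
      simp [hq, hn.2]
    exact_mod_cast h4.trans ((Multiset.toFinset_card_le _).trans (Polynomial.card_roots' q))
  have h5 : ∑ n ∈ Finset.range X, ∑ x : ZMod (2 * N), balFn (2 * N) N A x *
      balFn (2 * N) N A (x + ((q.eval (n : ℤ) : ℤ) : ZMod (2 * N))) ≤ - (α ^ 2 * N * X / 2) := by
    have h6 := mul_le_mul_of_nonneg_right h3 (mul_nonneg hα0 hN0.le)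
    have h7 := mul_le_mul_of_nonneg_right hX (mul_nonneg hα0 hN0.le)
    nlinarith
  push_cast
  nlinarith

end

section
variable {N : ℕ} [NeZero (2 * N)]

theorem card_meets_range_le (D L : ℕ) :
    ((Finset.univ.filter fun x : ZMod (2 * N) => ∃ j ∈ Finset.range L,
      (x + (j : ZMod (2 * N)) * (D : ZMod (2 * N))).val < N).card) ≤ N + D * L := by
  classical
  have hsub : (Finset.univ.filter fun x : ZMod (2 * N) => ∃ j ∈ Finset.range L,
      (x + (j : ZMod (2 * N)) * (D : ZMod (2 * N))).val < N) ⊆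
      (Finset.range (N + D * L)).image fun t : ℕ => (t : ZMod (2 * N)) - ((D * L : ℕ) : ZMod (2 * N)) := by
    intro x hx
    obtain ⟨-, j, hj, hx⟩ := Finset.mem_filter.1 hx
    have hj := Finset.mem_range.1 hj
    rw [Finset.mem_image]
    refine ⟨(x + (j : ZMod (2 * N)) * (D : ZMod (2 * N))).val + D * (L - j), ?_, ?_⟩
    · rw [Finset.mem_range]
      have : D * (L - j) ≤ D * L := Nat.mul_le_mul_left _ (Nat.sub_le _ _)
      omega
    · push_cast [Nat.cast_sub hj.le]
      rw [ZMod.natCast_zmod_val]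
      ring
  refine (Finset.card_le_card hsub).trans (Finset.card_image_le.trans ?_)
  rw [Finset.card_range]

/-- The average of the balanced function along a progression is small in mean square. -/
theorem sum_smoothed_sq_le (hN : 1 ≤ N) {A : Finset ℕ} (hA : A ⊆ Finset.range N) {D L : ℕ} (hL : 1 ≤ L)
    (hDL : 1024 * (D * L) ≤ N)
    (hinc : ∀ x : ZMod (2 * N), ∑ j ∈ Finset.range L,
      zmodInd (2 * N) A (x + (j : ZMod (2 * N)) * (D : ZMod (2 * N))) ≤ (1 + 1 / 256) * (A.card / N : ℝ) * L) :
    ∑ x : ZMod (2 * N), ((L : ℝ)⁻¹ * ∑ j ∈ Finset.range L,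
      balFn (2 * N) N A (x + (j : ZMod (2 * N)) * (D : ZMod (2 * N)))) ^ 2 ≤ (A.card / N : ℝ) ^ 2 * N / 32 := by
  classical
  have hN0 : (0 : ℝ) < N := by exact_mod_cast hN
  have hL0 : (0 : ℝ) < L := by exact_mod_cast hL
  have hNP : N ≤ 2 * N := by omega
  set α := (A.card / N : ℝ) with hα
  have hα0 : 0 ≤ α := by positivity
  set I := Finset.range N with hI
  set i : ZMod (2 * N) → ℝ := fun x => (L : ℝ)⁻¹ * ∑ j ∈ Finset.range L,
    zmodInd (2 * N) I (x + (j : ZMod (2 * N)) * (D : ZMod (2 * N))) with hi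
  set a : ZMod (2 * N) → ℝ := fun x => (L : ℝ)⁻¹ * ∑ j ∈ Finset.range L,
    zmodInd (2 * N) A (x + (j : ZMod (2 * N)) * (D : ZMod (2 * N))) with ha
  set f0 : ZMod (2 * N) → ℝ := fun x => (L : ℝ)⁻¹ * ∑ j ∈ Finset.range L,
    balFn (2 * N) N A (x + (j : ZMod (2 * N)) * (D : ZMod (2 * N))) with hf0
  have hf0e : ∀ x, f0 x = a x - α * i x := by
    intro x
    simp only [hf0, ha, hi, balFn, Finset.sum_sub_distrib, ← Finset.mul_sum, ← hα]
    ring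
  set B := (Finset.univ.filter fun x : ZMod (2 * N) => ∃ j ∈ Finset.range L,
      (x + (j : ZMod (2 * N)) * (D : ZMod (2 * N))).val < N) with hB
  have hBcard : (B.card : ℝ) ≤ N + D * L := by
    calc (B.card : ℝ) ≤ ((N + D * L : ℕ) : ℝ) := Nat.cast_le.2 (card_meets_range_le D L)
      _ = N + D * L := by push_cast; ring
  have ha0 : ∀ x, 0 ≤ a x := fun x => mul_nonneg (by positivity) (Finset.sum_nonneg fun _ _ => zmodInd_nonneg _ _)
  have hai : ∀ x, a x ≤ i x := fun x => mul_le_mul_of_nonneg_left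
    (Finset.sum_le_sum fun _ _ => zmodInd_mono hA _) (by positivity)
  have hi1 : ∀ x, i x ≤ 1 := fun x => by
    have : ∑ j ∈ Finset.range L, zmodInd (2 * N) I (x + (j : ZMod (2 * N)) * (D : ZMod (2 * N))) ≤ L := by
      refine (Finset.sum_le_sum fun _ _ => zmodInd_le_one _ _).trans ?_
      simp
    calc i x ≤ (L : ℝ)⁻¹ * L := mul_le_mul_of_nonneg_left this (by positivity)
      _ = 1 := inv_mul_cancel₀ hL0.ne'
  have ha1 : ∀ x, a x ≤ (1 + 1 / 256) * α := fun x => by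
    calc a x ≤ (L : ℝ)⁻¹ * ((1 + 1 / 256) * α * L) := mul_le_mul_of_nonneg_left (hinc x) (by positivity)
      _ = _ := by field_simp
  have hiB : ∀ x, x ∉ B → i x = 0 := by
    intro x hx
    simp only [hi]
    rw [Finset.sum_eq_zero, mul_zero]
    intro j hj
    unfold zmodInd
    rw [if_neg]
    intro hm
    exact hx (Finset.mem_filter.2 ⟨Finset.mem_univ _, j, hj, Finset.mem_range.1 hm⟩)
  have hsumshift : ∀ g : ZMod (2 * N) → ℝ, ∑ x, (L : ℝ)⁻¹ * ∑ j ∈ Finset.range L,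
      g (x + (j : ZMod (2 * N)) * (D : ZMod (2 * N))) = ∑ x, g x := by
    intro g
    rw [← Finset.mul_sum, Finset.sum_comm]
    have : ∀ j : ℕ, ∑ x, g (x + (j : ZMod (2 * N)) * (D : ZMod (2 * N))) = ∑ x, g x := fun j =>
      Equiv.sum_comp (Equiv.addRight _) g
    simp_rw [this]
    rw [Finset.sum_const, Finset.card_range, nsmul_eq_mul, ← mul_assoc, inv_mul_cancel₀ hL0.ne', one_mul]
  have hsumi : ∑ x, i x = N := by
    rw [hi, hsumshift, sum_zmodInd (Finset.range_subset_range.2 hNP), Finset.card_range]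
  have hsumf : ∑ x, f0 x = 0 := by
    rw [hf0, hsumshift, sum_balFn hN hNP hA]
  have key : ∀ x, f0 x ^ 2 ≤ 2 * α * (2 * (if x ∈ B then α * (1 / 256 + 1 - i x) else 0) - f0 x) := by
    intro x
    have h1 := ha0 x
    have h2 := hai x
    have h3 := hi1 x
    have h4 := ha1 x
    rw [hf0e]
    split_ifs with hx
    · have hi0 : 0 ≤ i x := h1.trans h2
      have hαi : α * i x ≤ α := mul_le_of_le_one_right hα0 h3
      have hαi0 : 0 ≤ α * i x := mul_nonneg hα0 hi0
      set z := a x - α * i x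
      have hz : z ≤ α * (1 / 256 + 1 - i x) := by simp only [z]; linarith
      have hz0 : 0 ≤ α * (1 / 256 + 1 - i x) := mul_nonneg hα0 (by linarith)
      rcases le_or_gt 0 z with hz1 | hz1
      · have : z ≤ 2 * α := by simp only [z]; linarith
        nlinarith
      · have : -z ≤ 2 * α := by simp only [z]; linarith
        nlinarith
    · have h5 := hiB x hx
      have : a x = 0 := by linarith
      rw [h5, this]; simp
  refine (Finset.sum_le_sum fun x _ => key x).trans ?_
  rw [← Finset.mul_sum, Finset.sum_sub_distrib, hsumf, ← Finset.mul_sum, ← Finset.sum_filter]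
  have h1 : ∑ x ∈ Finset.univ.filter (fun x => x ∈ B), α * (1 / 256 + 1 - i x) =
      α * ((1 / 256 + 1) * B.card - N) := by
    rw [← Finset.mul_sum, Finset.sum_sub_distrib, Finset.sum_const, Finset.filter_mem_eq_inter,
      Finset.univ_inter, nsmul_eq_mul, ← hsumi]
    congr 1
    rw [Finset.sum_subset (Finset.subset_univ B) (fun x _ hx => hiB x hx)]
    ring
  rw [h1]
  have h2 : (1024 : ℝ) * (D * L) ≤ N := by exact_mod_cast hDL
  have h3 : (1 / 256 + 1 : ℝ) * B.card - N ≤ N / 128 := by nlinarith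
  have h4 : 0 ≤ α * α := mul_nonneg hα0 hα0
  have := mul_le_mul_of_nonneg_left h3 h4
  nlinarith
end

theorem card_filter_card_le_pow (ι : Type) [Fintype ι] [DecidableEq ι] (m : ℕ) :
    (Finset.univ.filter fun T : Finset ι => T.card ≤ m).card ≤ (Fintype.card ι + 1) ^ m := by
  induction m with
  | zero =>
    rw [pow_zero, Finset.card_le_one]
    intro a ha b hb
    have ha := (Finset.mem_filter.1 ha).2
    have hb := (Finset.mem_filter.1 hb).2
    rw [Finset.card_eq_zero.1 (Nat.le_zero.1 ha), Finset.card_eq_zero.1 (Nat.le_zero.1 hb)]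
  | succ m ih =>
    have hsub : (Finset.univ.filter fun T : Finset ι => T.card ≤ m + 1) ⊆
        ((Finset.univ.filter fun T : Finset ι => T.card ≤ m) ×ˢ (Finset.univ : Finset (Option ι))).image
          fun p => p.2.elim p.1 fun a => insert a p.1 := by
      intro T hT
      have hT := (Finset.mem_filter.1 hT).2
      rw [Finset.mem_image]
      by_cases h : T.card ≤ m
      · exact ⟨(T, none), by simp [h], rfl⟩
      · obtain ⟨a, ha⟩ : T.Nonempty := Finset.card_pos.1 (by omega)
        refine ⟨(T.erase a, some a), ?_, Finset.insert_erase ha⟩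
        simp only [Finset.mem_product, Finset.mem_filter, Finset.mem_univ, true_and, and_true]
        rw [Finset.card_erase_of_mem ha]
        omega
    refine (Finset.card_le_card hsub).trans (Finset.card_image_le.trans ?_)
    rw [Finset.card_product, Finset.card_univ, Fintype.card_option, pow_succ]
    exact Nat.mul_le_mul_right _ ih

section
variable {ι : Type} [Fintype ι] [DecidableEq ι] {n : ι → ℕ} [∀ i, NeZero (n i)]

theorem exists_forall_natCast_eq_iff (hco : Pairwise (Function.onFun Nat.Coprime n)) (U : Finset ι)
    (x : ∀ i, ZMod (n i)) : ∃ c, c < ∏ i ∈ U, n i ∧ ∀ j : ℕ,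
      (∀ i ∈ U, (j : ZMod (n i)) = x i) ↔ j ≡ c [MOD ∏ i ∈ U, n i] := by
  have hn : ∀ i ∈ U, n i ≠ 0 := fun i _ => NeZero.ne _
  have hpp : Set.Pairwise (U : Set ι) (Function.onFun Nat.Coprime n) := fun i _ j _ hij => hco hij
  refine ⟨Nat.chineseRemainderOfFinset (fun i => (x i).val) n U hn hpp,
    Nat.chineseRemainderOfFinset_lt_prod _ n hn hpp, fun j => ?_⟩
  have hc := (Nat.chineseRemainderOfFinset (fun i => (x i).val) n U hn hpp).2
  set c := (Nat.chineseRemainderOfFinset (fun i => (x i).val) n U hn hpp).1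
  have h1 : ∀ i, ((j : ZMod (n i)) = x i ↔ j ≡ (x i).val [MOD n i]) := by
    intro i
    rw [← ZMod.natCast_eq_natCast_iff, ZMod.natCast_zmod_val]
  simp only [h1]
  constructor
  · intro h
    rw [Nat.modEq_iff_dvd, Nat.cast_prod]
    refine Finset.prod_dvd_of_coprime ?_ ?_
    · intro i hi k hk hik
      exact Nat.isCoprime_iff_coprime.2 (hpp hi hk hik)
    · intro i hi
      exact Nat.modEq_iff_dvd.1 ((h i hi).trans (hc i hi).symm)
  · intro h i hi
    exact (h.of_dvd (Finset.dvd_prod_of_mem n hi)).trans (hc i hi)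

theorem indKer_natCast (U : Finset ι) (x : ∀ i, ZMod (n i)) (j : ℕ) :
    indKer U x (fun i => (j : ZMod (n i))) =
      if ∀ i ∈ U, (j : ZMod (n i)) = x i then ((∏ i ∈ U, n i : ℕ) : ℝ) else 0 := by
  unfold indKer
  simp only [ZMod.card]
  split_ifs with h
  · rw [Nat.cast_prod]
    exact Finset.prod_congr rfl fun i hi => if_pos (h i hi)
  · push Not at h
    obtain ⟨i, hi, h⟩ := h
    exact Finset.prod_eq_zero hi (if_neg h)

theorem sum_indKer_le (hco : Pairwise (Function.onFun Nat.Coprime n)) {L : ℕ} {g : ℕ → ℝ}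
    (hg : ∀ j, 0 ≤ g j) {κ : ℝ} {U : Finset ι} (h : ∀ c, ((∏ i ∈ U, n i : ℕ) : ℝ) *
      ∑ i ∈ Finset.range (L / (∏ i ∈ U, n i) + 1), g (c + i * ∏ i ∈ U, n i) ≤ κ) (x : ∀ i, ZMod (n i)) :
    ∑ j ∈ Finset.range L, g j * indKer U x (fun i => (j : ZMod (n i))) ≤ κ := by
  obtain ⟨c, hc, hx⟩ := exists_forall_natCast_eq_iff hco U x
  simp only [indKer_natCast, hx, mul_ite, mul_zero]
  set P := ∏ i ∈ U, n i
  have hP : 0 < P := by omega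
  refine le_trans ?_ (h c)
  rw [← Finset.sum_filter, ← Finset.sum_mul, mul_comm]
  refine mul_le_mul_of_nonneg_left ?_ (Nat.cast_nonneg _)
  rw [← Finset.sum_image (s := Finset.range (L / P + 1)) (g := fun i => c + i * P) (f := g)]
  · refine Finset.sum_le_sum_of_subset_of_nonneg ?_ fun _ _ _ => hg _
    intro j hj
    obtain ⟨hj, hjc⟩ := Finset.mem_filter.1 hj
    have hj := Finset.mem_range.1 hj
    have hjc : j % P = c := by rw [hjc, Nat.mod_eq_of_lt hc]
    refine Finset.mem_image.2 ⟨j / P, ?_, ?_⟩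
    · rw [Finset.mem_range, Nat.lt_succ_iff]
      exact Nat.div_le_div_right hj.le
    · rw [← hjc, mul_comm]; exact Nat.mod_add_div j P
  · intro a _ b _ hab
    have hab : c + a * P = c + b * P := hab
    exact Nat.eq_of_mul_eq_mul_right hP (by omega)

theorem abs_sum_indKer_sub_one_le (hco : Pairwise (Function.onFun Nat.Coprime n)) {L : ℕ} (hL : 1 ≤ L)
    (W : Finset ι) (x : ∀ i, ZMod (n i)) :
    |∑ j ∈ Finset.range L, (L : ℝ)⁻¹ * indKer W x (fun i => (j : ZMod (n i))) - 1| ≤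
      (∏ i ∈ W, n i : ℕ) / L := by
  obtain ⟨c, hc, hx⟩ := exists_forall_natCast_eq_iff hco W x
  simp only [indKer_natCast, hx, mul_ite, mul_zero]
  set P := ∏ i ∈ W, n i
  have hP : 0 < P := by omega
  have hL0 : (0 : ℝ) < L := by exact_mod_cast hL
  rw [← Finset.sum_filter, Finset.sum_const, nsmul_eq_mul, ← Nat.count_eq_card_filter_range,
    Nat.count_modEq_card _ hP]
  have h1 : P * (L / P) + L % P = L := Nat.div_add_mod L P
  have h2 : L % P < P := Nat.mod_lt _ hP
  have h3 : (P : ℝ) * (L / P : ℕ) + (L % P : ℕ) = L := by exact_mod_cast h1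
  have h4 : ((L % P : ℕ) : ℝ) < P := by exact_mod_cast h2
  have h5 : (0 : ℝ) ≤ (L % P : ℕ) := Nat.cast_nonneg _
  have h6 : ∀ t : ℝ, 0 ≤ t → t ≤ 1 → |((L / P : ℕ) + t) * ((L : ℝ)⁻¹ * P) - 1| ≤ P / L := by
    intro t h0 h1
    have : ((L / P : ℕ) + t) * ((L : ℝ)⁻¹ * P) - 1 = (t * P - (L % P : ℕ)) / L := by
      field_simp
      linarith
    rw [this, abs_div, abs_of_pos hL0]
    gcongr
    rw [abs_le]
    constructor <;> nlinarith
  have := h6 ((if c % P < L % P then 1 else 0 : ℕ) : ℝ) (by positivity) (by split_ifs <;> simp)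
  exact_mod_cast this

theorem level_numeric {m : ℕ} (hm : 1 ≤ m) {α : ℝ} (hα : ((2 : ℝ) ^ (64 * m ^ 3))⁻¹ ≤ α) :
    3 * (4 * (((4 : ℝ) ^ (2 * m))⁻¹)⁻¹ ^ 2) ^ (m * (2 * m)) * (4 * α) ^ (4 * m - 1) ≤
      (α ^ 2 * 2 ^ (64 * m ^ 2) / 64) ^ (2 * m) := by
  have hα0 : 0 < α := lt_of_lt_of_le (by positivity) hα
  rw [inv_inv]
  have h4 : (4 : ℝ) = 2 ^ 2 := by norm_num
  have h64 : (64 : ℝ) = 2 ^ 6 := by norm_num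
  have e1 : (4 * ((4 : ℝ) ^ (2 * m)) ^ 2) ^ (m * (2 * m)) = 2 ^ ((2 + 8 * m) * (m * (2 * m))) := by
    rw [h4, ← pow_mul, ← pow_mul, ← pow_add, ← pow_mul]
    congr 1; ring
  have e2 : (α ^ 2 * 2 ^ (64 * m ^ 2) / 64) ^ (2 * m) = α ^ (4 * m - 1) * α * 2 ^ (128 * m ^ 3) / 2 ^ (12 * m) := by
    rw [← pow_succ, Nat.sub_add_cancel (by omega), h64]
    rw [div_pow, mul_pow, ← pow_mul, ← pow_mul, ← pow_mul]
    congr 2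
    · congr 1; ring
    · congr 1; ring
    · ring
  rw [e1, e2, mul_pow, le_div_iff₀ (by positivity)]
  have h5 : (3 : ℝ) * 2 ^ ((2 + 8 * m) * (m * (2 * m))) * 4 ^ (4 * m - 1) * 2 ^ (12 * m) ≤ 2 ^ (64 * m ^ 3) := by
    calc (3 : ℝ) * 2 ^ ((2 + 8 * m) * (m * (2 * m))) * 4 ^ (4 * m - 1) * 2 ^ (12 * m)
        ≤ 2 ^ 2 * 2 ^ ((2 + 8 * m) * (m * (2 * m))) * 2 ^ (2 * (4 * m - 1)) * 2 ^ (12 * m) := by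
          rw [h4, ← pow_mul]
          gcongr
          norm_num
      _ = 2 ^ (2 + (2 + 8 * m) * (m * (2 * m)) + 2 * (4 * m - 1) + 12 * m) := by
          rw [← pow_add, ← pow_add, ← pow_add]
      _ ≤ _ := by
          refine pow_le_pow_right₀ (by norm_num) ?_
          obtain ⟨t, rfl⟩ : ∃ t, m = t + 1 := ⟨m - 1, by omega⟩
          have : 4 * (t + 1) - 1 = 4 * t + 3 := by omega
          rw [this]
          ring_nf
          nlinarith [Nat.zero_le t, Nat.zero_le (t ^ 2), Nat.zero_le (t ^ 3)]
  have h6 : (2 : ℝ) ^ (64 * m ^ 3) ≤ α * 2 ^ (128 * m ^ 3) := by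
    have h7 : (2 : ℝ) ^ (128 * m ^ 3) = 2 ^ (64 * m ^ 3) * 2 ^ (64 * m ^ 3) := by
      rw [← pow_add]; congr 1; ring
    have h8 : 1 ≤ α * 2 ^ (64 * m ^ 3) := by
      rwa [inv_le_iff_one_le_mul₀ (by positivity)] at hα
    rw [h7, ← mul_assoc]
    exact le_mul_of_one_le_left (by positivity) h8
  calc 3 * 2 ^ ((2 + 8 * m) * (m * (2 * m))) * (4 ^ (4 * m - 1) * α ^ (4 * m - 1)) * 2 ^ (12 * m)
      = α ^ (4 * m - 1) * (3 * 2 ^ ((2 + 8 * m) * (m * (2 * m))) * 4 ^ (4 * m - 1) * 2 ^ (12 * m)) := by ring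
    _ ≤ α ^ (4 * m - 1) * (α * 2 ^ (128 * m ^ 3)) := by
        refine mul_le_mul_of_nonneg_left (h5.trans h6) (by positivity)
    _ = _ := by ring

open ComplexConjugate in
/-- A measure on an interval which is roughly equidistributed from above in progressions has
few large correlations with low-level characters. -/
theorem sum_norm_sq_conj_character_le (hco : Pairwise (Function.onFun Nat.Coprime n)) {Z : ℕ}
    (hZ1 : 1 ≤ Z) (hZ : ∀ i, n i ≤ Z) {L m : ℕ} (hm : 1 ≤ m)
    (hL : Z ^ ((4 * m + 1) * m) * ((Fintype.card ι + 1) ^ m * 2 ^ m) ^ (4 * m) ≤ L) {ν : ℕ → ℝ}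
    (hν : ∀ j, |ν j| ≤ (L : ℝ)⁻¹) {α : ℝ} (hα : ((2 : ℝ) ^ (64 * m ^ 3))⁻¹ ≤ α)
    (hκ : ∀ U : Finset ι, U.card ≤ m → ∀ c, ((∏ i ∈ U, n i : ℕ) : ℝ) *
      ∑ i ∈ Finset.range (L / (∏ i ∈ U, n i) + 1), |ν (c + i * ∏ i ∈ U, n i)| ≤ 4 * α)
    (𝒳 : Finset (AddChar (∀ i, ZMod (n i)) ℂ)) (h𝒳 : ∀ χ ∈ 𝒳, (charSupp χ).card ≤ m) :
    ∑ χ ∈ 𝒳, ‖∑ j ∈ Finset.range L, (ν j : ℂ) * conj (χ fun i => (j : ZMod (n i)))‖ ^ 2 ≤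
      α ^ 2 * 2 ^ (64 * m ^ 2) / 64 := by
  have hα0 : 0 < α := lt_of_lt_of_le (by positivity) hα
  obtain ⟨t, rfl⟩ : ∃ t, m = t + 1 := ⟨m - 1, by omega⟩
  set m := t + 1 with hmt
  have hM : 2 * t + 2 = 2 * m := by omega
  rcases Nat.eq_zero_or_pos L with hL0 | hLpos
  · subst hL0
    simp only [Finset.range_zero, Finset.sum_empty, norm_zero]
    simp only [ne_eq, OfNat.ofNat_ne_zero, not_false_eq_true, zero_pow, Finset.sum_const_zero]
    positivity
  have hLr : (0 : ℝ) < L := by exact_mod_cast hLpos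
  refine (sum_norm_sq_le_levelEnergy (Finset.range L) ν (fun j i => (j : ZMod (n i))) m 𝒳 h𝒳
    (fun _ => 0)).trans ?_
  refine levelEnergy_le (Finset.range L) ν (fun j i => (j : ZMod (n i))) (ρ := ((4 : ℝ) ^ (2 * m))⁻¹)
    (n := 2 * t) (e := m) (μ := (L : ℝ)⁻¹) (ε := (Z ^ ((4 * m + 1) * m) : ℕ) / L) (κ := 4 * α)
    (K := (Fintype.card ι + 1 : ℕ) ^ m) (by positivity) ?_ ?_ (fun j _ => hν j) ?_ ?_ ?_ ?_ ?_ ?_ m ∅ (by simp) _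
  · exact inv_le_one_of_one_le₀ (one_le_pow₀ (by norm_num))
  · rw [hM, inv_pow, ← div_eq_mul_inv, div_le_one (by positivity)]
    have : ((4 : ℝ) ^ (2 * m)) ^ 2 = 2 ^ (2 * m) * (2 ^ (2 * m)) ^ 3 := by
      have h4 : (4 : ℝ) = 2 ^ 2 := by norm_num
      rw [h4, ← pow_mul, ← pow_mul, ← pow_mul, ← pow_add]
      congr 1; ring
    rw [this, mul_comm]
    refine mul_le_mul_of_nonneg_left ?_ (by positivity)
    calc (18 : ℝ) ≤ (2 ^ (2 * 1)) ^ 3 := by norm_num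
      _ ≤ _ := by gcongr; norm_num
  · intro U hU x
    exact sum_indKer_le hco (fun _ => abs_nonneg _) (hκ U hU) x
  · intro W hW x
    refine (abs_sum_indKer_sub_one_le hco hLpos W x).trans ?_
    refine div_le_div_of_nonneg_right (Nat.cast_le.2 ?_) hLr.le
    rw [hM] at hW
    calc ∏ i ∈ W, n i ≤ Z ^ W.card := Finset.prod_le_pow_card _ _ _ fun i _ => hZ i
        _ ≤ _ := Nat.pow_le_pow_right hZ1 (hW.trans (by apply le_of_eq; ring))
  · exact_mod_cast card_filter_card_le_pow ι m
  · rw [hM, div_mul_eq_mul_div, div_le_one hLr]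
    have : 2 * (2 * m) = 4 * m := by ring
    rw [this]
    exact_mod_cast hL
  · have : (2 : ℝ) ^ 10 ≤ 2 ^ (64 * m ^ 2) := by
      refine pow_le_pow_right₀ (by norm_num) ?_
      nlinarith
    have h2 : 0 < α ^ 2 := by positivity
    nlinarith
  · have h := level_numeric hm hα
    have h1 : 2 * (2 * t) + 3 = 4 * m - 1 := by omega
    rw [hM, h1]
    exact h
end

/-- The primes between `w` and `Q`. -/
abbrev LargePrime (w Q : ℕ) : Type :=
  {p : ℕ // p ∈ (Finset.range (Q + 1)).filter fun p => p.Prime ∧ w < p}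

section
variable {w Q J : ℕ}

theorem LargePrime.prime (p : LargePrime w Q) : p.1.Prime := (Finset.mem_filter.1 p.2).2.1

theorem LargePrime.lt (p : LargePrime w Q) : w < p.1 := (Finset.mem_filter.1 p.2).2.2

theorem LargePrime.le (p : LargePrime w Q) : p.1 ≤ Q :=
  Nat.lt_succ_iff.1 (Finset.mem_range.1 (Finset.mem_filter.1 p.2).1)

instance (p : LargePrime w Q) : NeZero (p.1 ^ J) := ⟨pow_ne_zero _ p.prime.ne_zero⟩

theorem LargePrime.coprime (J : ℕ) :
    Pairwise (Function.onFun Nat.Coprime fun p : LargePrime w Q => p.1 ^ J) := fun p p' h =>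
  Nat.Coprime.pow _ _ ((Nat.coprime_primes p.prime p'.prime).2 fun h' => h (Subtype.ext h'))

theorem lt_of_prime_dvd_div_gcd {q p : ℕ} (hq : 1 ≤ q) (hqJ : q ≤ 2 ^ J) (hp : p.Prime)
    (hpq : p ∣ q / q.gcd (w.factorial ^ J)) : w < p := by
  by_contra! hpw
  have hD0 : w.factorial ^ J ≠ 0 := pow_ne_zero _ (Nat.factorial_ne_zero _)
  have hdvd : p ^ q.factorization p ∣ q.gcd (w.factorial ^ J) := by
    refine Nat.dvd_gcd (Nat.ordProj_dvd q p) ?_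
    have h1 : q.factorization p ≤ J := by
      have h2 : p ^ q.factorization p ≤ q := Nat.ordProj_le p (by omega)
      have h3 : 2 ^ q.factorization p ≤ p ^ q.factorization p := Nat.pow_le_pow_left hp.two_le _
      exact (Nat.pow_le_pow_iff_right (by norm_num)).1 (h3.trans (h2.trans hqJ))
    exact (pow_dvd_pow p h1).trans (pow_dvd_pow_of_dvd ((Nat.Prime.dvd_factorial hp).2 hpw) J)
  have h4 : p ^ (q.factorization p + 1) ∣ q := by
    have := Nat.mul_dvd_mul hdvd hpq
    rwa [Nat.mul_div_cancel' (Nat.gcd_dvd_left _ _), ← pow_succ] at this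
  exact Nat.pow_succ_factorization_not_dvd (by omega) hp h4

theorem div_gcd_dvd_prod {q : ℕ} (hq : 1 ≤ q) (hqQ : q ≤ Q) (hQJ : Q ≤ 2 ^ J) :
    q / q.gcd (w.factorial ^ J) ∣ ∏ p : LargePrime w Q, p.1 ^ J := by
  set q' := q / q.gcd (w.factorial ^ J) with hq'
  have hq'q : q' ∣ q := Nat.div_dvd_of_dvd (Nat.gcd_dvd_left _ _)
  have hq'0 : q' ≠ 0 := fun h => by rw [h, zero_dvd_iff] at hq'q; omega
  have hle : q' ≤ q := Nat.le_of_dvd hq hq'q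
  rw [Finset.prod_coe_sort _ fun p => p ^ J]
  conv_lhs => rw [← Nat.prod_factorization_pow_eq_self hq'0]
  rw [Finsupp.prod, Nat.support_factorization]
  refine (Finset.prod_dvd_prod_of_dvd _ (fun p => p ^ J) fun p hp => pow_dvd_pow p ?_).trans
    (Finset.prod_dvd_prod_of_subset _ _ _ fun p hp => ?_)
  · have hpp := Nat.prime_of_mem_primeFactors hp
    have h2 : p ^ q'.factorization p ≤ q' := Nat.ordProj_le p hq'0
    have h3 : 2 ^ q'.factorization p ≤ p ^ q'.factorization p := Nat.pow_le_pow_left hpp.two_le _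
    exact (Nat.pow_le_pow_iff_right (by norm_num)).1 (h3.trans (h2.trans (hle.trans (hqQ.trans hQJ))))
  · have hpp := Nat.prime_of_mem_primeFactors hp
    have hpq := Nat.dvd_of_mem_primeFactors hp
    refine Finset.mem_filter.2 ⟨Finset.mem_range.2 ?_, hpp, lt_of_prime_dvd_div_gcd hq (hqQ.trans hQJ) hpp hpq⟩
    have := Nat.le_of_dvd (Nat.pos_of_ne_zero hq'0) hpq
    omega

/-- A point of the circle close to a fraction with small denominator is approximated, along a
suitable progression, by a character of small support. -/
theorem exists_character_near {m q : ℕ} (hw : 1 ≤ w) (hQw : Q < w ^ (m + 1)) (hQJ : Q ≤ 2 ^ J)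
    (hq : 1 ≤ q) (hqQ : q ≤ Q) {θ ε : ℝ} (hθ : NearInt (q * θ) ε) :
    ∃ χ : AddChar (∀ p : LargePrime w Q, ZMod (p.1 ^ J)) ℂ, (charSupp χ).card ≤ m ∧
      (q ≤ w → χ = 1) ∧ ∀ j : ℕ, ‖ex ((w.factorial ^ J : ℕ) * j * θ) - χ fun p => (j : ZMod (p.1 ^ J))‖ ≤
        8 * ((w.factorial ^ J : ℕ) * j * ε) := by
  obtain ⟨a, ha⟩ := hθ
  have hD0 : w.factorial ^ J ≠ 0 := pow_ne_zero _ (Nat.factorial_ne_zero _)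
  set D := w.factorial ^ J with hD
  set g := q.gcd D with hg
  have hg0 : 0 < g := Nat.gcd_pos_of_pos_left _ hq
  obtain ⟨D', hD'⟩ : g ∣ D := Nat.gcd_dvd_right _ _
  have hgq : g * (q / g) = q := Nat.mul_div_cancel' (Nat.gcd_dvd_left _ _)
  have hq'dvd : q / g ∣ ∏ p : LargePrime w Q, p.1 ^ J := div_gcd_dvd_prod hq hqQ hQJ
  have hprime : ∀ p : ℕ, p.Prime → p ∣ q / g → w < p := fun p hp hpq =>
    lt_of_prime_dvd_div_gcd hq (hqQ.trans hQJ) hp hpq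
  set q' := q / g with hq'
  have hq'0 : 0 < q' := Nat.pos_of_ne_zero fun h => by rw [h, mul_zero] at hgq; omega
  set N0 := ∏ p : LargePrime w Q, p.1 ^ J with hN0
  have : NeZero N0 := ⟨Finset.prod_ne_zero_iff.2 fun p _ => NeZero.ne _⟩
  obtain ⟨u, hu⟩ := hq'dvd
  set b : ℤ := D' * a * u with hb
  let e := ZMod.prodEquivPi (fun p : LargePrime w Q => p.1 ^ J) (LargePrime.coprime J)
  let χ : AddChar (∀ p : LargePrime w Q, ZMod (p.1 ^ J)) ℂ :=
    (AddChar.mulShift ZMod.stdAddChar (b : ZMod N0)).compAddMonoidHom e.symm.toAddMonoidHom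
  have hχ : ∀ y, χ y = ZMod.stdAddChar ((b : ZMod N0) * e.symm y) := fun y => rfl
  have hχq : ∀ y, χ y ^ q' = 1 := by
    intro y
    rw [hχ, ← AddChar.map_nsmul_eq_pow, nsmul_eq_mul, ← mul_assoc]
    have : (q' : ZMod N0) * (b : ZMod N0) = 0 := by
      have h1 : (q' : ZMod N0) * (b : ZMod N0) = (D' * a * (q' * u : ℕ) : ℤ) := by
        rw [hb]; push_cast; ring
      rw [h1, ← hu]; push_cast; simp
    rw [this, zero_mul, AddChar.map_zero_eq_one]
  have hsupp : ∀ p : LargePrime w Q, p ∈ charSupp χ → p.1 ∣ q' := by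
    intro p hp
    by_contra hpq
    have hco : Nat.Coprime (p.1 ^ J) q' := Nat.Coprime.pow_left _ ((Nat.Prime.coprime_iff_not_dvd p.prime).2 hpq)
    obtain ⟨t, ht⟩ := (Finset.mem_filter.1 hp).2
    refine ht ?_
    have h1 : χ (Pi.single p t) ^ (p.1 ^ J) = 1 := by
      rw [← AddChar.map_nsmul_eq_pow, ← Pi.single_smul, nsmul_eq_mul]
      simp
    have h2 := hχq (Pi.single p t)
    have h3 := orderOf_dvd_of_pow_eq_one h1
    have h4 := orderOf_dvd_of_pow_eq_one h2
    exact orderOf_eq_one_iff.1 (Nat.eq_one_of_dvd_coprimes hco h3 h4)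
  refine ⟨χ, ?_, ?_, ?_⟩
  · by_contra! hcard
    have h1 : ∏ p ∈ charSupp χ, p.1 ∣ q' := by
      refine Finset.prod_dvd_of_isRelPrime (fun p _ p' _ h => ?_) hsupp
      exact Nat.coprime_iff_isRelPrime.1
        ((Nat.coprime_primes p.prime p'.prime).2 fun h' => h (Subtype.ext h'))
    have h2 : w ^ (charSupp χ).card ≤ ∏ p ∈ charSupp χ, p.1 :=
      Finset.pow_card_le_prod _ _ _ fun p _ => p.lt.le
    have h3 : w ^ (m + 1) ≤ w ^ (charSupp χ).card := Nat.pow_le_pow_right hw hcard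
    have h4 := Nat.le_of_dvd hq'0 h1
    have h5 : q' ≤ q := by rw [← hgq]; exact Nat.le_mul_of_pos_left _ hg0
    omega
  · intro hqw
    have hq1 : q' = 1 := by
      by_contra h
      obtain ⟨p, hp, hpq⟩ := Nat.exists_prime_and_dvd h
      have h1 := hprime p hp hpq
      have h2 := Nat.le_of_dvd hq'0 hpq
      have h5 : q' ≤ q := by rw [← hgq]; exact Nat.le_mul_of_pos_left _ hg0
      omega
    ext y
    have := hχq y
    rwa [hq1, pow_one] at this
  · intro j
    have h1 : (χ fun p => (j : ZMod (p.1 ^ J))) = ex (D * j * (a / q)) := by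
      rw [hχ]
      have h2 : e.symm (fun p => (j : ZMod (p.1 ^ J))) = (j : ZMod N0) := by
        have : (fun p : LargePrime w Q => (j : ZMod (p.1 ^ J))) =
            ((j : ℕ) : ∀ p : LargePrime w Q, ZMod (p.1 ^ J)) := by ext p; simp
        rw [this, map_natCast]
      have h3 : (b : ZMod N0) * (j : ZMod N0) = ((b * j : ℤ) : ZMod N0) := by push_cast; ring
      rw [h2, h3, ZMod.stdAddChar_coe]
      unfold ex
      congr 1
      have hN0c : (N0 : ℂ) = q' * u := by rw [hu]; push_cast; ring
      have hqc : (q : ℂ) = g * q' := by rw [← hgq]; push_cast; ring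
      have hDc : (D : ℂ) = g * D' := by rw [hD']; push_cast; ring
      have hu0 : (u : ℂ) ≠ 0 := by
        rintro h
        have : u = 0 := by exact_mod_cast h
        rw [this, mul_zero] at hu
        exact NeZero.ne N0 hu
      have hq'c : (q' : ℂ) ≠ 0 := by exact_mod_cast hq'0.ne'
      have hgc : (g : ℂ) ≠ 0 := by exact_mod_cast hg0.ne'
      push_cast
      rw [hN0c, hqc, hDc, hb]
      push_cast
      field_simp
    have hq0 : (0 : ℝ) < q := by exact_mod_cast hq
    have hq1 : (1 : ℝ) ≤ q := by exact_mod_cast hq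
    rw [h1]
    have h2 : ex (D * j * θ) - ex (D * j * (a / q)) =
        ex (D * j * (a / q)) * (ex (D * j * (θ - a / q)) - 1) := by
      rw [mul_sub, ← ex_add, mul_one]; congr 2; ring
    rw [h2, norm_mul, norm_ex, one_mul]
    refine (norm_ex_sub_one_le _).trans ?_
    refine mul_le_mul_of_nonneg_left ?_ (by norm_num)
    rw [abs_mul, abs_of_nonneg (by positivity : (0 : ℝ) ≤ D * j)]
    refine mul_le_mul_of_nonneg_left ?_ (by positivity)
    refine le_trans ?_ ha
    have h3 : (q : ℝ) * θ - a = q * (θ - a / q) := by field_simp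
    rw [h3, abs_mul, abs_of_pos hq0]
    exact le_mul_of_one_le_left (abs_nonneg _) hq1
end

section

open ComplexConjugate

section
variable {P : ℕ} [NeZero P]

theorem abs_balFn_le {N : ℕ} (A : Finset ℕ) (x : ZMod P) :
    |balFn P N A x| ≤ zmodInd P A x + A.card / N := by
  unfold balFn
  have h0 : (0 : ℝ) ≤ A.card / N := by positivity
  have h1 := zmodInd_nonneg A x
  have h2 := zmodInd_nonneg (Finset.range N) x
  have h3 := zmodInd_le_one (Finset.range N) x
  rw [abs_le]
  constructor <;> nlinarith

/-- Correlating with a phase close to that of a frequency preserves the Fourier transform. -/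
theorem norm_sq_zmodFourier_le {L D : ℕ} (hL : 1 ≤ L) (f : ZMod P → ℂ) {c : ℕ → ℂ} {r : ZMod P}
    (hc1 : ∀ j < L, ‖c j‖ = 1) (hc : ∀ j < L,
      ‖(ZMod.stdAddChar (r * ((j : ZMod P) * (D : ZMod P))) : ℂ) - c j‖ ≤ 1 / 2) :
    ‖zmodFourier f r‖ ^ 2 ≤ 4 * ‖zmodFourier (fun x => ∑ j ∈ Finset.range L,
      ((L : ℂ)⁻¹ * conj (c j)) * f (x + (j : ZMod P) * (D : ZMod P))) r‖ ^ 2 := by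
  have hL0 : (0 : ℝ) < L := by exact_mod_cast hL
  have hLc : (L : ℂ) ≠ 0 := by exact_mod_cast hL0.ne'
  rw [zmodFourier_sum_shift (Finset.range L) (fun j => (L : ℂ)⁻¹ * conj (c j))
    (fun j : ℕ => (j : ZMod P) * (D : ZMod P))]
  set M := ∑ j ∈ Finset.range L, (L : ℂ)⁻¹ * conj (c j) *
    (ZMod.stdAddChar (r * ((j : ZMod P) * (D : ZMod P))) : ℂ) with hM
  have h1 : M - 1 = ∑ j ∈ Finset.range L, (L : ℂ)⁻¹ * (conj (c j) *
      ((ZMod.stdAddChar (r * ((j : ZMod P) * (D : ZMod P))) : ℂ) - c j)) := by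
    have h2 : ∀ j ∈ Finset.range L, (L : ℂ)⁻¹ * (conj (c j) *
      ((ZMod.stdAddChar (r * ((j : ZMod P) * (D : ZMod P))) : ℂ) - c j)) = (L : ℂ)⁻¹ * conj (c j) *
    (ZMod.stdAddChar (r * ((j : ZMod P) * (D : ZMod P))) : ℂ) - (L : ℂ)⁻¹ := by
      intro j hj
      have h3 : conj (c j) * c j = 1 := by
        rw [Complex.conj_mul', hc1 j (Finset.mem_range.1 hj)]; norm_num
      rw [mul_sub, h3]; ring
    rw [Finset.sum_congr rfl h2, Finset.sum_sub_distrib, ← hM]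
    simp [hLc]
  have h2 : ‖M - 1‖ ≤ 1 / 2 := by
    rw [h1]
    refine (norm_sum_le _ _).trans ?_
    calc ∑ j ∈ Finset.range L, ‖(L : ℂ)⁻¹ * (conj (c j) *
          ((ZMod.stdAddChar (r * ((j : ZMod P) * (D : ZMod P))) : ℂ) - c j))‖
        ≤ ∑ j ∈ Finset.range L, (L : ℝ)⁻¹ * (1 / 2) := by
          refine Finset.sum_le_sum fun j hj => ?_
          have hj := Finset.mem_range.1 hj
          rw [norm_mul, norm_mul, RCLike.norm_conj, hc1 j hj, one_mul, norm_inv, Complex.norm_natCast]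
          exact mul_le_mul_of_nonneg_left (hc j hj) (by positivity)
      _ = 1 / 2 := by
          rw [Finset.sum_const, Finset.card_range, nsmul_eq_mul]; field_simp
  have h3 : 1 / 2 ≤ ‖M‖ := by
    have := norm_sub_norm_le (1 : ℂ) (1 - M)
    rw [norm_sub_rev 1 M, norm_one, sub_sub_cancel] at this
    linarith
  rw [norm_mul]
  have h4 := norm_nonneg (zmodFourier f r)
  rw [mul_pow]
  have h5 : (1 / 2) ^ 2 ≤ ‖M‖ ^ 2 := by gcongr
  nlinarith [sq_nonneg ‖zmodFourier f r‖]

end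

section
variable {ι : Type} [Fintype ι] [DecidableEq ι] {n : ι → ℕ} [∀ i, NeZero (n i)]

/-- The level inequality applied to a set of integers without a density increment. -/
theorem sum_sum_norm_sq_le {N : ℕ} [NeZero (2 * N)] {A : Finset ℕ}
    (hA1 : (A.card / N : ℝ) ≤ 1) (hco : Pairwise (Function.onFun Nat.Coprime n)) {Z : ℕ} (hZ1 : 1 ≤ Z)
    (hZ : ∀ i, n i ≤ Z) {L m D : ℕ} (hm : 1 ≤ m) (hL1 : 1 ≤ L)
    (hL : Z ^ ((4 * m + 1) * m) * ((Fintype.card ι + 1) ^ m * 2 ^ m) ^ (4 * m) ≤ L)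
    (hα : ((2 : ℝ) ^ (64 * m ^ 3))⁻¹ ≤ A.card / N)
    (hκ : ∀ U : Finset ι, U.card ≤ m → ∀ x : ZMod (2 * N), ((∏ i ∈ U, n i : ℕ) : ℝ) *
      ∑ i ∈ Finset.range (L / (∏ i ∈ U, n i) + 1),
        zmodInd (2 * N) A (x + i * ((D * ∏ i ∈ U, n i : ℕ) : ZMod (2 * N))) ≤ 5 / 2 * (A.card / N) * L)
    (hκ' : ∀ U : Finset ι, U.card ≤ m → 2 * ∏ i ∈ U, n i ≤ L)
    (𝒳 : Finset (AddChar (∀ i, ZMod (n i)) ℂ)) (h𝒳 : ∀ χ ∈ 𝒳, (charSupp χ).card ≤ m) :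
    ∑ χ ∈ 𝒳, ∑ r, ‖zmodFourier (fun x => ∑ j ∈ Finset.range L,
      ((L : ℂ)⁻¹ * conj (χ fun i => (j : ZMod (n i)))) *
        (balFn (2 * N) N A (x + (j : ZMod (2 * N)) * (D : ZMod (2 * N))) : ℂ)) r‖ ^ 2 ≤
      (2 * N) * ((2 * N) * ((A.card / N : ℝ) ^ 2 * 2 ^ (64 * m ^ 2) / 64)) := by
  set α := (A.card / N : ℝ) with hαdef
  have hα0 : 0 ≤ α := by positivity
  have hL0 : (0 : ℝ) < L := by exact_mod_cast hL1
  simp_rw [sum_norm_sq_zmodFourier, ← Finset.mul_sum]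
  rw [Finset.sum_comm]
  push_cast
  refine mul_le_mul_of_nonneg_left ?_ (by positivity)
  have hx : ∀ x : ZMod (2 * N), ∑ χ ∈ 𝒳, ‖∑ j ∈ Finset.range L,
      ((L : ℂ)⁻¹ * conj (χ fun i => (j : ZMod (n i)))) *
        (balFn (2 * N) N A (x + (j : ZMod (2 * N)) * (D : ZMod (2 * N))) : ℂ)‖ ^ 2 ≤
      α ^ 2 * 2 ^ (64 * m ^ 2) / 64 := by
    intro x
    set ν : ℕ → ℝ := fun j => (L : ℝ)⁻¹ * balFn (2 * N) N A (x + (j : ZMod (2 * N)) * (D : ZMod (2 * N))) with hν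
    have h := sum_norm_sq_conj_character_le hco hZ1 hZ hm hL (ν := ν) ?_ hα ?_ 𝒳 h𝒳
    · refine le_trans (le_of_eq ?_) h
      refine Finset.sum_congr rfl fun χ _ => ?_
      congr 2
      refine Finset.sum_congr rfl fun j _ => ?_
      simp only [hν]
      push_cast
      ring
    · intro j
      simp only [hν]
      rw [abs_mul, abs_of_pos (inv_pos.2 hL0)]
      refine mul_le_of_le_one_right (by positivity) ?_
      unfold balFn
      set y := x + (j : ZMod (2 * N)) * (D : ZMod (2 * N))
      have h1 := zmodInd_nonneg A y
      have h2 := zmodInd_nonneg (Finset.range N) y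
      have h3 := zmodInd_le_one (Finset.range N) y
      have h4 := zmodInd_le_one A y
      rw [← hαdef, abs_le]
      constructor <;> nlinarith
    · intro U hU c
      set R := ∏ i ∈ U, n i with hR
      have h1 := hκ U hU (x + (c : ZMod (2 * N)) * (D : ZMod (2 * N)))
      have h2 : ∀ i : ℕ, |ν (c + i * R)| ≤ (L : ℝ)⁻¹ * (zmodInd (2 * N) A ((x + (c : ZMod (2 * N)) * (D : ZMod (2 * N))) +
          i * ((D * R : ℕ) : ZMod (2 * N))) + α) := by
        intro i
        have e : (x + (c : ZMod (2 * N)) * (D : ZMod (2 * N))) + i * ((D * R : ℕ) : ZMod (2 * N)) =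
            x + ((c + i * R : ℕ) : ZMod (2 * N)) * (D : ZMod (2 * N)) := by push_cast; ring
        rw [e]
        simp only [hν]
        rw [abs_mul, abs_of_pos (inv_pos.2 hL0)]
        exact mul_le_mul_of_nonneg_left (abs_balFn_le A _) (by positivity)
      have h3 : (R : ℝ) * (L / R + 1 : ℕ) ≤ 3 / 2 * L := by
        have h4 : R * (L / R) ≤ L := Nat.mul_div_le L R
        have h5 := hκ' U hU
        have h6 : 2 * (R * (L / R + 1)) ≤ 3 * L := by rw [mul_add, mul_one]; omega
        have h7 : (2 : ℝ) * (R * (L / R + 1 : ℕ)) ≤ 3 * L := by exact_mod_cast h6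
        linarith
      calc (R : ℝ) * ∑ i ∈ Finset.range (L / R + 1), |ν (c + i * R)|
          ≤ R * ∑ i ∈ Finset.range (L / R + 1), (L : ℝ)⁻¹ * (zmodInd (2 * N) A
            ((x + (c : ZMod (2 * N)) * (D : ZMod (2 * N))) + i * ((D * R : ℕ) : ZMod (2 * N))) + α) :=
            mul_le_mul_of_nonneg_left (Finset.sum_le_sum fun i _ => h2 i) (by positivity)
        _ = (L : ℝ)⁻¹ * (R * ∑ i ∈ Finset.range (L / R + 1), zmodInd (2 * N) A
            ((x + (c : ZMod (2 * N)) * (D : ZMod (2 * N))) + i * ((D * R : ℕ) : ZMod (2 * N))) +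
            R * (L / R + 1 : ℕ) * α) := by
            rw [← Finset.mul_sum, Finset.sum_add_distrib, Finset.sum_const, Finset.card_range, nsmul_eq_mul]
            ring
        _ ≤ (L : ℝ)⁻¹ * (5 / 2 * α * L + 3 / 2 * L * α) := by
            refine mul_le_mul_of_nonneg_left ?_ (by positivity)
            exact add_le_add h1 (mul_le_mul_of_nonneg_right h3 hα0)
        _ = 4 * α := by field_simp; ring
  refine (Finset.sum_le_sum fun x _ => hx x).trans ?_
  rw [Finset.sum_const, Finset.card_univ, ZMod.card, nsmul_eq_mul]
  push_cast
  exact le_rfl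

theorem correlation_numeric {α β v N X : ℝ} (hα0 : 0 < α) (hα : β ≤ α) (hv : 0 < v) (hN : 0 < N)
    (hX : 0 < X) (h : α ^ 2 * N * X * N ≤ β / 8 * X * (2 * N * (α * N)) +
      (X * (4 * (2 * N * (α ^ 2 * N / 32))) + X / v * (4 * ((2 * N) * ((2 * N) * (α ^ 2 * v / 64)))))) :
    False := by
  have h1 : X / v * (4 * ((2 * N) * ((2 * N) * (α ^ 2 * v / 64)))) = α ^ 2 * N * X * N / 4 := by
    field_simp; ring
  have h2 : β / 8 * X * (2 * N * (α * N)) ≤ α / 8 * X * (2 * N * (α * N)) := by gcongr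
  have h3 : 0 < α ^ 2 * N * X * N := by positivity
  nlinarith

/-- A set of integers cannot satisfy simultaneously: its Fourier transform correlates with that of a
polynomial sequence, the large frequencies of the latter are low-level, and the set has no density
increment on progressions. -/
theorem false_of_fourier_correlation {N X : ℕ} [NeZero (2 * N)] (hN : 1 ≤ N) (hX : 1 ≤ X) {A : Finset ℕ}
    (hA : A ⊆ Finset.range N) (hco : Pairwise (Function.onFun Nat.Coprime n)) {Z : ℕ} (hZ1 : 1 ≤ Z)
    (hZ : ∀ i, n i ≤ Z) {L m D : ℕ} (hm : 1 ≤ m) (hL1 : 1 ≤ L)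
    (hL : Z ^ ((4 * m + 1) * m) * ((Fintype.card ι + 1) ^ m * 2 ^ m) ^ (4 * m) ≤ L)
    (hα : ((2 : ℝ) ^ (64 * m ^ 3))⁻¹ ≤ A.card / N)
    (hκ : ∀ U : Finset ι, U.card ≤ m → ∀ x : ZMod (2 * N), ((∏ i ∈ U, n i : ℕ) : ℝ) *
      ∑ i ∈ Finset.range (L / (∏ i ∈ U, n i) + 1),
        zmodInd (2 * N) A (x + i * ((D * ∏ i ∈ U, n i : ℕ) : ZMod (2 * N))) ≤ 5 / 2 * (A.card / N) * L)
    (hκ' : ∀ U : Finset ι, U.card ≤ m → 2 * ∏ i ∈ U, n i ≤ L)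
    (hDL : 1024 * (D * L) ≤ N)
    (hinc : ∀ x : ZMod (2 * N), ∑ j ∈ Finset.range L,
      zmodInd (2 * N) A (x + (j : ZMod (2 * N)) * (D : ZMod (2 * N))) ≤ (1 + 1 / 256) * (A.card / N : ℝ) * L)
    (b : ℕ → ZMod (2 * N))
    (hcorr : (A.card / N : ℝ) ^ 2 * N * X * N ≤
      ∑ r, ‖zmodFourier (fun x => (balFn (2 * N) N A x : ℂ)) r‖ ^ 2 *
        ‖∑ k ∈ Finset.range X, (ZMod.stdAddChar (r * b k) : ℂ)‖)
    (hmajor : ∀ r, ((2 : ℝ) ^ (64 * m ^ 3))⁻¹ / 8 * X ≤ ‖∑ k ∈ Finset.range X, (ZMod.stdAddChar (r * b k) : ℂ)‖ →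
      ∃ χ : AddChar (∀ i, ZMod (n i)) ℂ, (charSupp χ).card ≤ m ∧
        (X / 2 ^ (64 * m ^ 2) ≤ ‖∑ k ∈ Finset.range X, (ZMod.stdAddChar (r * b k) : ℂ)‖ → χ = 1) ∧
        ∀ j < L, ‖(ZMod.stdAddChar (r * ((j : ZMod (2 * N)) * (D : ZMod (2 * N)))) : ℂ) -
          χ fun i => (j : ZMod (n i))‖ ≤ 1 / 2) : False := by
  classical
  have hN0 : (0 : ℝ) < N := by exact_mod_cast hN
  have hX0 : (0 : ℝ) < X := by exact_mod_cast hX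
  have hL0 : (0 : ℝ) < L := by exact_mod_cast hL1
  have hβ0 : (0 : ℝ) < ((2 : ℝ) ^ (64 * m ^ 3))⁻¹ := by positivity
  set β := ((2 : ℝ) ^ (64 * m ^ 3))⁻¹ with hβ
  have hA1 : (A.card / N : ℝ) ≤ 1 := by
    rw [div_le_one hN0]
    have := Finset.card_le_card hA
    rw [Finset.card_range] at this
    exact_mod_cast this
  have hlevel := sum_sum_norm_sq_le hA1 hco hZ1 hZ hm hL1 hL hα hκ hκ'
  have hsmooth := sum_smoothed_sq_le hN hA hL1 hDL hinc
  have hsq := sum_balFn_sq_le hN (by omega : N ≤ 2 * N) hA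
  set α := (A.card / N : ℝ) with hαdef
  have hα0 : 0 < α := hβ0.trans_le hα
  have hAα : (A.card : ℝ) = α * N := by rw [hαdef]; field_simp
  set F : ZMod (2 * N) → ℝ := fun r => ‖zmodFourier (fun x => (balFn (2 * N) N A x : ℂ)) r‖ ^ 2 with hF
  set S : ZMod (2 * N) → ℝ := fun r => ‖∑ k ∈ Finset.range X, (ZMod.stdAddChar (r * b k) : ℂ)‖ with hS
  set v : ℝ := 2 ^ (64 * m ^ 2) with hv
  have hv0 : 0 < v := by positivity
  have hF0 : ∀ r, 0 ≤ F r := fun r => by positivity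
  have hS0 : ∀ r, 0 ≤ S r := fun r => norm_nonneg _
  have hSX : ∀ r, S r ≤ X := fun r => by
    refine (norm_sum_le _ _).trans ?_
    simp
  have hFsum : ∑ r, F r ≤ 2 * N * (α * N) := by
    simp only [hF]
    rw [sum_norm_sq_zmodFourier]
    simp only [Complex.norm_real, Real.norm_eq_abs, sq_abs]
    rw [← hAα]
    push_cast
    exact mul_le_mul_of_nonneg_left hsq (by positivity)
  have hch : ∀ r, ∃ χ : AddChar (∀ i, ZMod (n i)) ℂ, β / 8 * X ≤ S r → (charSupp χ).card ≤ m ∧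
        (X / v ≤ S r → χ = 1) ∧
        ∀ j < L, ‖(ZMod.stdAddChar (r * ((j : ZMod (2 * N)) * (D : ZMod (2 * N)))) : ℂ) -
          χ fun i => (j : ZMod (n i))‖ ≤ 1 / 2 := by
    intro r
    by_cases h : β / 8 * X ≤ S r
    · obtain ⟨χ, hχ⟩ := hmajor r h
      exact ⟨χ, fun _ => hχ⟩
    · exact ⟨1, fun h' => absurd h' h⟩
  choose χ hχ using hch
  set maj := Finset.univ.filter fun r => β / 8 * X ≤ S r with hmaj
  set G : AddChar (∀ i, ZMod (n i)) ℂ → ZMod (2 * N) → ℝ := fun ψ r =>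
    ‖zmodFourier (fun x => ∑ j ∈ Finset.range L, ((L : ℂ)⁻¹ * conj (ψ fun i => (j : ZMod (n i)))) *
        (balFn (2 * N) N A (x + (j : ZMod (2 * N)) * (D : ZMod (2 * N))) : ℂ)) r‖ ^ 2 with hG
  have hG0 : ∀ ψ r, 0 ≤ G ψ r := fun ψ r => by positivity
  have hFG : ∀ r ∈ maj, F r ≤ 4 * G (χ r) r := by
    intro r hr
    have hr := (Finset.mem_filter.1 hr).2
    exact norm_sq_zmodFourier_le hL1 (fun x => (balFn (2 * N) N A x : ℂ))
      (c := fun j => χ r fun i => (j : ZMod (n i))) (fun j _ => AddChar.norm_apply _ _) (hχ r hr).2.2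
  set 𝒳 := (maj.image χ).erase 1 with h𝒳
  have h𝒳c : ∀ ψ ∈ 𝒳, (charSupp ψ).card ≤ m := by
    intro ψ hψ
    obtain ⟨r, hr, rfl⟩ := Finset.mem_image.1 (Finset.mem_of_mem_erase hψ)
    exact (hχ r (Finset.mem_filter.1 hr).2).1
  have hminor : ∑ r ∈ majᶜ, F r * S r ≤ β / 8 * X * (2 * N * (α * N)) := by
    calc ∑ r ∈ majᶜ, F r * S r ≤ ∑ r ∈ majᶜ, F r * (β / 8 * X) := by
          refine Finset.sum_le_sum fun r hr => mul_le_mul_of_nonneg_left ?_ (hF0 r)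
          rw [Finset.mem_compl, hmaj, Finset.mem_filter, not_and] at hr
          exact (not_le.1 (hr (Finset.mem_univ _))).le
      _ = β / 8 * X * ∑ r ∈ majᶜ, F r := by rw [← Finset.sum_mul]; ring
      _ ≤ _ := by
          refine mul_le_mul_of_nonneg_left (le_trans ?_ hFsum) (by positivity)
          exact Finset.sum_le_univ_sum_of_nonneg hF0
  have htriv : ∑ r ∈ maj.filter fun r => χ r = 1, F r * S r ≤ X * (4 * (2 * N * (α ^ 2 * N / 32))) := by
    calc ∑ r ∈ maj.filter fun r => χ r = 1, F r * S r
        ≤ ∑ r ∈ maj.filter fun r => χ r = 1, 4 * G 1 r * X := by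
          refine Finset.sum_le_sum fun r hr => ?_
          obtain ⟨hr, hr1⟩ := Finset.mem_filter.1 hr
          have := hFG r hr
          rw [hr1] at this
          exact mul_le_mul this (hSX r) (hS0 r) (by have := hG0 1 r; positivity)
      _ = X * (4 * ∑ r ∈ maj.filter fun r => χ r = 1, G 1 r) := by
          rw [← Finset.sum_mul, ← Finset.mul_sum]; ring
      _ ≤ X * (4 * ∑ r, G 1 r) := by
          gcongr
          exact Finset.subset_univ _
      _ ≤ _ := by
          gcongr
          simp only [hG]
          rw [sum_norm_sq_zmodFourier]
          push_cast
          refine mul_le_mul_of_nonneg_left ?_ (by positivity)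
          refine le_trans (le_of_eq ?_) hsmooth
          refine Finset.sum_congr rfl fun x _ => ?_
          rw [← sq_abs (_ * _), ← Real.norm_eq_abs, ← Complex.norm_real]
          congr 2
          push_cast
          rw [Finset.mul_sum]
          refine Finset.sum_congr rfl fun j _ => ?_
          change (L : ℂ)⁻¹ * conj (1 : ℂ) * _ = _
          rw [map_one, mul_one]
  have hnon : ∑ r ∈ maj.filter fun r => ¬ χ r = 1, F r * S r ≤
      X / v * (4 * ((2 * N) * ((2 * N) * (α ^ 2 * v / 64)))) := by
    calc ∑ r ∈ maj.filter fun r => ¬ χ r = 1, F r * S r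
        ≤ ∑ r ∈ maj.filter fun r => ¬ χ r = 1, 4 * G (χ r) r * (X / v) := by
          refine Finset.sum_le_sum fun r hr => ?_
          obtain ⟨hr, hr1⟩ := Finset.mem_filter.1 hr
          refine mul_le_mul (hFG r hr) ?_ (hS0 r) (by have := hG0 (χ r) r; positivity)
          by_contra! hlt
          exact hr1 ((hχ r (Finset.mem_filter.1 hr).2).2.1 hlt.le)
      _ = X / v * (4 * ∑ r ∈ maj.filter fun r => ¬ χ r = 1, G (χ r) r) := by
          rw [← Finset.sum_mul, ← Finset.mul_sum]; ring
      _ ≤ X / v * (4 * ∑ ψ ∈ 𝒳, ∑ r, G ψ r) := by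
          gcongr
          rw [← Finset.sum_fiberwise_of_maps_to (g := χ) (t := 𝒳)]
          · refine Finset.sum_le_sum fun ψ _ => ?_
            calc ∑ r ∈ (maj.filter fun r => ¬ χ r = 1) with χ r = ψ, G (χ r) r
                = ∑ r ∈ (maj.filter fun r => ¬ χ r = 1) with χ r = ψ, G ψ r :=
                  Finset.sum_congr rfl fun r hr => by rw [(Finset.mem_filter.1 hr).2]
              _ ≤ _ := Finset.sum_le_univ_sum_of_nonneg (hG0 ψ)
          · intro r hr
            obtain ⟨hr, hr1⟩ := Finset.mem_filter.1 hr
            exact Finset.mem_erase.2 ⟨hr1, Finset.mem_image_of_mem _ hr⟩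
      _ ≤ _ := by
          gcongr
          exact hlevel 𝒳 h𝒳c
  have htotal : ∑ r, F r * S r = ∑ r ∈ majᶜ, F r * S r + (∑ r ∈ maj.filter fun r => χ r = 1, F r * S r +
      ∑ r ∈ maj.filter fun r => ¬ χ r = 1, F r * S r) := by
    rw [Finset.sum_filter_add_sum_filter_not, add_comm, Finset.sum_add_sum_compl]
  exact correlation_numeric hα0 hα hv0 hN0 hX0
    (hcorr.trans (htotal.le.trans (add_le_add hminor (add_le_add htriv hnon))))
end

end

section

open Polynomial

/-- The lower bounds required of the parameter `B` in one step of the density increment. -/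
structure Dominates (k H C m B : ℕ) : Prop where
  modulus : (2 ^ (64 * m ^ 2 * C)).factorial ^ (C * (64 * m ^ 3 + 3)) *
    (2 ^ (C * (64 * m ^ 3 + 3) * (C * (64 * m ^ 3 + 3)))) ^ m ≤ B
  length : (2 ^ (C * (64 * m ^ 3 + 3) * (C * (64 * m ^ 3 + 3)))) ^ ((4 * m + 1) * m) *
    ((2 ^ (C * (64 * m ^ 3 + 3)) + 2) ^ m * 2 ^ m) ^ (4 * m) ≤ B
  density : 2 ^ (64 * m ^ 3 + 10) ≤ B
  denominator : 2 ^ (C * (64 * m ^ 3 + 3)) ≤ B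
  coeff : 16 * (k + 1) * (H + 1) ≤ B
  degree : 2 ^ k ≤ B

theorem Polynomial.abs_eval_natCast_le {q : ℤ[X]} {k : ℕ} {c : ℤ} (hdeg : q.natDegree = k)
    (hc : ∀ j, |q.coeff j| ≤ c) {n X : ℕ} (hX : 1 ≤ X) (hn : n ≤ X) :
    |q.eval (n : ℤ)| ≤ (k + 1) * (c * X ^ k) := by
  rw [eval_eq_sum_range, hdeg]
  refine (Finset.abs_sum_le_sum_abs _ _).trans ?_
  have hc0 : 0 ≤ c := (abs_nonneg _).trans (hc 0)
  calc ∑ j ∈ Finset.range (k + 1), |q.coeff j * (n : ℤ) ^ j|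
      ≤ ∑ j ∈ Finset.range (k + 1), c * (X : ℤ) ^ k := by
        refine Finset.sum_le_sum fun j hj => ?_
        rw [abs_mul, abs_pow, Nat.abs_cast]
        have h1 : (n : ℤ) ^ j ≤ (X : ℤ) ^ k := by
          calc (n : ℤ) ^ j ≤ (X : ℤ) ^ j := by gcongr
            _ ≤ _ := pow_le_pow_right₀ (by exact_mod_cast hX) (by have := Finset.mem_range.1 hj; omega)
        exact mul_le_mul (hc j) h1 (by positivity) hc0
    _ = _ := by rw [Finset.sum_const, Finset.card_range, nsmul_eq_mul]; push_cast; ring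

theorem exists_pow_mul_le_lt {k M N : ℕ} (hk : 1 ≤ k) (hM : 1 ≤ M) (hMN : M ≤ N) :
    ∃ X : ℕ, 1 ≤ X ∧ X ^ k * M ≤ N ∧ N < 2 ^ k * (X ^ k * M) := by
  have h1 : (1 : ℕ) ^ k * M ≤ N := by simpa using hMN
  have hN : 1 ≤ N := hM.trans hMN
  refine ⟨Nat.findGreatest (fun X => X ^ k * M ≤ N) N, Nat.le_findGreatest hN h1,
    Nat.findGreatest_spec (P := fun X => X ^ k * M ≤ N) hN h1, ?_⟩
  set X := Nat.findGreatest (fun X => X ^ k * M ≤ N) N with hX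
  have hX1 : 1 ≤ X := Nat.le_findGreatest hN h1
  have h2 : N < (X + 1) ^ k * M := by
    by_contra! h
    have h3 : X + 1 ≤ N := (Nat.le_self_pow (by omega) _).trans ((Nat.le_mul_of_pos_right _ hM).trans h)
    exact Nat.findGreatest_is_greatest (P := fun X => X ^ k * M ≤ N) (Nat.lt_succ_self _) h3 h
  calc N < (X + 1) ^ k * M := h2
    _ ≤ (2 * X) ^ k * M := by gcongr; omega
    _ = _ := by ring

theorem stdAddChar_mul_intCast {P : ℕ} [NeZero P] (r : ZMod P) (b : ℤ) :
    (ZMod.stdAddChar (r * (b : ZMod P)) : ℂ) = ex ((r.val / P : ℝ) * b) := by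
  have : r * (b : ZMod P) = ((r.val * b : ℤ) : ZMod P) := by
    push_cast; rw [ZMod.natCast_zmod_val]
  rw [this, ZMod.stdAddChar_coe]
  unfold ex
  congr 1
  push_cast
  ring

theorem inv_mul_le_inv_of_mul_le {t b : ℝ} (ht : 0 < t) (h : t * 1024 ≤ b) : b⁻¹ * 1024 ≤ t⁻¹ := by
  have hb : 0 < b := by linarith
  rw [inv_mul_le_iff₀ hb, le_mul_inv_iff₀ ht]
  linarith

theorem prod_mul_sum_numeric {P B L : ℕ} {α s : ℝ} (hP1 : 1 ≤ P) (hPB : P ≤ B) (hB : 1024 ≤ B)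
    (hBB : B * B ≤ L) (hα : 0 ≤ α)
    (hs : s ≤ (1 + 1 / 512) * α * ((L / P + 1 : ℕ) + L / (B * B))) :
    (P : ℝ) * s ≤ 5 / 2 * α * L := by
  have hB0 : (0 : ℝ) < B := by exact_mod_cast (by omega : 0 < B)
  have h1 : ((P * (L / P) : ℕ) : ℝ) ≤ L := Nat.cast_le.2 (Nat.mul_div_le L P)
  rw [Nat.cast_mul] at h1
  have h2 : (P : ℝ) * 1024 ≤ L := by
    have : P * 1024 ≤ L := (Nat.mul_le_mul hPB hB).trans hBB
    exact_mod_cast this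
  have h3 : (P : ℝ) * (L / (B * B)) ≤ L / 1024 := by
    have hPB' : (P : ℝ) ≤ B := Nat.cast_le.2 hPB
    have hB' : (1024 : ℝ) ≤ B := by exact_mod_cast hB
    have hL : (0 : ℝ) ≤ L := Nat.cast_nonneg _
    rw [← mul_div_assoc, div_le_div_iff₀ (by positivity) (by norm_num)]
    nlinarith [mul_le_mul hPB' hB' (by norm_num) hB0.le]
  have h4 : (P : ℝ) * ((L / P + 1 : ℕ) + L / (B * B)) ≤ 2 * L := by
    rw [mul_add, Nat.cast_add, mul_add, Nat.cast_one]
    linarith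
  have h5 := mul_le_mul_of_nonneg_left h4 hα
  calc (P : ℝ) * s ≤ P * ((1 + 1 / 512) * α * ((L / P + 1 : ℕ) + L / (B * B))) := by gcongr
    _ = (1 + 1 / 512) * (α * (P * ((L / P + 1 : ℕ) + L / (B * B)))) := by ring
    _ ≤ (1 + 1 / 512) * (α * (2 * L)) := by gcongr
    _ ≤ 5 / 2 * α * L := by
      have : 0 ≤ α * L := mul_nonneg hα (Nat.cast_nonneg _)
      linarith

theorem progression_numeric {B : ℕ} {α L : ℝ} (hB : 1024 ≤ B) (hα : 0 ≤ α) (hL : 0 ≤ L) :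
    (1 + 1 / 512) * α * (L + L / (B * B)) ≤ (1 + 1 / 256) * α * L := by
  have hB' : (1024 : ℝ) ≤ B := by exact_mod_cast hB
  have h1 : L / (B * B) ≤ L / 1024 := by
    gcongr
    nlinarith
  have h2 : L + L / (B * B) ≤ (1 + 1 / 1024) * L := by linarith
  have h3 := mul_le_mul_of_nonneg_left h2 hα
  have : 0 ≤ α * L := mul_nonneg hα hL
  rw [mul_assoc, mul_assoc]
  linarith

theorem degree_numeric {k H B X : ℕ} {α : ℝ} (hB : 1024 ≤ B) (hk : 16 * (k + 1) * (H + 1) ≤ B)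
    (hα : (B : ℝ)⁻¹ * 1024 ≤ α) (hX : B * B ≤ X) : 8 * (k : ℝ) ≤ 3 * α * X := by
  have hB0 : (0 : ℝ) < B := by exact_mod_cast (by omega : 0 < B)
  have h1 : 1024 ≤ α * B := by
    rw [inv_mul_le_iff₀ hB0] at hα
    linarith
  have h2 : (B * B : ℝ) ≤ X := by exact_mod_cast hX
  have h3 : (k : ℝ) ≤ B := by
    have : k ≤ B := by nlinarith [Nat.zero_le (k * H)]
    exact_mod_cast this
  have hα0 : 0 < α := by
    by_contra! h
    nlinarith
  calc 8 * (k : ℝ) ≤ 3 * 1024 * B := by linarith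
    _ ≤ 3 * (α * B) * B := by gcongr
    _ = 3 * α * (B * B) := by ring
    _ ≤ 3 * α * X := by gcongr

theorem eval_numeric {k H B X d N : ℕ} {α : ℝ} {z : ℤ} (hB : 1024 ≤ B) (hk : 16 * (k + 1) * (H + 1) ≤ B)
    (hα : (B : ℝ)⁻¹ * 1024 ≤ α) (hX : X ^ k * (B ^ 3 * d ^ k) ≤ N)
    (hz : |z| ≤ (k + 1) * ((H : ℤ) * d ^ k * X ^ k)) : |(z : ℝ)| ≤ α * N / 16 := by
  have hB0 : (0 : ℝ) < B := by exact_mod_cast (by omega : 0 < B)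
  have h1 : 1024 ≤ α * B := by
    rw [inv_mul_le_iff₀ hB0] at hα
    linarith
  have h2 : |(z : ℝ)| ≤ (k + 1) * ((H : ℝ) * d ^ k * X ^ k) := by exact_mod_cast hz
  have h3 : ((X : ℝ) ^ k * (B ^ 3 * d ^ k)) ≤ N := by exact_mod_cast hX
  have h4 : ((16 : ℝ) * (k + 1) * (H + 1)) ≤ B := by exact_mod_cast hk
  have h5 : (1 : ℝ) ≤ B := by exact_mod_cast (by omega : 1 ≤ B)
  have hα0 : 0 < α := by
    by_contra! h
    nlinarith
  have hW : (0 : ℝ) ≤ d ^ k * X ^ k := by positivity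
  set W : ℝ := d ^ k * X ^ k
  have hkH : (k + 1 : ℝ) * H ≤ B / 16 := by
    have : (0 : ℝ) ≤ k := by positivity
    linarith
  calc |(z : ℝ)| ≤ (k + 1) * H * W := by rw [mul_assoc, ← mul_assoc (H : ℝ)]; exact h2
    _ ≤ B / 16 * W := by gcongr
    _ ≤ (α * B) * B ^ 2 * W / 16 := by
      have : (B : ℝ) ≤ α * B * B ^ 2 := by nlinarith [sq_nonneg (B : ℝ)]
      have := mul_le_mul_of_nonneg_right this hW
      linarith
    _ = α * (X ^ k * (B ^ 3 * d ^ k)) / 16 := by ring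
    _ ≤ α * N / 16 := by gcongr

section
variable {k H C m B d N : ℕ} {q : ℤ[X]} {lam : ℕ → ℕ} {A : Finset ℕ} [NeZero (2 * N)]

/-- Without a density increment, a set has few points on long progressions. -/
theorem sum_zmodInd_progression_le {N' : ℕ} (hN' : 1 ≤ N')
    (hlam : ∀ d, 1 ≤ d → 1 ≤ lam d ∧ lam d ≤ d ^ k ∧ d ∣ lam d)
    (hinc : ∀ D, 1 ≤ D → D ≤ B → ∀ x : ZMod (2 * N), ∑ j ∈ Finset.range N',
      zmodInd (2 * N) A (x + (lam D * j : ℕ)) ≤ (1 + 1 / 512) * (A.card / N) * N') {D : ℕ} (hD1 : 1 ≤ D)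
    (hDB : D ≤ B) (x : ZMod (2 * N)) (l : ℕ) :
    ∑ i ∈ Finset.range l, zmodInd (2 * N) A (x + i * (D : ZMod (2 * N))) ≤
      (1 + 1 / 512) * (A.card / N) * (l + B ^ k * N') := by
  obtain ⟨-, hle, s, hs⟩ := hlam D hD1
  have hsB : s ≤ B ^ k := calc
    s ≤ D * s := Nat.le_mul_of_pos_left _ hD1
    _ ≤ D ^ k := by rw [← hs]; exact hle
    _ ≤ B ^ k := Nat.pow_le_pow_left hDB k
  refine (sum_progression_le (zmodInd (2 * N) A) (zmodInd_nonneg A) (D : ZMod (2 * N)) s N' hN'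
    ((1 + 1 / 512) * (A.card / N))
    (fun x => ?_) x l).trans ?_
  · have h := hinc D hD1 hDB x
    refine le_trans (le_of_eq ?_) h
    refine Finset.sum_congr rfl fun j _ => ?_
    rw [hs]
    congr 2
    push_cast
    ring
  · have : (s : ℝ) ≤ B ^ k := by exact_mod_cast hsB
    gcongr

/-- Frequencies with large exponential sums are governed by characters of small support. -/
theorem exists_character_of_large_sum {P : ℕ} [NeZero P] (hC : 1 ≤ C) (hm : 1 ≤ m) {w J Q : ℕ} (hw : w = 2 ^ (64 * m ^ 2 * C))
    (hJ : J = C * (64 * m ^ 3 + 3)) (hQ : Q = 2 ^ J) (hd : 1 ≤ d)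
    (hW : ∀ T : ℝ, 2 ≤ T → ∀ X : ℕ, (T * d) ^ C ≤ X → ∀ θ : ℝ,
        X / T ≤ ‖∑ n ∈ Finset.range X, ex (θ * (q.eval (n : ℤ) : ℤ))‖ →
        ∃ Q : ℕ, 1 ≤ Q ∧ (Q : ℝ) ≤ T ^ C ∧ NearInt (Q * θ) (T ^ C / X ^ k))
    {X L : ℕ} (hX1 : 1 ≤ X) (hX : (2 ^ (64 * m ^ 3 + 3) * d) ^ C ≤ X)
    (hL : 16 * (w.factorial ^ J * L * Q) ≤ X ^ k) (r : ZMod P)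
    (hr : ((2 : ℝ) ^ (64 * m ^ 3))⁻¹ / 8 * X ≤
      ‖∑ n ∈ Finset.range X, (ZMod.stdAddChar (r * ((q.eval (n : ℤ) : ℤ) : ZMod P)) : ℂ)‖) :
    ∃ χ : AddChar (∀ p : LargePrime w Q, ZMod (p.1 ^ J)) ℂ, (charSupp χ).card ≤ m ∧
      (X / 2 ^ (64 * m ^ 2) ≤
        ‖∑ n ∈ Finset.range X, (ZMod.stdAddChar (r * ((q.eval (n : ℤ) : ℤ) : ZMod P)) : ℂ)‖ → χ = 1) ∧
      ∀ j < L, ‖(ZMod.stdAddChar (r * ((j : ZMod P) * ((w.factorial ^ J : ℕ) : ZMod P))) : ℂ) -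
        χ fun p => (j : ZMod (p.1 ^ J))‖ ≤ 1 / 2 := by
  have hm23 : m ^ 2 ≤ m ^ 3 := Nat.pow_le_pow_right hm (by norm_num)
  have hm1 : 1 ≤ m ^ 2 := Nat.one_le_pow _ _ hm
  set θ : ℝ := (r.val / P : ℝ) with hθ
  have hsum : ∑ n ∈ Finset.range X, (ZMod.stdAddChar (r * ((q.eval (n : ℤ) : ℤ) : ZMod P)) : ℂ) =
      ∑ n ∈ Finset.range X, ex (θ * (q.eval (n : ℤ) : ℤ)) :=
    Finset.sum_congr rfl fun n _ => stdAddChar_mul_intCast r _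
  rw [hsum] at hr ⊢
  have key : ∀ t : ℕ, 1 ≤ t → t ≤ 64 * m ^ 3 + 3 →
      X / (2 : ℝ) ^ t ≤ ‖∑ n ∈ Finset.range X, ex (θ * (q.eval (n : ℤ) : ℤ))‖ →
      ∃ q1 : ℕ, 1 ≤ q1 ∧ q1 ≤ 2 ^ (t * C) ∧ NearInt (q1 * θ) (Q / X ^ k) := by
    intro t ht1 ht h
    obtain ⟨q1, h1, h2, a, ha⟩ := hW (2 ^ t) (by
        calc (2 : ℝ) = 2 ^ 1 := by norm_num
          _ ≤ 2 ^ t := pow_le_pow_right₀ (by norm_num) ht1) X (by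
        calc ((2 : ℝ) ^ t * d) ^ C ≤ (2 ^ (64 * m ^ 3 + 3) * d) ^ C := by
              have := pow_le_pow_right₀ (by norm_num : (1 : ℝ) ≤ 2) ht
              gcongr
          _ ≤ X := by exact_mod_cast hX) θ h
    refine ⟨q1, h1, ?_, a, ha.trans ?_⟩
    · rw [← pow_mul] at h2
      exact_mod_cast h2
    · have : ((2 : ℝ) ^ t) ^ C ≤ Q := by
        rw [hQ, hJ, ← pow_mul]
        push_cast
        exact pow_le_pow_right₀ (by norm_num) (by rw [mul_comm]; exact Nat.mul_le_mul_left _ ht)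
      gcongr
  have hQw : Q < w ^ (m + 1) := by
    rw [hQ, hw, hJ, ← pow_mul]
    refine Nat.pow_lt_pow_right (by norm_num) ?_
    calc C * (64 * m ^ 3 + 3) < C * (64 * m ^ 3 + 64 * m ^ 2) := by
          refine Nat.mul_lt_mul_of_pos_left ?_ hC
          omega
      _ = _ := by ring
  have hw1 : 1 ≤ w := by rw [hw]; exact Nat.one_le_two_pow
  have herr : ∀ j < L, 8 * (((w.factorial ^ J : ℕ) : ℝ) * j * (Q / X ^ k)) ≤ 1 / 2 := by
    intro j hj
    have hXk : (0 : ℝ) < X ^ k := by positivity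
    have h1 : ((16 * (w.factorial ^ J * L * Q) : ℕ) : ℝ) ≤ ((X ^ k : ℕ) : ℝ) := Nat.cast_le.2 hL
    rw [Nat.cast_mul, Nat.cast_mul, Nat.cast_mul, Nat.cast_pow X] at h1
    have h2 : ((w.factorial ^ J : ℕ) : ℝ) * j * Q ≤ ((w.factorial ^ J : ℕ) : ℝ) * L * Q := by
      have : (j : ℝ) ≤ L := by exact_mod_cast hj.le
      gcongr
    rw [← mul_div_assoc, ← mul_div_assoc, div_le_iff₀ hXk]
    norm_num at h1 h2 ⊢
    linarith
  have hval : ∀ j : ℕ, (ZMod.stdAddChar (r * ((j : ZMod P) * ((w.factorial ^ J : ℕ) : ZMod P))) : ℂ) =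
      ex ((w.factorial ^ J : ℕ) * j * θ) := by
    intro j
    have : (j : ZMod P) * ((w.factorial ^ J : ℕ) : ZMod P) = ((j * (w.factorial ^ J : ℕ) : ℤ) : ZMod P) := by
      rw [Int.cast_mul, Int.cast_natCast, Int.cast_natCast]
    rw [this, stdAddChar_mul_intCast]
    congr 1
    rw [Int.cast_mul, Int.cast_natCast, Int.cast_natCast, hθ]
    ring
  have hQJ : Q ≤ 2 ^ J := hQ.le
  by_cases hbig : X / (2 : ℝ) ^ (64 * m ^ 2) ≤ ‖∑ n ∈ Finset.range X, ex (θ * (q.eval (n : ℤ) : ℤ))‖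
  · obtain ⟨q1, h1, h2, h3⟩ := key (64 * m ^ 2) (by omega) (by omega) hbig
    rw [← hw] at h2
    have hwQ : w ≤ Q := by
      rw [hw, hQ, hJ]
      refine Nat.pow_le_pow_right (by norm_num) ?_
      rw [mul_comm]
      exact Nat.mul_le_mul_left _ (by omega)
    obtain ⟨χ, hχ1, hχ2, hχ3⟩ := exists_character_near (J := J) hw1 hQw hQJ h1 (h2.trans hwQ) h3
    refine ⟨χ, hχ1, fun _ => hχ2 h2, fun j hj => ?_⟩
    rw [hval]
    exact (hχ3 j).trans (herr j hj)
  · obtain ⟨q1, h1, h2, h3⟩ := key (64 * m ^ 3 + 3) (by omega) le_rfl (by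
      refine le_trans (le_of_eq ?_) hr
      rw [pow_add]
      norm_num
      ring)
    have hq1 : q1 ≤ Q := by rw [hQ, hJ, mul_comm]; exact h2
    obtain ⟨χ, hχ1, -, hχ3⟩ := exists_character_near (J := J) hw1 hQw hQJ h1 hq1 h3
    refine ⟨χ, hχ1, fun h => absurd h hbig, fun j hj => ?_⟩
    rw [hval]
    exact (hχ3 j).trans (herr j hj)

set_option maxHeartbeats 1000000 in
/-- The density increment step. -/
theorem exists_density_increment (hk : 1 ≤ k) (hC : 1 ≤ C) (hm : 1 ≤ m) (hB : Dominates k H C m B) {E : ℕ}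
    (hE1 : k + 9 ≤ E) (hE2 : k * (C + 3) + 4 ≤ 2 * E)
    (hlam : ∀ d, 1 ≤ d → 1 ≤ lam d ∧ lam d ≤ d ^ k ∧ d ∣ lam d) (hd : 1 ≤ d)
    (hdeg : q.natDegree = k) (hcoef : ∀ j, |q.coeff j| ≤ (H : ℤ) * d ^ k)
    (hW : ∀ T : ℝ, 2 ≤ T → ∀ X : ℕ, (T * d) ^ C ≤ X → ∀ θ : ℝ,
        X / T ≤ ‖∑ n ∈ Finset.range X, ex (θ * (q.eval (n : ℤ) : ℤ))‖ →
        ∃ Q : ℕ, 1 ≤ Q ∧ (Q : ℝ) ≤ T ^ C ∧ NearInt (Q * θ) (T ^ C / X ^ k))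
    (hN : (B * d) ^ (2 * E) ≤ N) (hA : A ⊆ Finset.range N)
    (hα : ((2 : ℝ) ^ (64 * m ^ 3))⁻¹ ≤ A.card / N)
    (hdiff : ∀ a ∈ A, ∀ a' ∈ A, ∀ n : ℕ, (a : ℤ) - a' = q.eval (n : ℤ) → a = a') :
    ∃ D, 1 ≤ D ∧ D ≤ B ∧ ∃ x : ZMod (2 * N),
      (1 + 1 / 512) * (A.card / N) * (N / (B * d) ^ E : ℕ) < ∑ j ∈ Finset.range (N / (B * d) ^ E),
        zmodInd (2 * N) A (x + (lam D * j : ℕ)) := by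
  by_contra! hinc
  have hB1024 : 1024 ≤ B := by
    refine le_trans ?_ hB.density
    calc 1024 = 2 ^ 10 := by norm_num
      _ ≤ _ := Nat.pow_le_pow_right (by norm_num) (by omega)
  have hBd : 1 ≤ B * d := by nlinarith
  set N' := N / (B * d) ^ E with hN'def
  have hpowE : 0 < (B * d) ^ E := Nat.pow_pos hBd
  have hN'1 : 1 ≤ N' := by
    rw [hN'def, Nat.one_le_div_iff hpowE]
    exact (Nat.pow_le_pow_right hBd (by omega)).trans hN
  have hN'N : N' * (B * d) ^ E ≤ N := Nat.div_mul_le_self _ _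
  have hBE : B ^ (k + 9) * d ^ k ≤ (B * d) ^ E := by
    calc B ^ (k + 9) * d ^ k ≤ B ^ E * d ^ E := by
          refine Nat.mul_le_mul (Nat.pow_le_pow_right (by omega) hE1) (Nat.pow_le_pow_right hd (by omega))
      _ = _ := (mul_pow _ _ _).symm
  have hN1 : 1 ≤ N := (Nat.pow_pos hBd).trans_le hN
  obtain ⟨X, hX1, hXN, hNX⟩ : ∃ X : ℕ, 1 ≤ X ∧ X ^ k * (B ^ 3 * d ^ k) ≤ N ∧ N < 2 ^ k * (X ^ k * (B ^ 3 * d ^ k)) := by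
    refine exists_pow_mul_le_lt hk (by have := Nat.pow_pos (n := 3) (by omega : 0 < B); have := Nat.pow_pos (n := k) hd; nlinarith) ?_
    calc B ^ 3 * d ^ k ≤ B ^ (k + 9) * d ^ k := Nat.mul_le_mul_right _ (Nat.pow_le_pow_right (by omega) (by omega))
      _ ≤ 1 * (B * d) ^ E := by rw [one_mul]; exact hBE
      _ ≤ N' * (B * d) ^ E := Nat.mul_le_mul_right _ hN'1
      _ ≤ N := hN'N
  have hNX' : N < X ^ k * (B ^ 4 * d ^ k) := by
    calc N < 2 ^ k * (X ^ k * (B ^ 3 * d ^ k)) := hNX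
      _ ≤ B * (X ^ k * (B ^ 3 * d ^ k)) := Nat.mul_le_mul_right _ hB.degree
      _ = _ := by ring
  have hXlarge : (B * d) ^ (C + 2) ≤ X := by
    refine (Nat.pow_le_pow_iff_left (by omega : k ≠ 0)).1 ?_
    have h1 : (B * d) ^ (k * (C + 2)) * (B ^ 4 * d ^ k) ≤ (B * d) ^ (2 * E) := by
      calc (B * d) ^ (k * (C + 2)) * (B ^ 4 * d ^ k)
          ≤ (B * d) ^ (k * (C + 2)) * ((B * d) ^ 4 * (B * d) ^ k) := by
            gcongr
            · exact Nat.le_mul_of_pos_right _ hd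
            · exact Nat.le_mul_of_pos_left _ (by omega)
        _ = (B * d) ^ (k * (C + 3) + 4) := by ring
        _ ≤ _ := Nat.pow_le_pow_right hBd hE2
    have h2 : (B * d) ^ (k * (C + 2)) * (B ^ 4 * d ^ k) < X ^ k * (B ^ 4 * d ^ k) :=
      (h1.trans hN).trans_lt hNX'
    rw [← pow_mul, mul_comm (C + 2)]
    exact (Nat.lt_of_mul_lt_mul_right h2).le
  have hXB : B * B ≤ X := by
    calc B * B = B ^ 2 := by ring
      _ ≤ (B * d) ^ 2 := Nat.pow_le_pow_left (Nat.le_mul_of_pos_right _ hd) 2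
      _ ≤ (B * d) ^ (C + 2) := Nat.pow_le_pow_right hBd (by omega)
      _ ≤ X := hXlarge
  have hXk : N' * B ^ (k + 5) ≤ X ^ k := by
    have h1 : N' * B ^ (k + 5) * (B ^ 4 * d ^ k) < X ^ k * (B ^ 4 * d ^ k) := by
      calc N' * B ^ (k + 5) * (B ^ 4 * d ^ k) = N' * (B ^ (k + 9) * d ^ k) := by ring
        _ ≤ N' * (B * d) ^ E := Nat.mul_le_mul_left _ hBE
        _ ≤ N := hN'N
        _ < _ := hNX'
    exact (Nat.lt_of_mul_lt_mul_right h1).le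
  have hB1 : 1 ≤ B := by omega
  set J := C * (64 * m ^ 3 + 3) with hJ
  set w := 2 ^ (64 * m ^ 2 * C) with hw
  set Q := 2 ^ J with hQ
  set Z := 2 ^ (J * J) with hZ
  have hmod : w.factorial ^ J * Z ^ m ≤ B := hB.modulus
  have hlen : Z ^ ((4 * m + 1) * m) * ((Q + 2) ^ m * 2 ^ m) ^ (4 * m) ≤ B := hB.length
  have hQB : Q ≤ B := hB.denominator
  set D := w.factorial ^ J with hD
  set L := N' * B ^ (k + 2) with hL
  have hQZ : Q ^ J = Z := (pow_mul 2 J J).symm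
  have hZ1 : 1 ≤ Z := Nat.one_le_two_pow
  have hD1 : 1 ≤ D := Nat.one_le_pow _ _ (Nat.factorial_pos _)
  have hDB : D ≤ B := (Nat.le_mul_of_pos_right _ (Nat.pow_pos hZ1)).trans hmod
  have hBB : B * B ≤ L := by
    calc B * B = 1 * B ^ 2 := by ring
      _ ≤ N' * B ^ (k + 2) := Nat.mul_le_mul hN'1 (Nat.pow_le_pow_right hB1 (by omega))
  have hprodZ : ∀ U : Finset (LargePrime w Q), U.card ≤ m → ∏ i ∈ U, i.1 ^ J ≤ Z ^ m := by
    intro U hU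
    refine (Finset.prod_le_pow_card _ _ Z fun p _ => ?_).trans (Nat.pow_le_pow_right hZ1 hU)
    calc p.1 ^ J ≤ Q ^ J := Nat.pow_le_pow_left p.le _
      _ = Z := hQZ
  have hprod1 : ∀ U : Finset (LargePrime w Q), 1 ≤ ∏ i ∈ U, i.1 ^ J := fun U =>
    Finset.one_le_prod' fun p _ => Nat.one_le_pow _ _ p.prime.pos
  have hDprod : ∀ U : Finset (LargePrime w Q), U.card ≤ m → D * ∏ i ∈ U, i.1 ^ J ≤ B := fun U hU =>
    (Nat.mul_le_mul_left _ (hprodZ U hU)).trans hmod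
  have hprodB : ∀ U : Finset (LargePrime w Q), U.card ≤ m → ∏ i ∈ U, i.1 ^ J ≤ B := fun U hU =>
    (Nat.le_mul_of_pos_left _ hD1).trans (hDprod U hU)
  have hα0 : (0 : ℝ) ≤ A.card / N := by positivity
  have hBkL : (B : ℝ) ^ k * N' ≤ L / (B * B) := by
    rw [le_div_iff₀ (by positivity)]
    have : B ^ k * N' * (B * B) ≤ L := by
      rw [hL]
      exact le_of_eq (by ring)
    exact_mod_cast this
  have hprog : ∀ D', 1 ≤ D' → D' ≤ B → ∀ (x : ZMod (2 * N)) (l : ℕ),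
      ∑ i ∈ Finset.range l, zmodInd (2 * N) A (x + i * (D' : ZMod (2 * N))) ≤
      (1 + 1 / 512) * (A.card / N) * (l + L / (B * B)) := by
    intro D' h1 h2 x l
    refine (sum_zmodInd_progression_le hN'1 hlam hinc h1 h2 x l).trans ?_
    gcongr
  have hcard : Fintype.card (LargePrime w Q) ≤ Q + 1 := by
    rw [Fintype.card_coe]
    exact (Finset.card_filter_le _ _).trans (Finset.card_range _).le
  have hDL : D * L * 1024 ≤ N := by
    calc D * L * 1024 ≤ B * (N' * B ^ (k + 2)) * B := by gcongr
      _ = N' * (B ^ (k + 4) * 1) := by ring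
      _ ≤ N' * (B ^ (k + 9) * d ^ k) := Nat.mul_le_mul_left _
          (Nat.mul_le_mul (Nat.pow_le_pow_right hB1 (by omega)) (Nat.one_le_pow _ _ hd))
      _ ≤ N' * (B * d) ^ E := Nat.mul_le_mul_left _ hBE
      _ ≤ N := hN'N
  have hαB : (B : ℝ)⁻¹ * 1024 ≤ A.card / N := by
    refine le_trans ?_ hα
    have h := hB.density
    have h1 : (2 : ℝ) ^ (64 * m ^ 3) * 1024 ≤ B := by
      calc (2 : ℝ) ^ (64 * m ^ 3) * 1024 = ((2 ^ (64 * m ^ 3 + 10) : ℕ) : ℝ) := by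
            push_cast; rw [pow_add]; norm_num
        _ ≤ B := Nat.cast_le.2 h
    exact inv_mul_le_inv_of_mul_le (pow_pos (by norm_num) _) h1
  refine false_of_fourier_correlation (n := fun p : LargePrime w Q => p.1 ^ J) (X := X) (A := A) (Z := Z)
    (L := L) (m := m) (D := D) hN1 hX1 hA (LargePrime.coprime J) hZ1 ?_ hm (by nlinarith) ?_ hα ?_ ?_ ?_ ?_
    (fun n => ((q.eval (n : ℤ) : ℤ) : ZMod (2 * N))) ?_ ?_
  · intro p
    calc p.1 ^ J ≤ Q ^ J := Nat.pow_le_pow_left p.le _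
      _ = Z := hQZ
  · refine le_trans ?_ (hlen.trans ((Nat.le_mul_of_pos_left _ hB1).trans hBB))
    have hc2 : Fintype.card (LargePrime w Q) + 1 ≤ Q + 2 := Nat.succ_le_succ hcard
    exact Nat.mul_le_mul_left _ (Nat.pow_le_pow_left (Nat.mul_le_mul_right _ (Nat.pow_le_pow_left hc2 m)) _)
  · intro U hU x
    have h1 := hprog _ (Nat.mul_pos hD1 (hprod1 U)) (hDprod U hU) x (L / (∏ i ∈ U, i.1 ^ J) + 1)
    exact prod_mul_sum_numeric (hprod1 U) (hprodB U hU) hB1024 hBB hα0 h1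
  · intro U hU
    have := hprodB U hU
    nlinarith
  · calc 1024 * (D * L) = D * L * 1024 := by ring
      _ ≤ N := hDL
  · intro x
    exact (hprog D hD1 hDB x L).trans (progression_numeric hB1024 hα0 (Nat.cast_nonneg _))
  · refine le_sum_fourier_of_no_difference hN1 hA ?_ hdiff ?_ ?_
    · intro h
      rw [h, natDegree_zero] at hdeg
      omega
    · rw [hdeg]
      exact degree_numeric hB1024 hB.coeff hαB hXB
    · intro n hn
      have h1 := Polynomial.abs_eval_natCast_le hdeg hcoef hX1 hn.le
      exact eval_numeric hB1024 hB.coeff hαB hXN h1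
  · intro r hr
    refine exists_character_of_large_sum hC hm hw hJ hQ hd hW hX1 ?_ ?_ r hr
    · calc (2 ^ (64 * m ^ 3 + 3) * d) ^ C ≤ (B * d) ^ C := by
            gcongr
            exact (Nat.pow_le_pow_right (by norm_num) (by omega)).trans hB.density
        _ ≤ (B * d) ^ (C + 2) := Nat.pow_le_pow_right hBd (by omega)
        _ ≤ X := hXlarge
    · calc 16 * (D * L * Q) ≤ B * (B * (N' * B ^ (k + 2)) * B) := by gcongr; omega
        _ = N' * B ^ (k + 5) := by ring
        _ ≤ X ^ k := hXk
end

end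

section

open Polynomial

theorem exists_dominates (k H C : ℕ) :
    ∃ a : ℕ, ∀ m : ℕ, 1 ≤ m → Dominates k H C m (2 ^ (2 ^ (a * m ^ 2))) := by
  refine ⟨66 * C + 26 + 16 * (k + 1) * (H + 1), fun m hm => ?_⟩
  set u : ℕ := 2 ^ m ^ 2 with hu
  have hm2 : 1 ≤ m ^ 2 := Nat.one_le_pow _ _ hm
  have hu2 : 2 ≤ u := Nat.le_self_pow (by omega) 2
  have hu1 : 1 ≤ u := by omega
  have hpow : ∀ a : ℕ, 2 ^ (a * m ^ 2) = u ^ a := fun a => by rw [hu, ← pow_mul, mul_comm]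
  have hn : ∀ n : ℕ, n ≤ u ^ n := fun n => (Nat.lt_pow_self (by omega)).le
  have h2 : ∀ n : ℕ, 2 ^ n ≤ u ^ n := fun n => Nat.pow_le_pow_left hu2 n
  have hmu : m ≤ u := calc
    m ≤ m ^ 2 := Nat.le_self_pow (by norm_num) m
    _ ≤ u := Nat.lt_two_pow_self.le
  have hm23 : 1 ≤ m ^ 3 := Nat.one_le_pow _ _ hm
  have hJ : C * (64 * m ^ 3 + 3) ≤ u ^ (C + 10) := by
    calc C * (64 * m ^ 3 + 3) ≤ u ^ C * (2 ^ 7 * m ^ 3) := by gcongr; exact hn C; omega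
      _ ≤ u ^ C * (u ^ 7 * u ^ 3) := by gcongr
      _ = _ := by ring
  set J := C * (64 * m ^ 3 + 3) with hJdef
  have hw : 2 ^ (64 * m ^ 2 * C) = u ^ (64 * C) := by rw [← hpow]; congr 1; ring
  have hle : ∀ {x y : ℕ}, x ≤ y → y ≤ 66 * C + 26 + 16 * (k + 1) * (H + 1) → u ^ x ≤ u ^ (66 * C + 26 + 16 * (k + 1) * (H + 1)) :=
    fun h1 h2 => Nat.pow_le_pow_right hu1 (h1.trans h2)
  rw [hpow]
  constructor
  · rw [← hJdef]
    have h1 : (2 ^ (64 * m ^ 2 * C)).factorial ^ J ≤ 2 ^ (64 * m ^ 2 * C * u ^ (64 * C) * J) := by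
      calc (2 ^ (64 * m ^ 2 * C)).factorial ^ J ≤ ((2 ^ (64 * m ^ 2 * C)) ^ (2 ^ (64 * m ^ 2 * C))) ^ J := by
            gcongr; exact Nat.factorial_le_pow _
        _ = _ := by rw [← hw, ← pow_mul, ← pow_mul, mul_assoc (64 * m ^ 2 * C)]
    refine (Nat.mul_le_mul_right _ h1).trans ?_
    rw [← pow_mul 2 (J * J) m, ← pow_add]
    refine Nat.pow_le_pow_right (by norm_num) (le_trans ?_ (hle (x := 66 * C + 26) le_rfl (by omega)))
    calc 64 * m ^ 2 * C * u ^ (64 * C) * J + J * J * m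
        ≤ u ^ 6 * u ^ 2 * u ^ C * u ^ (64 * C) * u ^ (C + 10) + u ^ (C + 10) * u ^ (C + 10) * u := by
          have := h2 6
          gcongr
          · omega
          · exact hn C
      _ = u ^ (66 * C + 18) + u ^ (2 * C + 21) := by ring
      _ ≤ u ^ (66 * C + 25) + u ^ (66 * C + 25) := by gcongr <;> omega
      _ = 2 * u ^ (66 * C + 25) := by ring
      _ ≤ u * u ^ (66 * C + 25) := by gcongr
      _ = _ := by ring
  · rw [← hJdef]
    have h1 : 2 ^ J + 2 ≤ 2 ^ (J + 2) := by
      have := Nat.one_le_two_pow (n := J)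
      rw [pow_add]
      omega
    calc (2 ^ (J * J)) ^ ((4 * m + 1) * m) * ((2 ^ J + 2) ^ m * 2 ^ m) ^ (4 * m)
        ≤ (2 ^ (J * J)) ^ ((4 * m + 1) * m) * ((2 ^ (J + 2)) ^ m * 2 ^ m) ^ (4 * m) := by gcongr
      _ = 2 ^ (J * J * ((4 * m + 1) * m) + ((J + 2) * m + m) * (4 * m)) := by
        rw [← pow_mul, ← pow_mul, ← pow_add, ← pow_mul, ← pow_add]
      _ ≤ _ := by
        refine Nat.pow_le_pow_right (by norm_num) (le_trans ?_ (hle (x := 66 * C + 26) le_rfl (by omega)))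
        have hc1 := Nat.one_le_pow (C + 10) u hu1
        have h4 : 4 ≤ u ^ 2 := h2 2
        have h8 : 8 ≤ u ^ 3 := h2 3
        calc J * J * ((4 * m + 1) * m) + ((J + 2) * m + m) * (4 * m)
            ≤ J * J * ((8 * m) * m) + ((J + 3) * m) * (4 * m) := by
              gcongr
              · omega
              · exact le_of_eq (by ring)
          _ ≤ u ^ (C + 10) * u ^ (C + 10) * (u ^ 3 * u * u) + (u ^ 2 * u ^ (C + 10)) * u * (u ^ 2 * u) := by
              gcongr
              calc J + 3 ≤ 4 * u ^ (C + 10) := by omega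
                _ ≤ _ := by gcongr
          _ = u ^ (2 * C + 25) + u ^ (C + 16) := by ring
          _ ≤ u ^ (66 * C + 25) + u ^ (66 * C + 25) := by gcongr <;> omega
          _ = 2 * u ^ (66 * C + 25) := by ring
          _ ≤ u * u ^ (66 * C + 25) := by gcongr
          _ = _ := by ring
  · refine Nat.pow_le_pow_right (by norm_num) (le_trans ?_ (hle (x := 10) le_rfl (by omega)))
    calc 64 * m ^ 3 + 10 ≤ 2 ^ 7 * m ^ 3 := by omega
      _ ≤ u ^ 7 * u ^ 3 := by gcongr
      _ = _ := by ring
  · exact Nat.pow_le_pow_right (by norm_num) (hJ.trans (hle le_rfl (by omega)))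
  · refine (Nat.lt_two_pow_self).le.trans (Nat.pow_le_pow_right (by norm_num) ?_)
    exact (hn _).trans (hle le_rfl (by omega))
  · refine Nat.pow_le_pow_right (by norm_num) ((hn k).trans (hle le_rfl ?_))
    nlinarith [Nat.zero_le (k * H)]

section
variable {k H C m B d N E : ℕ} {hd : ℕ → ℤ[X]} {lam : ℕ → ℕ} {A : Finset ℕ} [NeZero (2 * N)]

/-- Passing to a progression of difference `lam D` turns a set without differences in `hd d` into
one without differences in `hd (d * D)`. -/
theorem eq_of_sub_eq_eval {D N' : ℕ} (hA : A ⊆ Finset.range N)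
    (hcomp : ∀ n : ℕ, ∃ n' : ℕ, (lam D : ℤ) * (hd (d * D)).eval (n : ℤ) = (hd d).eval (n' : ℤ))
    (hlam : 1 ≤ lam D) (hlamN : lam D * N' ≤ N)
    (hdiff : ∀ a ∈ A, ∀ a' ∈ A, ∀ n : ℕ, (a : ℤ) - a' = (hd d).eval (n : ℤ) → a = a') (x : ZMod (2 * N))
    {j j' n : ℕ} (hj : j < N') (hj' : j' < N') (hjA : (x + (lam D * j : ℕ)).val ∈ A)
    (hjA' : (x + (lam D * j' : ℕ)).val ∈ A) (h : (j : ℤ) - j' = (hd (d * D)).eval (n : ℤ)) : j = j' := by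
  obtain ⟨n', hn'⟩ := hcomp n
  rw [← h] at hn'
  set a := (x + (lam D * j : ℕ)).val with ha
  set a' := (x + (lam D * j' : ℕ)).val with ha'
  have haN := Finset.mem_range.1 (hA hjA)
  have haN' := Finset.mem_range.1 (hA hjA')
  have h1 : lam D * j < N := (Nat.mul_lt_mul_of_pos_left hj hlam).trans_le hlamN
  have h2 : lam D * j' < N := (Nat.mul_lt_mul_of_pos_left hj' hlam).trans_le hlamN
  have h3 : (((a : ℤ) - a' - ((lam D * j : ℕ) - (lam D * j' : ℕ)) : ℤ) : ZMod (2 * N)) = 0 := by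
    push_cast
    rw [ha, ha', ZMod.natCast_zmod_val, ZMod.natCast_zmod_val]
    push_cast
    ring
  rw [ZMod.intCast_zmod_eq_zero_iff_dvd] at h3
  have h4 : (a : ℤ) - a' - ((lam D * j : ℕ) - (lam D * j' : ℕ)) = 0 := by
    refine Int.eq_zero_of_abs_lt_dvd h3 ?_
    rw [abs_lt]
    push_cast
    constructor <;> omega
  have h5 : a = a' := hdiff a hjA a' hjA' n' (by rw [← hn']; push_cast at h4; linarith)
  rw [h5] at h4
  have h6 : (lam D * j : ℕ) = lam D * j' := by omega
  exact Nat.eq_of_mul_eq_mul_left hlam h6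

theorem exists_denser_set (hk : 1 ≤ k) (hC : 1 ≤ C) (hm : 1 ≤ m) (hB : Dominates k H C m B)
    (hE1 : k + 9 ≤ E) (hE2 : k * (C + 3) + 4 ≤ 2 * E)
    (hlam : ∀ d, 1 ≤ d → 1 ≤ lam d ∧ lam d ≤ d ^ k ∧ d ∣ lam d) (hd1 : 1 ≤ d)
    (hcomp : ∀ d t, 1 ≤ d → 1 ≤ t → ∀ n : ℕ, ∃ n' : ℕ,
      (lam t : ℤ) * (hd (d * t)).eval (n : ℤ) = (hd d).eval (n' : ℤ))
    (hdeg : (hd d).natDegree = k) (hcoef : ∀ j, |(hd d).coeff j| ≤ (H : ℤ) * d ^ k)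
    (hW : ∀ T : ℝ, 2 ≤ T → ∀ X : ℕ, (T * d) ^ C ≤ X → ∀ θ : ℝ,
        X / T ≤ ‖∑ n ∈ Finset.range X, ex (θ * ((hd d).eval (n : ℤ) : ℤ))‖ →
        ∃ Q : ℕ, 1 ≤ Q ∧ (Q : ℝ) ≤ T ^ C ∧ NearInt (Q * θ) (T ^ C / X ^ k))
    (hN : (B * d) ^ (2 * E) ≤ N) (hA : A ⊆ Finset.range N)
    (hα : ((2 : ℝ) ^ (64 * m ^ 3))⁻¹ ≤ A.card / N)
    (hdiff : ∀ a ∈ A, ∀ a' ∈ A, ∀ n : ℕ, (a : ℤ) - a' = (hd d).eval (n : ℤ) → a = a') :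
    ∃ D, 1 ≤ D ∧ D ≤ B ∧ ∃ A' ⊆ Finset.range (N / (B * d) ^ E),
      (1 + 1 / 512) * (A.card / N : ℝ) * (N / (B * d) ^ E : ℕ) ≤ A'.card ∧
      ∀ a ∈ A', ∀ a' ∈ A', ∀ n : ℕ, (a : ℤ) - a' = (hd (d * D)).eval (n : ℤ) → a = a' := by
  obtain ⟨D, hD1, hDB, x, hx⟩ := exists_density_increment hk hC hm hB hE1 hE2 hlam hd1 hdeg hcoef hW hN hA hα hdiff
  refine ⟨D, hD1, hDB, (Finset.range (N / (B * d) ^ E)).filter fun j => (x + (lam D * j : ℕ)).val ∈ A,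
    Finset.filter_subset _ _, hx.le.trans (le_of_eq ?_), fun j hj j' hj' n h => ?_⟩
  · rw [Finset.card_filter]
    push_cast
    refine Finset.sum_congr rfl fun j _ => ?_
    simp [zmodInd]
  · rw [Finset.mem_filter, Finset.mem_range] at hj hj'
    refine eq_of_sub_eq_eval hA (hcomp d D hd1 hD1) (hlam D hD1).1 ?_ hdiff x hj.1 hj'.1 hj.2 hj'.2 h
    have hB1 : 1 ≤ B := hD1.trans hDB
    calc lam D * (N / (B * d) ^ E) ≤ (B * d) ^ E * (N / (B * d) ^ E) := by
          refine Nat.mul_le_mul_right _ ?_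
          calc lam D ≤ D ^ k := (hlam D hD1).2.1
            _ ≤ (B * d) ^ k := Nat.pow_le_pow_left (hDB.trans (Nat.le_mul_of_pos_right _ hd1)) k
            _ ≤ (B * d) ^ E := Nat.pow_le_pow_right (Nat.mul_pos hB1 hd1) (by omega)
      _ ≤ N := Nat.mul_div_le _ _

end

end

section

open Polynomial

theorem two_mul_le_one_add_pow (n : ℕ) : (2 : ℝ) ^ n ≤ (1 + 1 / 512) ^ (512 * n) := by
  rw [pow_mul]
  refine pow_le_pow_left₀ (by norm_num) ?_ n
  have := one_add_mul_le_pow (a := (1 / 512 : ℝ)) (by norm_num) 512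
  norm_num at this ⊢
  linarith

/-- Iterating the density increment: very dense sets of large intervals contain a nontrivial difference. -/
theorem card_lt_of_intersective {h : ℤ[X]} (hint : Intersective h) {k : ℕ} (hk : 1 ≤ k)
    (hdeg : h.natDegree = k) :
    ∃ K : ℕ, 1 ≤ K ∧ ∀ m : ℕ, 1 ≤ m → ∀ N : ℕ, 2 ^ (2 ^ (K * m ^ 2)) ≤ N → ∀ A ⊆ Finset.range N,
      (∀ a ∈ A, ∀ a' ∈ A, ∀ n : ℕ, 1 ≤ n → (a : ℤ) - a' = h.eval (n : ℤ) → a = a') →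
      (A.card / N : ℝ) < ((2 : ℝ) ^ (64 * m ^ 3))⁻¹ := by
  obtain ⟨R0, H, hR0, -, lam, hd, hlam, -, hpoly, hcomp, h1⟩ := exists_intersective_data hint hdeg
  obtain ⟨C, hC, hW⟩ := exists_denominator_of_large_sum hk R0 H hR0
  obtain ⟨a, ha⟩ := exists_dominates k H C
  set E := k * (C + 3) + 9 with hE
  have hE1 : k + 9 ≤ E := by nlinarith [Nat.zero_le (k * C)]
  have hE2 : k * (C + 3) + 4 ≤ 2 * E := by omega
  refine ⟨a + 2 * E + 38, by omega, fun m hm N hN A hA hdiff => ?_⟩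
  by_contra! hα
  set B := 2 ^ (2 ^ (a * m ^ 2)) with hB
  have hdom : Dominates k H C m B := ha m hm
  have hB2 : 2 ≤ B := Nat.le_self_pow (by positivity) 2
  have hB1 : 1 ≤ B := by omega
  set I := 512 * (64 * m ^ 3 + 1) with hI
  set F := 2 * E * I with hF
  have hNF : B ^ (F * I) ≤ N := by
    refine le_trans ?_ hN
    rw [hB, ← pow_mul]
    refine Nat.pow_le_pow_right (by norm_num) ?_
    set u : ℕ := 2 ^ m ^ 2 with hu
    have hm2 : 1 ≤ m ^ 2 := Nat.one_le_pow _ _ hm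
    have hu2 : 2 ≤ u := Nat.le_self_pow (by omega) 2
    have hpow : ∀ a : ℕ, 2 ^ (a * m ^ 2) = u ^ a := fun a => by rw [hu, ← pow_mul, mul_comm]
    have h2 : ∀ n : ℕ, 2 ^ n ≤ u ^ n := fun n => Nat.pow_le_pow_left hu2 n
    have hmu : m ≤ u := calc
      m ≤ m ^ 2 := Nat.le_self_pow (by norm_num) m
      _ ≤ u := Nat.lt_two_pow_self.le
    have hm3 : 1 ≤ m ^ 3 := Nat.one_le_pow _ _ hm
    have hIu : I ≤ u ^ 19 := by
      calc I ≤ 2 ^ 16 * m ^ 3 := by rw [hI]; omega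
        _ ≤ u ^ 16 * u ^ 3 := by have := h2 16; gcongr
        _ = _ := by ring
    rw [hpow, hpow]
    calc u ^ a * (F * I) ≤ u ^ a * (u ^ (2 * E) * u ^ 19 * u ^ 19) := by
          rw [hF]
          have := (Nat.lt_pow_self (n := 2 * E) (by omega : 1 < u)).le
          gcongr
      _ = _ := by ring
  have key : ∀ i ≤ I, ∃ d M : ℕ, ∃ S ⊆ Finset.range M, 1 ≤ d ∧ d ≤ B ^ i ∧ 1 ≤ M ∧ N ≤ M * B ^ (F * i) ∧
      (1 + 1 / 512) ^ i * ((2 : ℝ) ^ (64 * m ^ 3))⁻¹ ≤ S.card / M ∧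
      ∀ a ∈ S, ∀ a' ∈ S, ∀ n : ℕ, (a : ℤ) - a' = (hd d).eval (n : ℤ) → a = a' := by
    intro i
    induction i with
    | zero =>
      intro _
      refine ⟨1, N, A, hA, le_rfl, by simp, (Nat.pow_pos hB1).trans_le hNF, by simp, by simpa using hα, ?_⟩
      intro b hb b' hb' n hn
      obtain ⟨n', hn', hnn⟩ := h1 n
      exact hdiff b hb b' hb' n' hn' (hn.trans hnn)
    | succ i ih =>
      intro hi
      obtain ⟨d, M, S, hS, hd1, hdB, hM1, hNM, hdens, hSd⟩ := ih (by omega)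
      have : NeZero (2 * M) := ⟨by omega⟩
      have hBd1 : 1 ≤ B * d := Nat.mul_pos hB1 hd1
      have hBdF : (B * d) ^ (2 * E) ≤ B ^ F := by
        calc (B * d) ^ (2 * E) ≤ (B * B ^ i) ^ (2 * E) := by gcongr
          _ = B ^ (2 * E * (i + 1)) := by rw [← pow_succ', ← pow_mul, mul_comm]
          _ ≤ B ^ F := Nat.pow_le_pow_right hB1 (Nat.mul_le_mul_left _ hi)
      have hMlarge : B ^ F ≤ M := by
        have h3 : B ^ F * B ^ (F * i) ≤ M * B ^ (F * i) := by
          refine le_trans ?_ (hNF.trans hNM)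
          rw [← pow_add]
          refine Nat.pow_le_pow_right hB1 ?_
          calc F + F * i = F * (i + 1) := by ring
            _ ≤ F * I := Nat.mul_le_mul_left _ hi
        exact Nat.le_of_mul_le_mul_right h3 (Nat.pow_pos hB1)
      obtain ⟨hp1, hp2, hp3⟩ := hpoly d hd1
      have hge1 : (1 : ℝ) ≤ (1 + 1 / 512) ^ i := one_le_pow₀ (by norm_num)
      have hdens' : ((2 : ℝ) ^ (64 * m ^ 3))⁻¹ ≤ S.card / M :=
        (le_mul_of_one_le_left (by positivity) hge1).trans hdens
      obtain ⟨D, hD1, hDB, S', hS', hcard, hSd'⟩ := exists_denser_set hk hC hm hdom hE1 hE2 hlam hd1 hcomp hp1 hp2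
        (hW d hd1 (hd d) hp1 hp2 hp3) (hBdF.trans hMlarge) hS hdens' hSd
      have hpE : 0 < (B * d) ^ E := Nat.pow_pos hBd1
      have hM' : 1 ≤ M / (B * d) ^ E := by
        rw [Nat.one_le_div_iff hpE]
        exact (Nat.pow_le_pow_right hBd1 (by omega)).trans (hBdF.trans hMlarge)
      refine ⟨d * D, M / (B * d) ^ E, S', hS', Nat.mul_pos hd1 hD1, ?_, hM', ?_, ?_, hSd'⟩
      · rw [pow_succ]
        exact Nat.mul_le_mul hdB hDB
      · have h4 : M ≤ M / (B * d) ^ E * B ^ F := by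
          have h5 : M < (M / (B * d) ^ E + 1) * (B * d) ^ E := by
            rw [mul_comm]; exact Nat.lt_mul_div_succ M hpE
          have h6 : 2 ≤ (B * d) ^ E := by
            calc 2 ≤ B * d := hB2.trans (Nat.le_mul_of_pos_right _ hd1)
              _ ≤ _ := Nat.le_self_pow (by omega) _
          calc M ≤ (M / (B * d) ^ E + 1) * (B * d) ^ E := h5.le
            _ ≤ (M / (B * d) ^ E * 2) * (B * d) ^ E := by gcongr; omega
            _ ≤ (M / (B * d) ^ E * (B * d) ^ E) * (B * d) ^ E := by gcongr
            _ = M / (B * d) ^ E * (B * d) ^ (2 * E) := by ring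
            _ ≤ _ := Nat.mul_le_mul_left _ hBdF
        calc N ≤ M * B ^ (F * i) := hNM
          _ ≤ M / (B * d) ^ E * B ^ F * B ^ (F * i) := Nat.mul_le_mul_right _ h4
          _ = _ := by ring
      · have hM'0 : (0 : ℝ) < (M / (B * d) ^ E : ℕ) := by exact_mod_cast hM'
        rw [le_div_iff₀ hM'0]
        refine le_trans ?_ hcard
        rw [pow_succ', mul_assoc (1 + 1 / 512 : ℝ)]
        gcongr
  obtain ⟨d, M, S, hS, -, -, hM1, -, hdens, -⟩ := key I le_rfl
  have hM0 : (0 : ℝ) < M := by exact_mod_cast hM1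
  have hle : (S.card : ℝ) / M ≤ 1 := by
    rw [div_le_one hM0]
    have := Finset.card_le_card hS
    rw [Finset.card_range] at this
    exact_mod_cast this
  have h2 : (2 : ℝ) ≤ (1 + 1 / 512) ^ I * ((2 : ℝ) ^ (64 * m ^ 3))⁻¹ := by
    rw [le_mul_inv_iff₀ (by positivity), ← pow_succ']
    exact two_mul_le_one_add_pow _
  linarith

end

section

open Polynomial Filter Topology

theorem eventually_log_log_le (c : ℝ) (K : ℕ) :
    ∀ᶠ l : ℝ in atTop, c * Real.log (Real.log l) * (K : ℝ) ^ (3 / 2 : ℝ) ≤ l ^ (1 / 2 : ℝ) := by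
  have h1 : ∀ᶠ l : ℝ in atTop, ‖Real.log l‖ ≤ (|c| * (K : ℝ) ^ (3 / 2 : ℝ) + 1)⁻¹ * ‖l ^ (1 / 2 : ℝ)‖ :=
    (isLittleO_log_rpow_atTop (by norm_num : (0 : ℝ) < 1 / 2)).def (by positivity)
  filter_upwards [h1, eventually_ge_atTop (Real.exp 1)] with l hl he
  have hl0 : 0 < l := (Real.exp_pos 1).trans_le he
  have hlog1 : 1 ≤ Real.log l := by rwa [Real.le_log_iff_exp_le hl0]
  have hll0 : 0 ≤ Real.log (Real.log l) := Real.log_nonneg hlog1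
  have hll : Real.log (Real.log l) ≤ Real.log l := (Real.log_le_sub_one_of_pos (by linarith)).trans (by linarith)
  rw [Real.norm_of_nonneg (by linarith), Real.norm_of_nonneg (by positivity)] at hl
  set W : ℝ := (K : ℝ) ^ (3 / 2 : ℝ)
  have hW : 0 ≤ W := by positivity
  have hpos : 0 < |c| * W + 1 := by positivity
  calc c * Real.log (Real.log l) * W ≤ |c| * Real.log l * W := by
        gcongr
        exact le_abs_self c
    _ ≤ (|c| * W + 1) * Real.log l := by nlinarith
    _ ≤ (|c| * W + 1) * ((|c| * W + 1)⁻¹ * l ^ (1 / 2 : ℝ)) := by gcongr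
    _ = l ^ (1 / 2 : ℝ) := by field_simp

theorem exists_nat_sq_le {K : ℕ} (hK : 1 ≤ K) {c l : ℝ} (hl : (K : ℝ) ≤ l)
    (hc : c * Real.log (Real.log l) * (K : ℝ) ^ (3 / 2 : ℝ) ≤ l ^ (1 / 2 : ℝ)) :
    ∃ m : ℕ, 1 ≤ m ∧ (K : ℝ) * m ^ 2 ≤ l ∧ c * Real.log (Real.log l) * l ≤ 64 * m ^ 3 * Real.log 2 := by
  have hK0 : (0 : ℝ) < K := by exact_mod_cast hK
  have hl0 : 0 < l := hK0.trans_le hl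
  set s : ℝ := Real.sqrt (l / K) with hs
  have hs2 : s ^ 2 = l / K := Real.sq_sqrt (by positivity)
  have hs1 : 1 ≤ s := by
    rw [hs, Real.one_le_sqrt, one_le_div hK0]
    exact hl
  have hm1 : 1 ≤ ⌊s⌋₊ := (Nat.one_le_floor_iff s).2 hs1
  have hms : (⌊s⌋₊ : ℝ) ≤ s := Nat.floor_le (by linarith)
  have hsm : s ≤ 2 * ⌊s⌋₊ := by
    have := Nat.lt_floor_add_one s
    have h1 : (1 : ℝ) ≤ ⌊s⌋₊ := by exact_mod_cast hm1
    linarith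
  refine ⟨⌊s⌋₊, hm1, ?_, ?_⟩
  · calc (K : ℝ) * (⌊s⌋₊ : ℝ) ^ 2 ≤ K * s ^ 2 := by gcongr
      _ = l := by rw [hs2]; field_simp
  · have hlog2 : (1 : ℝ) / 8 ≤ Real.log 2 := by have := Real.log_two_gt_d9; linarith
    have hW : (0 : ℝ) < (K : ℝ) ^ (3 / 2 : ℝ) := by positivity
    have hs3 : s ^ 3 * (K : ℝ) ^ (3 / 2 : ℝ) = l ^ (1 / 2 : ℝ) * l := by
      have h1 : s = (l / K) ^ (1 / 2 : ℝ) := Real.sqrt_eq_rpow _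
      rw [h1, ← Real.rpow_natCast, ← Real.rpow_mul (by positivity), Real.div_rpow hl0.le hK0.le]
      norm_num
      rw [div_mul_cancel₀ _ hW.ne']
      nth_rewrite 3 [← Real.rpow_one l]
      rw [← Real.rpow_add hl0]
      norm_num
    have h2 : c * Real.log (Real.log l) * l ≤ s ^ 3 := by
      refine le_of_mul_le_mul_right ?_ hW
      rw [hs3]
      calc c * Real.log (Real.log l) * l * (K : ℝ) ^ (3 / 2 : ℝ) =
          c * Real.log (Real.log l) * (K : ℝ) ^ (3 / 2 : ℝ) * l := by ring
        _ ≤ _ := by gcongr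
    calc c * Real.log (Real.log l) * l ≤ s ^ 3 := h2
      _ ≤ (2 * ⌊s⌋₊) ^ 3 := by gcongr
      _ = 64 * (⌊s⌋₊ : ℝ) ^ 3 * (1 / 8) := by ring
      _ ≤ _ := by gcongr

theorem two_pow_two_pow_le {K m N : ℕ} (hN : 3 ≤ N) (h : (K : ℝ) * m ^ 2 ≤ Real.log (Real.log N)) :
    2 ^ 2 ^ (K * m ^ 2) ≤ N := by
  have hN0 : (0 : ℝ) < N := by exact_mod_cast (by omega : 0 < N)
  have h2 : Real.log 2 ≤ 1 := by have := Real.log_two_lt_d9; linarith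
  have h20 : 0 < Real.log 2 := Real.log_pos (by norm_num)
  have hlN : 0 < Real.log N := Real.log_pos (by exact_mod_cast (by omega : 1 < N))
  have h3 : ((2 : ℝ) ^ (K * m ^ 2)) ≤ Real.log N := by
    rw [← Real.log_le_log_iff (by positivity) hlN, Real.log_pow]
    refine le_trans ?_ h
    push_cast
    nlinarith [mul_nonneg (Nat.cast_nonneg (α := ℝ) K) (sq_nonneg (m : ℝ))]
  have h4 : ((2 : ℝ) ^ (2 ^ (K * m ^ 2))) ≤ N := by
    rw [← Real.log_le_log_iff (by positivity) hN0, Real.log_pow]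
    push_cast
    calc (2 : ℝ) ^ (K * m ^ 2) * Real.log 2 ≤ 2 ^ (K * m ^ 2) * 1 := by gcongr
      _ ≤ _ := by rw [mul_one]; exact h3
  exact_mod_cast h4

theorem inv_two_pow_le_rpow {m : ℕ} {c y : ℝ} (hy : 0 < y)
    (h : c * Real.log (Real.log (Real.log y)) * Real.log y ≤ 64 * m ^ 3 * Real.log 2) :
    ((2 : ℝ) ^ (64 * m ^ 3))⁻¹ ≤ y ^ (-(c * Real.log (Real.log (Real.log y)))) := by
  rw [← Real.log_le_log_iff (by positivity) (by positivity), Real.log_inv, Real.log_pow, Real.log_rpow hy]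
  push_cast
  linarith

theorem exists_const_forall_of_eventually {f : ℕ → ℝ} (hf : ∀ N, 16 ≤ N → 0 < f N) (N₁ : ℕ) :
    ∃ C : ℝ, 1 ≤ C ∧ ∀ N, 16 ≤ N → N < N₁ → 1 ≤ C * f N := by
  refine ⟨1 + ∑ N ∈ Finset.range N₁, |f N|⁻¹, ?_, fun N hN hN₁ => ?_⟩
  · have : 0 ≤ ∑ N ∈ Finset.range N₁, |f N|⁻¹ := Finset.sum_nonneg fun _ _ => by positivity
    linarith
  · have h1 : |f N|⁻¹ ≤ ∑ N ∈ Finset.range N₁, |f N|⁻¹ :=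
      Finset.single_le_sum (f := fun N => |f N|⁻¹) (fun _ _ => by positivity) (Finset.mem_range.2 hN₁)
    have h2 := hf N hN
    rw [abs_of_pos h2] at h1
    calc 1 = (f N)⁻¹ * f N := (inv_mul_cancel₀ h2.ne').symm
      _ ≤ _ := by gcongr; linarith

/-- The bound for sets in `{1, …, N}` when `N` is sufficiently large. -/
theorem eventually_card_le {h : ℤ[X]} (hint : Intersective h) {k : ℕ} (hk : 1 ≤ k)
    (hdeg : h.natDegree = k) (c : ℝ) :
    ∀ᶠ N : ℕ in atTop, ∀ A ⊆ Finset.Icc 1 N,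
      (∀ a ∈ A, ∀ a' ∈ A, a ≠ a' → ∀ n : ℕ, 1 ≤ n → (a : ℤ) - (a' : ℤ) ≠ h.eval (n : ℤ)) →
      (A.card : ℝ) ≤ N * Real.log N ^ (-(c * Real.log (Real.log (Real.log (Real.log N))))) := by
  obtain ⟨K, hK, hcard⟩ := card_lt_of_intersective hint hk hdeg
  have hlim : Tendsto (fun N : ℕ => Real.log (Real.log N)) atTop atTop :=
    Real.tendsto_log_atTop.comp (Real.tendsto_log_atTop.comp tendsto_natCast_atTop_atTop)
  filter_upwards [hlim.eventually (eventually_log_log_le c K), hlim.eventually (eventually_ge_atTop (K : ℝ)),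
    eventually_ge_atTop 3] with N h1 h2 hN A hA hdiff
  obtain ⟨m, hm1, hmK, hmc⟩ := exists_nat_sq_le hK h2 h1
  have hN0 : (0 : ℝ) < N := by exact_mod_cast (by omega : 0 < N)
  have hlN : 0 < Real.log N := Real.log_pos (by exact_mod_cast (by omega : 1 < N))
  have hA1 : ∀ a ∈ A, 1 ≤ a ∧ a ≤ N := fun a ha => Finset.mem_Icc.1 (hA ha)
  have hinj : Set.InjOn (fun a => a - 1) (A : Set ℕ) := by
    intro a ha a' ha' h
    have h3 := hA1 a ha
    have h4 := hA1 a' ha'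
    simp only at h
    omega
  have hlt := hcard m hm1 N (two_pow_two_pow_le hN hmK) (A.image fun a => a - 1) (by
      intro x hx
      obtain ⟨a, ha, rfl⟩ := Finset.mem_image.1 hx
      have := hA1 a ha
      exact Finset.mem_range.2 (by omega)) (by
      intro x hx x' hx' n hn hxn
      obtain ⟨a, ha, rfl⟩ := Finset.mem_image.1 hx
      obtain ⟨a', ha', rfl⟩ := Finset.mem_image.1 hx'
      by_contra hne
      have h3 := hA1 a ha
      have h4 := hA1 a' ha'
      refine hdiff a ha a' ha' (fun h => hne (by rw [h])) n hn ?_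
      rw [← hxn]
      omega)
  rw [Finset.card_image_of_injOn hinj, div_lt_iff₀ hN0] at hlt
  calc (A.card : ℝ) ≤ ((2 : ℝ) ^ (64 * m ^ 3))⁻¹ * N := hlt.le
    _ ≤ Real.log N ^ (-(c * Real.log (Real.log (Real.log (Real.log N))))) * N := by
        have := inv_two_pow_le_rpow hlN hmc
        gcongr
    _ = _ := mul_comm _ _

end

/-- **Furstenberg–Sárközy theorem, best-known bounds, maximal extension.**
If `h ∈ ℤ[x]` is intersective of degree `k ≥ 2` and `0 < c < 1/log((k²+k)/2)`, then any
`A ⊆ {1,…,N}` with no difference of distinct elements of the form `h(n)`, `n ≥ 1`, satisfies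
`|A| ≤ C · N · (log N)^{-c·log log log log N}`. -/
theorem furstenberg_sarkozy_intersective
    (h : Polynomial ℤ) (k : ℕ) (hk : 2 ≤ k) (hdeg : h.natDegree = k)
    (hint : Intersective h) (c : ℝ) (hc0 : 0 < c)
    (hc1 : c < 1 / Real.log (((k : ℝ) ^ 2 + k) / 2)) :
    ∃ C : ℝ, 0 < C ∧ ∀ N : ℕ, 16 ≤ N → ∀ A : Finset ℕ, A ⊆ Finset.Icc 1 N →
      (∀ a ∈ A, ∀ a' ∈ A, a ≠ a' → ∀ n : ℕ, 1 ≤ n → (a : ℤ) - (a' : ℤ) ≠ h.eval (n : ℤ)) →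
      (A.card : ℝ) ≤ C * N *
        Real.log N ^ (-(c * Real.log (Real.log (Real.log (Real.log N))))) := by
  obtain ⟨N₁, hN₁⟩ := Filter.eventually_atTop.1 (eventually_card_le hint (by omega : 1 ≤ k) hdeg c)
  have hpos : ∀ N : ℕ, 16 ≤ N → 0 < Real.log N ^ (-(c * Real.log (Real.log (Real.log (Real.log N))))) :=
    fun N hN => Real.rpow_pos_of_pos (Real.log_pos (by exact_mod_cast (by omega : 1 < N))) _
  obtain ⟨C, hC1, hC⟩ := exists_const_forall_of_eventually hpos N₁
  refine ⟨C, by linarith, fun N hN A hA hdiff => ?_⟩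
  have hf := hpos N hN
  rcases le_or_gt N₁ N with hle | hlt
  · refine (hN₁ N hle A hA hdiff).trans ?_
    rw [mul_assoc]
    exact le_mul_of_one_le_left (by positivity) hC1
  · have h1 : (A.card : ℝ) ≤ N := by
      have := Finset.card_le_card hA
      rw [Nat.card_Icc, Nat.add_sub_cancel] at this
      exact_mod_cast this
    calc (A.card : ℝ) ≤ N * 1 := by rwa [mul_one]
      _ ≤ N * (C * Real.log N ^ (-(c * Real.log (Real.log (Real.log (Real.log N)))))) := by
          gcongr
          exact hC N hN hlt
      _ = _ := by ring
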